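/- For every fixed ε > 0 there exists δ = δ(ε) > 0 such that for all sufficiently large integers m and all positive integers N₁, N₂, N₃ with N₁N₂N₃ > m^(1+ε), the number of residue classes modulo m of the form x₁x₂x₃ with integers x_j ∈ [1, N_j] equals m + O(m^(1-δ)). In particular the cardinality of the set {x₁x₂x₃ mod m : x_j ∈ [1, N_j]} is at least m - C·m^(1-δ) for some constant C depending only on ε. -/

import Mathlib

namespace ThreeProducts

section Stepanov

open Polynomial

theorem stepanov_count {F : Type*} [Field F] [Fintype F] [DecidableEq F] (p e M d c r : ℕ)
    [ExpChar F p] (hMp : M = p ^ e) (hq : Fintype.card F = M ^ 2) (hM : M = c * d + 1)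
    (hd : 2 ≤ d) (hr : r + 8 ≤ M) (U V : F[X]) (hU0 : U ≠ 0) (hV0 : V ≠ 0)
    (hU : U.natDegree = r) (hV : V.natDegree + 1 = r) (ω : F) :
    (Finset.univ.filter fun x : F => U.eval x ≠ 0 ∧ V.eval x ≠ 0 ∧
      U.eval x ^ (c * (M + 1)) = ω * V.eval x ^ (c * (M + 1))).card ≤ c * M + M * (2 * r + 5) := by
  classical
  set J := c + r + 4 with hJ
  have hc : 0 < c := by
    rcases Nat.eq_zero_or_pos c with h | h
    · subst h; omega
    · exact h
  let R := Fin d × Fin J → Fin c → F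
  let pol : (Fin c → F) → F[X] := fun v => ∑ k : Fin c, C (v k) * X ^ (k : ℕ)
  have pol_sub : ∀ v w, pol (v - w) = pol v - pol w := by
    intro v w
    simp only [pol, Pi.sub_apply, C_sub, sub_mul, Finset.sum_sub_distrib]
  have pol_coeff : ∀ v (k : Fin c), (pol v).coeff k = v k := by
    intro v k
    simp [pol, finsetSum_coeff, coeff_C_mul, coeff_X_pow, Fin.val_inj]
  have pol_deg : ∀ v, (pol v).natDegree < c := by
    intro v
    refine lt_of_le_of_lt (natDegree_sum_le_of_forall_le (n := c - 1) _ _ ?_) (by omega)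
    intro k _
    refine (natDegree_C_mul_X_pow_le _ _).trans ?_
    have := k.2; omega
  let W : ℕ := M * c + J + c * d * r
  let δ : R → F[X] := fun v => ∑ s : Fin d × Fin J,
    (pol (v s)) ^ M * (C (ω ^ (s.1 : ℕ)) * X ^ (s.2 : ℕ) * V ^ (c * s.1) * U ^ (c * (d - s.1)))
  have δ_sub : ∀ v w, δ (v - w) = δ v - δ w := by
    intro v w
    simp only [δ]
    rw [← Finset.sum_sub_distrib]
    refine Finset.sum_congr rfl fun s _ => ?_
    rw [← sub_mul, show (v - w) s = v s - w s from rfl, pol_sub, hMp]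
    congr 1
    exact sub_pow_expChar_pow (R := F[X]) (p := p) _ _ _
  have δ_deg : ∀ v, (δ v).natDegree < W := by
    intro v
    refine lt_of_le_of_lt (natDegree_sum_le_of_forall_le (n := W - 1) _ _ ?_) (by simp only [W]; omega)
    rintro ⟨i, j⟩ _
    have h1 : ((pol (v (i, j))) ^ M).natDegree ≤ M * (c - 1) :=
      (natDegree_pow_le).trans (Nat.mul_le_mul_left _ (by have := pol_deg (v (i, j)); omega))
    have h2 : (C (ω ^ (i : ℕ)) * X ^ (j : ℕ) * V ^ (c * i) * U ^ (c * (d - i))).natDegree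
        ≤ j + c * d * r := by
      refine (natDegree_mul_le).trans ?_
      have a1 : (U ^ (c * (d - (i:ℕ)))).natDegree ≤ c * (d - i) * r := by
        rw [natDegree_pow, hU]
      have a2 : (V ^ (c * (i:ℕ))).natDegree ≤ c * i * r := by
        rw [natDegree_pow]; exact Nat.mul_le_mul_left _ (by omega)
      have a3 : (C (ω ^ (i : ℕ)) * X ^ (j : ℕ) * V ^ (c * i)).natDegree ≤ j + c * i * r :=
        (natDegree_mul_le).trans (add_le_add (natDegree_C_mul_X_pow_le _ _) a2)
      have a4 : c * i * r + c * (d - i) * r = c * d * r := by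
        rw [← add_mul, ← mul_add]; congr 2; have := i.2; omega
      omega
    refine (natDegree_mul_le).trans ?_
    have h3 : M * (c - 1) ≤ M * c - M := by rw [Nat.mul_sub, mul_one]
    have h4 : M ≤ M * c := Nat.le_mul_of_pos_right _ hc
    have := j.2
    simp only [W]
    omega
  have hcard : Fintype.card (Fin W → F) < Fintype.card R := by
    simp only [R, Fintype.card_fun, Fintype.card_fin, Fintype.card_prod]
    rw [← pow_mul]
    refine Nat.pow_lt_pow_right Fintype.one_lt_card ?_
    simp only [W]
    have h1 : M * c + J + c * d * r = (c * d + 1) * c + J + c * d * r := by rw [hM]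
    rw [h1]
    have h2 : c * (d * J) = (c * d) * J := by ring
    rw [h2]
    have h3 : r + 7 ≤ c * d := by omega
    have h4 : 2 * c ≤ c * d := by nlinarith
    generalize c * d = t at *
    rw [hJ]
    nlinarith
  obtain ⟨v, w, hvw, hδvw⟩ := Fintype.exists_ne_map_eq_of_card_lt
    (fun v : R => fun k : Fin W => (δ v).coeff k) hcard
  have hδ0 : δ (v - w) = 0 := by
    rw [δ_sub, sub_eq_zero]
    ext k
    by_cases hk : k < W
    · exact congrFun hδvw ⟨k, hk⟩
    · rw [coeff_eq_zero_of_natDegree_lt (by have := δ_deg v; omega),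
        coeff_eq_zero_of_natDegree_lt (by have := δ_deg w; omega)]
  set z := v - w with hz
  have hz0 : z ≠ 0 := sub_ne_zero.2 hvw
  let term : Fin d × Fin J → F[X] := fun s =>
    pol (z s) * (U ^ (c * s.1) * V ^ (c * (d - s.1)) * X ^ (s.2 * M : ℕ))
  let T : F[X] := ∑ s, term s
  have term_deg : ∀ s, pol (z s) ≠ 0 → (term s).natDegree
      = (pol (z s)).natDegree + c * s.1 + s.2 * M + c * d * (r - 1) := by
    rintro ⟨i, j⟩ hs
    have hi : (i : ℕ) + (d - i) = d := by have := i.2; omega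
    simp only [term]
    rw [natDegree_mul hs (by simp [hU0, hV0]), natDegree_mul (by simp [hU0, hV0]) (by simp),
      natDegree_mul (by simp [hU0]) (by simp [hV0]), natDegree_pow, natDegree_pow,
      natDegree_X_pow, hU]
    obtain ⟨r', rfl⟩ : ∃ r', r = r' + 1 := ⟨V.natDegree, hV.symm⟩
    have hV' : V.natDegree = r' := by omega
    rw [hV', Nat.add_sub_cancel]
    have : c * (i:ℕ) * r' + c * (d - i) * r' = c * d * r' := by
      rw [← add_mul, ← mul_add, hi]
    linarith
  have term_ne : ∀ s, pol (z s) ≠ 0 → term s ≠ 0 := by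
    intro s hs
    simp [term, hs, hU0, hV0]
  have hTne : T ≠ 0 := by
    have hex : ∃ s, pol (z s) ≠ 0 := by
      by_contra! hall
      apply hz0
      funext s k
      rw [← pol_coeff (z s) k, hall]; rfl
    obtain ⟨s0, hs0⟩ := hex
    have hdeg := degree_sum_eq_of_disjoint term Finset.univ (by
      rintro s ⟨_, hs⟩ s' ⟨_, hs'⟩ hne heq
      have hs1 : pol (z s) ≠ 0 := fun h => hs (by simp [term, h])
      have hs1' : pol (z s') ≠ 0 := fun h => hs' (by simp [term, h])
      have h := natDegree_eq_of_degree_eq heq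
      rw [term_deg s hs1, term_deg s' hs1'] at h
      obtain ⟨i, j⟩ := s
      obtain ⟨i', j'⟩ := s'
      have hA := pol_deg (z (i, j))
      have hA' := pol_deg (z (i', j'))
      simp only at h
      set α := (pol (z (i, j))).natDegree
      set α' := (pol (z (i', j'))).natDegree
      have h' : α + c * i + j * M = α' + c * i' + j' * M := by omega
      have b1 : α + c * i < M := by
        have : (i:ℕ) + 1 ≤ d := i.2
        have : c * ((i:ℕ) + 1) ≤ c * d := Nat.mul_le_mul_left _ this
        rw [mul_add] at this; omega
      have b1' : α' + c * i' < M := by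
        have : (i':ℕ) + 1 ≤ d := i'.2
        have : c * ((i':ℕ) + 1) ≤ c * d := Nat.mul_le_mul_left _ this
        rw [mul_add] at this; omega
      have hj : (j : ℕ) = j' := by
        have e1 : (α + c * i + j * M) / M = j := by
          rw [Nat.add_mul_div_right _ _ (by omega), Nat.div_eq_of_lt b1, zero_add]
        have e2 : (α' + c * i' + j' * M) / M = j' := by
          rw [Nat.add_mul_div_right _ _ (by omega), Nat.div_eq_of_lt b1', zero_add]
        rw [← e1, h', e2]
      have h'' : α + c * i = α' + c * i' := by rw [hj] at h'; omega
      have hi : (i : ℕ) = i' := by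
        have e1 : (α + c * i) / c = i := by
          rw [Nat.add_mul_div_left _ _ hc, Nat.div_eq_of_lt hA, zero_add]
        have e2 : (α' + c * i') / c = i' := by
          rw [Nat.add_mul_div_left _ _ hc, Nat.div_eq_of_lt hA', zero_add]
        rw [← e1, h'', e2]
      exact hne (Prod.ext (Fin.ext hi) (Fin.ext hj)))
    intro hT0
    change degree T = _ at hdeg
    rw [hT0, degree_zero] at hdeg
    have := Finset.le_sup (f := fun i => degree (term i)) (Finset.mem_univ s0)
    rw [← hdeg] at this
    exact term_ne s0 hs0 (degree_eq_bot.1 (le_bot_iff.1 this))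
  have hTdeg : T.natDegree ≤ c * M + M * (2 * r + 5) := by
    refine natDegree_sum_le_of_forall_le _ _ ?_
    rintro ⟨i, j⟩ _
    by_cases hs : pol (z (i, j)) = 0
    · simp [term, hs]
    rw [term_deg _ hs]
    have hA := pol_deg (z (i, j))
    have hi : c * (i : ℕ) ≤ c * d := Nat.mul_le_mul_left _ i.2.le
    have hj : (j : ℕ) * M ≤ (c + r + 3) * M := Nat.mul_le_mul_right _ (by have := j.2; omega)
    have hcd : c * d * (r - 1) ≤ M * r := Nat.mul_le_mul (by omega) (by omega)
    have hcM : c ≤ c * d := Nat.le_mul_of_pos_right _ (by omega)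
    dsimp only
    nlinarith
  refine le_trans ?_ hTdeg
  refine le_trans (Finset.card_le_card ?_) ((Multiset.toFinset_card_le _).trans (card_roots' T))
  intro x hx
  rw [Finset.mem_filter] at hx
  obtain ⟨-, hUx, hVx, hx⟩ := hx
  rw [Multiset.mem_toFinset, mem_roots hTne, IsRoot.def]
  have hMpos : M ≠ 0 := by omega
  refine pow_eq_zero_iff hMpos |>.1 ?_
  have hxq : (x ^ M) ^ M = x := by
    rw [← pow_mul, ← sq, ← hq, FiniteField.pow_card]
  have key : (T.eval x) ^ M * (U.eval x) ^ (c * d) = (V.eval x) ^ (c * d * M) * (δ z).eval x := by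
    simp only [T, δ, eval_finsetSum]
    rw [hMp, sum_pow_char_pow, ← hMp, Finset.sum_mul, Finset.mul_sum]
    refine Finset.sum_congr rfl ?_
    rintro ⟨i, j⟩ _
    simp only [term, eval_mul, eval_pow, eval_C, eval_X]
    obtain ⟨k, hk⟩ : ∃ k, d = i + k := ⟨d - i, by have := i.2; omega⟩
    have hk' : d - (i : ℕ) = k := by omega
    rw [hk']
    generalize eval x U = a at *
    generalize eval x V = b at *
    generalize eval x (pol (z (i, j))) = g
    have h1 : (x ^ ((j : ℕ) * M)) ^ M = x ^ (j : ℕ) := by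
      rw [mul_comm (j : ℕ), pow_mul, ← pow_mul _ (j:ℕ) M, mul_comm (j:ℕ), pow_mul, hxq]
    have h2 : a ^ (c * d) = a ^ (c * i) * a ^ (c * k) := by
      rw [← pow_add, ← mul_add, ← hk]
    have h3 : b ^ (c * d * M) = b ^ (c * i * M) * b ^ (c * k * M) := by
      rw [← pow_add, ← add_mul, ← mul_add, ← hk]
    have h4 : a ^ (c * i * M) * a ^ (c * i) = ω ^ (i : ℕ) * (b ^ (c * i * M) * b ^ (c * i)) := by
      rw [← pow_add, ← pow_add]
      have : c * i * M + c * i = c * (M + 1) * i := by ring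
      rw [this, pow_mul, hx, mul_pow, ← pow_mul]
    rw [mul_pow, mul_pow, mul_pow, h1, h2, h3, ← pow_mul, ← pow_mul]
    calc g ^ M * (a ^ (c * ↑i * M) * b ^ (c * k * M) * x ^ (j:ℕ)) * (a ^ (c * ↑i) * a ^ (c * k))
        = g ^ M * (a ^ (c * ↑i * M) * a ^ (c * ↑i)) * b ^ (c * k * M) * x ^ (j:ℕ) * a ^ (c * k) := by ring
      _ = _ := by rw [h4]; ring
  rw [hδ0, eval_zero, mul_zero] at key
  exact (mul_eq_zero.1 key).resolve_right (pow_ne_zero _ hUx)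

end Stepanov

section QuadraticExtension

open Polynomial

theorem charSum_ratio_le {F : Type*} [Field F] [Fintype F] [DecidableEq F] (p e M d c r : ℕ)
    [ExpChar F p] (hMp : M = p ^ e) (hq : Fintype.card F = M ^ 2) (hM : M = c * d + 1)
    (hd : 2 ≤ d) (hr : r + 8 ≤ M) (U V : F[X]) (hU0 : U ≠ 0) (hV0 : V ≠ 0)
    (hU : U.natDegree = r) (hV : V.natDegree + 1 = r) (ψ : MulChar F ℂ) (hψ : ψ ≠ 1)
    (hψd : ψ ^ d = 1) :
    ‖∑ y, ψ (U.eval y) * ψ⁻¹ (V.eval y)‖ ≤ d * M * (2 * r + 5) + 2 * r := by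
  classical
  set k := c * (M + 1) with hk
  have hc : 0 < c := by
    rcases Nat.eq_zero_or_pos c with h | h
    · subst h; omega
    · exact h
  have hkpos : 0 < k := by positivity
  have hcardu : Fintype.card Fˣ = k * d := by
    rw [Fintype.card_units, hq, hk, hM, Nat.sub_eq_iff_eq_add (by nlinarith)]
    ring
  have hψk : ∀ t : Fˣ, t ^ k = 1 → ψ t = 1 := by
    intro t ht
    obtain ⟨g, hg⟩ := IsCyclic.exists_generator (α := Fˣ)
    obtain ⟨j, rfl⟩ := (Submonoid.mem_powers_iff _ _).1 (mem_powers_iff_mem_zpowers.2 (hg t))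
    have hord : orderOf g = k * d := by
      rw [orderOf_eq_card_of_forall_mem_zpowers hg, Nat.card_eq_fintype_card, hcardu]
    rw [← pow_mul] at ht
    have h1 := orderOf_dvd_of_pow_eq_one ht
    rw [hord, mul_comm k d] at h1
    obtain ⟨l, rfl⟩ := Nat.dvd_of_mul_dvd_mul_right hkpos h1
    rw [mul_comm d l, pow_mul, Units.val_pow_eq_pow_val, map_pow, ← MulChar.pow_apply_coe, hψd, MulChar.one_apply_coe]
  have hfib : ∀ w : Fˣ, (Finset.univ.filter fun t : Fˣ => w ^ k = t ^ k).card = k := by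
    intro w
    have h1 := IsCyclic.card_powMonoidHom_ker (G := Fˣ) k
    rw [Nat.card_eq_fintype_card (α := Fˣ), hcardu, Nat.gcd_eq_right (Dvd.intro _ rfl)] at h1
    conv_rhs => rw [← h1]
    rw [← Fintype.card_subtype, ← Nat.card_eq_fintype_card]
    refine Nat.card_congr ((Equiv.divRight w).subtypeEquiv fun t => ?_)
    rw [Equiv.divRight_apply, MonoidHom.mem_ker, powMonoidHom_apply, div_pow, div_eq_one, eq_comm]
  set G : Finset F := Finset.univ.filter fun y => U.eval y ≠ 0 ∧ V.eval y ≠ 0 with hG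
  set n : Fˣ → ℕ := fun t => (G.filter fun y => U.eval y ^ k = (t : F) ^ k * V.eval y ^ k).card with hn
  set B : ℕ := c * M + M * (2 * r + 5) with hB
  have hnB : ∀ t, n t ≤ B := by
    intro t
    have := stepanov_count p e M d c r hMp hq hM hd hr U V hU0 hV0 hU hV ((t : F) ^ k)
    refine le_trans (le_of_eq ?_) this
    simp only [hn, hG, Finset.filter_filter, hk, and_assoc]
  have h3 : ∀ a b t : Fˣ, ((a : F) ^ k = (t : F) ^ k * (b : F) ^ k) ↔ (a / b) ^ k = t ^ k := by
    intro a b t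
    rw [← Units.val_pow_eq_pow_val, ← Units.val_pow_eq_pow_val, ← Units.val_pow_eq_pow_val,
      ← Units.val_mul, Units.val_inj, div_pow, div_eq_iff_eq_mul]
  have hS : (k : ℂ) * ∑ y, ψ (U.eval y) * ψ⁻¹ (V.eval y) = ∑ t : Fˣ, ψ t * n t := by
    have h1 : ∑ y, ψ (U.eval y) * ψ⁻¹ (V.eval y) = ∑ y ∈ G, ψ (U.eval y) * ψ⁻¹ (V.eval y) := by
      symm
      refine Finset.sum_subset (Finset.subset_univ _) ?_
      intro y _ hy
      simp only [hG, Finset.mem_filter, Finset.mem_univ, true_and, not_and_or, not_not] at hy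
      rcases hy with h | h
      · rw [h, MulChar.map_zero, zero_mul]
      · rw [h, MulChar.map_zero, mul_zero]
    have h2 : ∀ t : Fˣ, ψ t * n t = ∑ y ∈ G, if U.eval y ^ k = (t : F) ^ k * V.eval y ^ k then ψ t else 0 := by
      intro t
      rw [← Finset.sum_filter, Finset.sum_const, nsmul_eq_mul, mul_comm]
    rw [h1, Finset.sum_congr rfl fun t _ => h2 t, Finset.sum_comm, Finset.mul_sum]
    refine Finset.sum_congr rfl fun y hy => ?_
    simp only [hG, Finset.mem_filter, Finset.mem_univ, true_and] at hy
    obtain ⟨hy1, hy2⟩ := hy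
    generalize U.eval y = a at *
    generalize V.eval y = b at *
    obtain ⟨a, rfl⟩ := IsUnit.mk0 a hy1
    obtain ⟨b, rfl⟩ := IsUnit.mk0 b hy2
    simp_rw [h3]
    rw [← Finset.sum_filter]
    have h4 : ψ a * ψ⁻¹ b = ψ (a / b : Fˣ) := by
      rw [MulChar.inv_apply', ← map_mul, Units.val_div_eq_div_val, div_eq_mul_inv]
    rw [h4, Finset.sum_congr rfl (g := fun _ => ψ (a / b : Fˣ)), Finset.sum_const, hfib, nsmul_eq_mul]
    intro t ht
    simp only [Finset.mem_filter, Finset.mem_univ, true_and] at ht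
    have h5 := hψk (t / (a / b)) (by rw [div_pow, ← ht, div_self'])
    rw [← mul_one (ψ ((a / b : Fˣ) : F)), ← h5, ← map_mul, ← Units.val_mul, mul_div_cancel]
  have hψ0 : ∑ t : Fˣ, ψ t = 0 := by
    have h1 := MulChar.sum_eq_zero_of_ne_one hψ
    rw [← Finset.sum_subset (s₁ := Finset.univ.map ⟨((↑) : Fˣ → F), Units.val_injective⟩)
      (Finset.subset_univ _), Finset.sum_map] at h1
    · exact h1
    · intro x _ hx
      refine MulChar.map_nonunit _ fun hu => hx ?_
      obtain ⟨u, rfl⟩ := hu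
      simp
  have hnorm : ∀ t : Fˣ, ‖ψ t‖ = 1 := by
    intro t
    have : ψ t ^ d = 1 := by rw [← MulChar.pow_apply_coe, hψd, MulChar.one_apply_coe]
    exact Complex.norm_eq_one_of_pow_eq_one this (by omega)
  have hsumn : ∑ t : Fˣ, n t = k * G.card := by
    simp only [hn, Finset.card_filter]
    rw [Finset.sum_comm, Finset.sum_congr rfl (g := fun _ => k), Finset.sum_const, smul_eq_mul,
      mul_comm]
    intro y hy
    simp only [hG, Finset.mem_filter, Finset.mem_univ, true_and] at hy
    obtain ⟨a, ha⟩ := IsUnit.mk0 _ hy.1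
    obtain ⟨b, hb⟩ := IsUnit.mk0 _ hy.2
    rw [← Finset.card_filter]
    refine Eq.trans ?_ (hfib (a / b))
    rw [← ha, ← hb]
    exact congrArg _ (Finset.filter_congr fun t _ => h3 a b t)
  have hGcard : Fintype.card F ≤ G.card + (2 * r) := by
    have h1 : Finset.univ \ G ⊆ U.roots.toFinset ∪ V.roots.toFinset := by
      intro y hy
      simp only [hG, Finset.mem_sdiff, Finset.mem_filter, Finset.mem_univ, true_and, not_and_or, not_not] at hy
      simp [hU0, hV0, hy]
    have h2 := Finset.card_le_card h1
    have h3 := Finset.card_union_le U.roots.toFinset V.roots.toFinset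
    have h4 := (Multiset.toFinset_card_le U.roots).trans (card_roots' U)
    have h5 := (Multiset.toFinset_card_le V.roots).trans (card_roots' V)
    rw [Finset.card_sdiff_of_subset (Finset.subset_univ _), Finset.card_univ] at h2
    omega
  have hfin : (k : ℝ) * ‖∑ y, ψ (U.eval y) * ψ⁻¹ (V.eval y)‖ ≤ k * (d * M * (2 * r + 5) + 2 * r) := by
    have h1 : (k : ℂ) * ∑ y, ψ (U.eval y) * ψ⁻¹ (V.eval y) = -∑ t : Fˣ, ψ t * ((B : ℂ) - n t) := by
      rw [hS]
      simp only [mul_sub, Finset.sum_sub_distrib, ← Finset.sum_mul, hψ0]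
      ring
    have h2 : (k : ℝ) * ‖∑ y, ψ (U.eval y) * ψ⁻¹ (V.eval y)‖ ≤ ∑ t : Fˣ, ((B : ℝ) - n t) := by
      rw [← Complex.norm_natCast, ← norm_mul, h1, norm_neg]
      refine (norm_sum_le _ _).trans (Finset.sum_le_sum fun t _ => ?_)
      rw [norm_mul, hnorm, one_mul, ← Nat.cast_sub (hnB t), Complex.norm_natCast, Nat.cast_sub (hnB t)]
    refine h2.trans ?_
    rw [Finset.sum_sub_distrib, Finset.sum_const, Finset.card_univ, hcardu, nsmul_eq_mul,
      ← Nat.cast_sum, hsumn]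
    push_cast
    rw [mul_assoc, ← mul_sub]
    refine mul_le_mul_of_nonneg_left ?_ (Nat.cast_nonneg _)
    have h3 : (M : ℝ) ^ 2 ≤ G.card + 2 * r := by exact_mod_cast hq ▸ hGcard
    have h4 : (d : ℝ) * B = M ^ 2 - M + d * M * (2 * r + 5) := by
      have : (M : ℝ) = c * d + 1 := by exact_mod_cast hM
      rw [hB]; push_cast; rw [this]; ring
    have : (0 : ℝ) ≤ M := Nat.cast_nonneg _
    rw [h4]
    linarith
  exact le_of_mul_le_mul_left hfin (by exact_mod_cast hkpos)

end QuadraticExtension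

section NormCharacter

open Polynomial

/-- The composition of a multiplicative character with the norm of an extension. -/
noncomputable def normChar {k : Type*} [Field k] (K : Type*) [Field K] [Algebra k K]
    [FiniteDimensional k K] (χ : MulChar k ℂ) : MulChar K ℂ where
  toMonoidHom := χ.toMonoidHom.comp (Algebra.norm k)
  map_nonunit' := by
    intro a ha
    have h0 : a = 0 := by simpa using ha
    subst h0
    change χ (Algebra.norm k 0) = 0
    rw [Algebra.norm_zero, MulChar.map_zero]

theorem normChar_apply {k : Type*} [Field k] (K : Type*) [Field K] [Algebra k K]
    [FiniteDimensional k K] (χ : MulChar k ℂ) (x : K) :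
    normChar K χ x = χ (Algebra.norm k x) := rfl

theorem normChar_inv {k : Type*} [Field k] (K : Type*) [Field K] [Algebra k K]
    [FiniteDimensional k K] (χ : MulChar k ℂ) :
    (normChar K χ)⁻¹ = normChar K χ⁻¹ := by
  ext x
  have h : Algebra.norm k ((x : K)⁻¹) = (Algebra.norm k (x : K))⁻¹ := by
    refine eq_inv_of_mul_eq_one_left ?_
    rw [← map_mul, inv_mul_cancel₀ x.ne_zero, map_one]
  rw [normChar_apply, MulChar.inv_apply', MulChar.inv_apply', normChar_apply, h]

theorem natDegree_prod_one_add {F ι : Type*} [Field F] [Fintype ι] (γ : ι → F)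
    (h : ∀ i, γ i ≠ 0) : (∏ i, (C (γ i) * X + 1 : F[X])).natDegree = Fintype.card ι := by
  have hd : ∀ i, (C (γ i) * X + 1 : F[X]).natDegree = 1 := fun i => by
    rw [← C_1]; exact natDegree_linear (h i)
  rw [natDegree_prod _ _ fun i _ h0 => by simpa [h0] using hd i]
  simp [hd]

theorem norm_charSum_norm_le {p e : ℕ} [Fact p.Prime] {ι κ : Type*} [Fintype ι] [Fintype κ]
    (hκ : Fintype.card κ = Fintype.card ι + 1) (χ : MulChar (ZMod p) ℂ) (hχ : χ ≠ 1)
    (a₀ : ZMod p) (α : ι → ZMod p) (β : κ → ZMod p) (hα : ∀ i, α i ≠ a₀) (hβ : ∀ i, β i ≠ a₀)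
    (K : Type*) [Field K] [Fintype K] [Algebra (ZMod p) K] (hK : Fintype.card K = (p ^ e) ^ 2)
    (he : Fintype.card κ + 8 ≤ p ^ e) :
    ‖∑ x : K, normChar K χ (x + algebraMap _ K a₀) * (∏ i, normChar K χ (x + algebraMap _ K (α i)))
      * ∏ i, normChar K χ⁻¹ (x + algebraMap _ K (β i))‖
      ≤ p * (2 * Fintype.card κ + 5) * p ^ e + (2 * Fintype.card κ + 1) := by
  classical
  have hp2 : p ≠ 2 := by
    rintro rfl
    apply hχ
    ext a
    have : a = 1 := Subsingleton.elim _ _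
    simp [this]
  have hp3 : 3 ≤ p := by
    have := (Fact.out : p.Prime).two_le
    omega
  set j := algebraMap (ZMod p) K
  have hj : Function.Injective j := j.injective
  set ψ := normChar K χ with hψ
  set U : K[X] := ∏ i, (C (j (β i - a₀)) * X + 1) with hU
  set V : K[X] := ∏ i, (C (j (α i - a₀)) * X + 1) with hV
  have hne : ∀ z : ZMod p, z ≠ a₀ → j (z - a₀) ≠ 0 := by
    intro z hz h
    rw [map_eq_zero, sub_eq_zero] at h
    exact hz h
  have hU0 : U ≠ 0 := by
    intro h
    have := congrArg (eval 0) h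
    simp [hU, eval_prod] at this
  have hV0 : V ≠ 0 := by
    intro h
    have := congrArg (eval 0) h
    simp [hV, eval_prod] at this
  have hUd : U.natDegree = Fintype.card κ := natDegree_prod_one_add _ fun i => hne _ (hβ i)
  have hVd : V.natDegree = Fintype.card ι := natDegree_prod_one_add _ fun i => hne _ (hα i)
  obtain ⟨c, hc⟩ : p - 1 ∣ p ^ e - 1 := by
    simpa using Nat.sub_dvd_pow_sub_pow p 1 e
  have hpe : p ^ e = c * (p - 1) + 1 := by
    rw [mul_comm, ← hc, Nat.sub_add_cancel (Nat.one_le_pow _ _ (by omega))]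
  have : CharP K p := charP_of_injective_algebraMap hj p
  have hχp : χ⁻¹ ^ (p - 1) = 1 := by
    have := MulChar.pow_card_eq_one χ⁻¹
    rwa [ZMod.card_units_eq_totient, Nat.totient_prime Fact.out] at this
  have hψ1 : ψ⁻¹ ≠ 1 := by
    rw [Ne, inv_eq_one]
    intro h
    apply hχ
    ext a
    obtain ⟨x, hx⟩ := FiniteField.norm_surjective (ZMod p) K (a : ZMod p)
    have hx0 : x ≠ 0 := by
      rintro rfl
      rw [Algebra.norm_zero] at hx
      exact a.ne_zero hx.symm
    have := normChar_apply K χ x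
    rw [← hψ, h, hx, MulChar.one_apply (IsUnit.mk0 x hx0)] at this
    rw [← this, MulChar.one_apply_coe]
  have hψd : ψ⁻¹ ^ (p - 1) = 1 := by
    rw [normChar_inv]
    ext x
    rw [MulChar.pow_apply_coe, normChar_apply]
    have hu : IsUnit (Algebra.norm (ZMod p) (x : K)) := by simp
    obtain ⟨u, hu⟩ := hu
    rw [← hu, ← MulChar.pow_apply_coe, hχp, MulChar.one_apply_coe, MulChar.one_apply_coe]
  have main := charSum_ratio_le p e (p ^ e) (p - 1) c (Fintype.card κ) rfl hK hpe (by omega) he U V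
    hU0 hV0 hUd (by rw [hVd, hκ]) ψ⁻¹ hψ1 hψd
  rw [inv_inv] at main
  set f : K → ℂ := fun x => ψ (x + j a₀) * (∏ i, ψ (x + j (α i))) * ∏ i, normChar K χ⁻¹ (x + j (β i))
    with hf
  have hsum : ∑ x, f x = ∑ y, ψ⁻¹ (U.eval y) * ψ (V.eval y) - 1 := by
    let E : K ≃ K := (Equiv.inv K).trans (Equiv.subRight (j a₀))
    rw [← Equiv.sum_comp E, ← Finset.add_sum_erase _ _ (Finset.mem_univ (0 : K)),
      ← Finset.add_sum_erase (a := (0 : K)) _ (fun y => ψ⁻¹ (U.eval y) * ψ (V.eval y)) (Finset.mem_univ _)]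
    have h0 : f (E 0) = 0 := by simp [hf, E, MulChar.map_zero]
    have h1 : ψ⁻¹ (U.eval 0) * ψ (V.eval 0) = 1 := by simp [hU, hV, eval_prod]
    rw [h0, h1, zero_add, add_sub_cancel_left]
    refine Finset.sum_congr rfl fun y hy => ?_
    have hy0 : y ≠ 0 := Finset.ne_of_mem_erase hy
    have hE : ∀ z : ZMod p, E y + j z = y⁻¹ * (C (j (z - a₀)) * X + 1 : K[X]).eval y := by
      intro z
      simp [E]
      field_simp
      ring
    simp only [hf, hE, map_mul, Finset.prod_mul_distrib, Finset.prod_const, Finset.card_univ, hκ]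
    rw [hU, hV, eval_prod, eval_prod, map_prod, map_prod, ← normChar_inv, ← hψ]
    have h2 : ψ⁻¹ y⁻¹ ^ (Fintype.card ι + 1) * ψ y⁻¹ ^ (Fintype.card ι + 1) = 1 := by
      rw [← mul_pow, ← MulChar.mul_apply, inv_mul_cancel, MulChar.one_apply (by simpa using hy0), one_pow]
    have h3 : (C (j (a₀ - a₀)) * X + 1 : K[X]).eval y = 1 := by simp
    rw [h3, map_one]
    linear_combination ((∏ i, ψ⁻¹ ((C (j (β i - a₀)) * X + 1 : K[X]).eval y)) * (∏ i, ψ ((C (j (α i - a₀)) * X + 1 : K[X]).eval y))) * h2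
  rw [hsum]
  refine (norm_sub_le _ _).trans ?_
  rw [norm_one]
  refine (add_le_add_left main 1).trans ?_
  have : ((p - 1 : ℕ) : ℝ) ≤ p := by exact_mod_cast Nat.sub_le _ _
  have h5 : ((p - 1 : ℕ) : ℝ) * (p ^ e * (2 * Fintype.card κ + 5)) ≤ p * (p ^ e * (2 * Fintype.card κ + 5)) :=
    mul_le_mul_of_nonneg_right this (by positivity)
  push_cast
  linarith

end NormCharacter

section Lfun

open Polynomial
variable {p : ℕ} [Fact p.Prime]

theorem finite_monic_natDegree (n : ℕ) : {g : (ZMod p)[X] | g.Monic ∧ g.natDegree = n}.Finite := by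
  refine Set.Finite.of_finite_image (f := fun g (i : Fin (n + 1)) => g.coeff i) (Set.toFinite _) ?_
  rintro g ⟨-, hg⟩ h ⟨-, hh⟩ hgh
  ext i
  by_cases hi : i < n + 1
  · exact congrFun hgh ⟨i, hi⟩
  · rw [coeff_eq_zero_of_natDegree_lt (by omega), coeff_eq_zero_of_natDegree_lt (by omega)]

/-- The monic polynomials of degree `n` over `ZMod p`. -/
noncomputable def monicsOfDegree (p : ℕ) [Fact p.Prime] (n : ℕ) : Finset (ZMod p)[X] :=
  (finite_monic_natDegree n).toFinset

theorem mem_monicsOfDegree {n : ℕ} {g : (ZMod p)[X]} :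
    g ∈ monicsOfDegree p n ↔ g.Monic ∧ g.natDegree = n := by
  simp [monicsOfDegree]

/-- The completely multiplicative weight on monic polynomials attached to characters at points. -/
noncomputable def polyWeight (T : Finset (ZMod p)) (θ : ZMod p → MulChar (ZMod p) ℂ)
    (g : (ZMod p)[X]) : ℂ :=
  ∏ t ∈ T, θ t ((-1) ^ g.natDegree * g.eval (-t))

theorem polyWeight_mul (T : Finset (ZMod p)) (θ : ZMod p → MulChar (ZMod p) ℂ)
    {g h : (ZMod p)[X]} (hg : g.Monic) (hh : h.Monic) :
    polyWeight T θ (g * h) = polyWeight T θ g * polyWeight T θ h := by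
  simp only [polyWeight, ← Finset.prod_mul_distrib, ← map_mul, hg.natDegree_mul hh, eval_mul]
  refine Finset.prod_congr rfl fun t _ => congrArg _ ?_
  ring

theorem polyWeight_sum_zero (T : Finset (ZMod p)) (θ : ZMod p → MulChar (ZMod p) ℂ) :
    ∑ g ∈ monicsOfDegree p 0, polyWeight T θ g = 1 := by
  have : monicsOfDegree p 0 = {1} := by
    ext g
    rw [mem_monicsOfDegree, Finset.mem_singleton]
    exact ⟨fun h => h.1.natDegree_eq_zero.1 h.2, fun h => by simp [h]⟩
  simp [this, polyWeight]

theorem degree_C_mul_le_degree (a : ZMod p) (g : (ZMod p)[X]) : (C a * g).degree ≤ g.degree := by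
  rw [← smul_eq_C_mul]
  exact degree_smul_le _ _

theorem polyWeight_sum_eq_zero (T : Finset (ZMod p)) (θ : ZMod p → MulChar (ZMod p) ℂ)
    {t₀ : ZMod p} (ht₀ : t₀ ∈ T) (hθ : θ t₀ ≠ 1) {n : ℕ} (hn : T.card ≤ n) :
    ∑ g ∈ monicsOfDegree p n, polyWeight T θ g = 0 := by
  classical
  obtain ⟨u, hu⟩ := MulChar.ne_one_iff.1 hθ
  set ℓ : (ZMod p)[X] := ∏ t ∈ T.erase t₀, (C (t - t₀)⁻¹ * (X + C t)) with hℓ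
  have hℓ0 : ∀ t ∈ T, t ≠ t₀ → ℓ.eval (-t) = 0 := by
    intro t ht hne
    rw [hℓ, eval_prod]
    exact Finset.prod_eq_zero (Finset.mem_erase.2 ⟨hne, ht⟩) (by simp)
  have hℓ1 : ℓ.eval (-t₀) = 1 := by
    rw [hℓ, eval_prod]
    refine Finset.prod_eq_one fun t ht => ?_
    have : t - t₀ ≠ 0 := sub_ne_zero.2 (Finset.ne_of_mem_erase ht)
    simp only [eval_mul, eval_C, eval_add, eval_X]
    rw [neg_add_eq_sub, inv_mul_cancel₀ this]
  have hℓd : ℓ.degree < n := by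
    have h1 : ℓ.degree ≤ ((T.erase t₀).card : ℕ) := by
      refine (degree_prod_le _ _).trans ?_
      refine (Finset.sum_le_sum (g := fun _ => (1 : WithBot ℕ)) fun t _ => ?_).trans (by simp)
      exact (degree_C_mul_le_degree _ _).trans (by rw [degree_X_add_C])
    refine h1.trans_lt ?_
    have : (T.erase t₀).card < T.card := Finset.card_erase_lt_of_mem ht₀
    exact_mod_cast this.trans_le hn
  let σ : (ZMod p)ˣ → (ZMod p)[X] → (ZMod p)[X] := fun u g => g + C (((u : ZMod p) - 1) * g.eval (-t₀)) * ℓ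
  have hdeg : ∀ u g, g ∈ monicsOfDegree p n → (C (((u : (ZMod p)ˣ) - 1 : ZMod p) * g.eval (-t₀)) * ℓ).degree < g.degree := by
    intro u g hg
    rw [mem_monicsOfDegree] at hg
    rw [degree_eq_natDegree hg.1.ne_zero, hg.2]
    exact (degree_C_mul_le_degree _ _).trans_lt hℓd
  have hσ : ∀ u g, g ∈ monicsOfDegree p n → σ u g ∈ monicsOfDegree p n := by
    intro u g hg
    have h := hdeg u g hg
    rw [mem_monicsOfDegree] at hg ⊢
    exact ⟨hg.1.add_of_left h, by rw [← hg.2]; exact natDegree_eq_of_degree_eq (degree_add_eq_left_of_degree_lt h)⟩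
  have hσe : ∀ u g, (σ u g).eval (-t₀) = u * g.eval (-t₀) := by
    intro u g
    simp only [σ, eval_add, eval_mul, eval_C, hℓ1]
    ring
  have hσσ : ∀ u v : (ZMod p)ˣ, (u * v = 1) → ∀ g, σ u (σ v g) = g := by
    intro u v huv g
    have huv' : (u : ZMod p) * v = 1 := by rw [← Units.val_mul, huv, Units.val_one]
    have : σ u (σ v g) = σ v g + C (((u : ZMod p) - 1) * (v * g.eval (-t₀))) * ℓ := by rw [← hσe]
    rw [this]
    simp only [σ]
    rw [add_assoc, ← add_mul, ← C_add]
    have : ((v : ZMod p) - 1) * g.eval (-t₀) + (u - 1) * (v * g.eval (-t₀)) = 0 := by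
      linear_combination g.eval (-t₀) * huv'
    rw [this, C_0, zero_mul, add_zero]
  have hw : ∀ g ∈ monicsOfDegree p n, polyWeight T θ (σ u g) = θ t₀ u * polyWeight T θ g := by
    intro g hg
    have h1 : (σ u g).natDegree = g.natDegree := by
      rw [(mem_monicsOfDegree.1 (hσ u g hg)).2, (mem_monicsOfDegree.1 hg).2]
    rw [polyWeight, polyWeight, ← Finset.mul_prod_erase _ _ ht₀, ← Finset.mul_prod_erase _ _ ht₀,
      hσe, h1, ← mul_assoc (θ t₀ u), ← map_mul]
    congr 1
    · congr 1; ring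
    · refine Finset.prod_congr rfl fun t ht => ?_
      rw [Finset.mem_erase] at ht
      simp [σ, hℓ0 t ht.2 ht.1]
  have hsum : ∑ g ∈ monicsOfDegree p n, polyWeight T θ g
      = ∑ g ∈ monicsOfDegree p n, polyWeight T θ (σ u g) := by
    symm
    refine Finset.sum_bij' (fun g _ => σ u g) (fun g _ => σ u⁻¹ g) (hσ u) (hσ u⁻¹) ?_ ?_ ?_
    · exact fun g _ => hσσ _ _ (by simp) g
    · exact fun g _ => hσσ _ _ (by simp) g
    · exact fun g _ => rfl
  rw [Finset.sum_congr rfl hw, ← Finset.mul_sum] at hsum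
  have : (1 - θ t₀ u) * ∑ g ∈ monicsOfDegree p n, polyWeight T θ g = 0 := by
    rw [sub_mul, one_mul, ← hsum, sub_self]
  exact (mul_eq_zero.1 this).resolve_left (sub_ne_zero.2 (Ne.symm hu))

variable (K : Type*) [Field K] [Algebra (ZMod p) K] [Fintype K]

theorem polyWeight_minpoly (T : Finset (ZMod p)) (θ : ZMod p → MulChar (ZMod p) ℂ) (x : K) :
    polyWeight T θ (minpoly (ZMod p) x ^ (Module.finrank (ZMod p) K / (minpoly (ZMod p) x).natDegree))
      = ∏ t ∈ T, θ t (Algebra.norm (ZMod p) (x + algebraMap _ K t)) := by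
  have h_int : ∀ y : K, IsIntegral (ZMod p) y := fun y => Algebra.IsIntegral.isIntegral y
  rw [polyWeight]
  refine Finset.prod_congr rfl fun t _ => congrArg _ ?_
  set P := minpoly (ZMod p) x with hP
  set y := x + algebraMap _ K t with hy
  have hmin : minpoly (ZMod p) y = P.comp (X - C t) := minpoly.add_algebraMap x t
  have hdeg : (minpoly (ZMod p) y).natDegree = P.natDegree := by
    rw [hmin, natDegree_comp, natDegree_X_sub_C, mul_one]
  have hfr := IntermediateField.adjoin.finrank (h_int y)
  have hmul := Module.finrank_mul_finrank (ZMod p) (IntermediateField.adjoin (ZMod p) {y}) K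
  have hpos : 0 < P.natDegree := minpoly.natDegree_pos (h_int x)
  have hexp : Module.finrank (IntermediateField.adjoin (ZMod p) {y}) K
      = Module.finrank (ZMod p) K / P.natDegree := by
    rw [← hmul, hfr, hdeg, Nat.mul_div_cancel_left _ hpos]
  have hgen := Algebra.PowerBasis.norm_gen_eq_coeff_zero_minpoly
    (IntermediateField.adjoin.powerBasis (h_int y))
  rw [IntermediateField.adjoin.powerBasis_gen, IntermediateField.minpoly_gen,
    IntermediateField.adjoin.powerBasis_dim, hdeg, hmin, coeff_zero_eq_eval_zero, eval_comp] at hgen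
  rw [Algebra.norm_eq_norm_adjoin, hexp, hgen]
  simp only [eval_sub, eval_X, eval_C, zero_sub, natDegree_pow, eval_pow, mul_pow, ← pow_mul]
  rw [mul_comm P.natDegree]

theorem card_minpoly_eq {P : (ZMod p)[X]} (hP : P.Monic) (hirr : Irreducible P) [DecidableEq (ZMod p)[X]] :
    (Finset.univ.filter fun x : K => minpoly (ZMod p) x = P).card
      = if P.natDegree ∣ Module.finrank (ZMod p) K then P.natDegree else 0 := by
  classical
  split_ifs with h
  · have hsep : P.Separable := PerfectField.separable_of_irreducible hirr
    have hdvd := hirr.natDegree_dvd_iff_dvd_X_pow_card_pow_sub_X.1 h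
    have hK : Nat.card (ZMod p) ^ Module.finrank (ZMod p) K = Fintype.card K := by
      rw [← Nat.card_eq_fintype_card, Nat.card_zmod]
      exact FiniteField.pow_finrank_eq_natCard p K
    rw [hK] at hdvd
    have hsplit : (P.map (algebraMap (ZMod p) K)).Splits := by
      have h2 := Polynomial.map_dvd (algebraMap (ZMod p) K) hdvd
      refine Splits.of_dvd ?_ ?_ h2
      · have := FiniteField.isSplittingField_sub K (ZMod p)
        exact this.splits
      · exact map_ne_zero (FiniteField.X_pow_card_sub_X_ne_zero _ Fintype.one_lt_card)
    rw [← card_rootSet_eq_natDegree hsep hsplit, ← Set.toFinset_card]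
    congr 1
    ext x
    simp only [Finset.mem_filter, Finset.mem_univ, true_and, Set.mem_toFinset]
    rw [mem_rootSet, and_iff_right hirr.ne_zero]
    constructor
    · rintro rfl; exact minpoly.aeval _ _
    · exact fun hx => (minpoly.eq_of_irreducible_of_monic hirr hx hP).symm
  · rw [Finset.card_eq_zero, Finset.filter_eq_empty_iff]
    rintro x _ rfl
    exact h (minpoly.degree_dvd (Algebra.IsIntegral.isIntegral x))

end Lfun

section Relation

open Polynomial
variable {p : ℕ} [Fact p.Prime] (K : ℕ → Type*) [∀ k, Field (K k)] [∀ k, Algebra (ZMod p) (K k)]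
  [∀ k, Fintype (K k)]

open UniqueFactorizationMonoid in
theorem sum_card_minpoly_pow_dvd [DecidableEq (ZMod p)[X]] (hK : ∀ k ≠ 0, Module.finrank (ZMod p) (K k) = k)
    {n : ℕ} {g : (ZMod p)[X]} (hg : g ∈ monicsOfDegree p n) [∀ h : (ZMod p)[X], Decidable (h ∣ g)] :
    ∑ k ∈ Finset.Icc 1 n, (Finset.univ.filter fun x : K k =>
      minpoly (ZMod p) x ^ (k / (minpoly (ZMod p) x).natDegree) ∣ g).card = n := by
  classical
  rw [mem_monicsOfDegree] at hg
  obtain ⟨hgm, hgn⟩ := hg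
  have hg0 := hgm.ne_zero
  set N := normalizedFactors g with hN
  have hNirr : ∀ P ∈ N, Irreducible P := fun P hP => irreducible_of_normalized_factor P hP
  have hNm : ∀ P ∈ N, P.Monic := fun P hP => by
    have h1 := normalize_normalized_factor P hP
    rw [← h1]
    exact monic_normalize (hNirr P hP).ne_zero
  have hprod : N.prod = g := by
    have h1 := prod_normalizedFactors_eq (a := g) hg0
    rw [hN, h1, normalize_eq_self_iff_monic hg0 |>.2 hgm]
  have hdeg : n = ∑ P ∈ N.toFinset, N.count P * P.natDegree := by
    rw [← hgn, ← hprod, natDegree_multiset_prod_of_monic _ hNm, Finset.sum_multiset_map_count]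
    simp
  have hpow : ∀ P ∈ N, ∀ j, P ^ j ∣ g ↔ j ≤ N.count P := by
    intro P hP j
    rw [dvd_iff_normalizedFactors_le_normalizedFactors (pow_ne_zero _ (hNirr P hP).ne_zero) hg0,
      normalizedFactors_pow, normalizedFactors_irreducible (hNirr P hP),
      (hNm P hP).normalize_eq_self, Multiset.nsmul_singleton, ← Multiset.le_count_iff_replicate_le]
  have hfib : ∀ k ∈ Finset.Icc 1 n, (Finset.univ.filter fun x : K k =>
      minpoly (ZMod p) x ^ (k / (minpoly (ZMod p) x).natDegree) ∣ g).card
      = ∑ P ∈ N.toFinset, if P.natDegree ∣ k ∧ P ^ (k / P.natDegree) ∣ g then P.natDegree else 0 := by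
    intro k hk
    rw [Finset.mem_Icc] at hk
    have hk0 : k ≠ 0 := by omega
    rw [Finset.card_eq_sum_card_fiberwise (f := fun x => minpoly (ZMod p) x) (t := N.toFinset)]
    · refine Finset.sum_congr rfl fun P hP => ?_
      rw [Multiset.mem_toFinset] at hP
      have hc := card_minpoly_eq (K k) (hNm P hP) (hNirr P hP)
      rw [hK k hk0] at hc
      by_cases hd : P ^ (k / P.natDegree) ∣ g
      · simp only [hd, and_true]
        rw [← hc, Finset.filter_filter]
        congr 1
        refine Finset.filter_congr fun x _ => ?_
        constructor
        · exact fun h => h.2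
        · exact fun h => ⟨by rw [h]; exact hd, h⟩
      · simp only [hd, and_false, if_false]
        rw [Finset.card_eq_zero, Finset.filter_filter, Finset.filter_eq_empty_iff]
        rintro x _ ⟨h1, h2⟩
        rw [h2] at h1
        exact hd h1
    · intro x hx
      rw [Finset.mem_coe, Finset.mem_filter] at hx
      have h_int : IsIntegral (ZMod p) x := Algebra.IsIntegral.isIntegral x
      have hdv : (minpoly (ZMod p) x).natDegree ∣ k := by
        have := minpoly.degree_dvd h_int
        rwa [hK k hk0] at this
      have hpos : 0 < k / (minpoly (ZMod p) x).natDegree :=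
        Nat.div_pos (Nat.le_of_dvd (by omega) hdv) (minpoly.natDegree_pos h_int)
      rw [Finset.mem_coe, Multiset.mem_toFinset]
      obtain ⟨q, hq, hassoc⟩ := exists_mem_normalizedFactors_of_dvd hg0 (minpoly.irreducible h_int)
        ((dvd_pow_self _ hpos.ne').trans hx.2)
      change minpoly (ZMod p) x ∈ N
      rwa [eq_of_monic_of_associated (minpoly.monic h_int) (hNm q hq) hassoc]
  rw [Finset.sum_congr rfl hfib, Finset.sum_comm]
  conv_rhs => rw [hdeg]
  refine Finset.sum_congr rfl fun P hP => ?_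
  have hP' := Multiset.mem_toFinset.1 hP
  have hd := (hNirr P hP').natDegree_pos
  rw [← Finset.sum_filter, Finset.sum_const, smul_eq_mul]
  congr 1
  have hcount : N.count P * P.natDegree ≤ n := by
    rw [hdeg]
    exact Finset.single_le_sum (f := fun P => N.count P * P.natDegree) (fun _ _ => Nat.zero_le _) hP
  trans (Finset.Icc 1 (N.count P)).card
  · symm
    refine Finset.card_bij (fun j _ => j * P.natDegree) ?_ ?_ ?_
    · intro j hj
      rw [Finset.mem_Icc] at hj
      rw [Finset.mem_filter, Finset.mem_Icc, Nat.mul_div_cancel _ hd, hpow P hP']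
      exact ⟨⟨Nat.mul_pos hj.1 hd, (Nat.mul_le_mul_right _ hj.2).trans hcount⟩, Dvd.intro_left _ rfl, hj.2⟩
    · exact fun a _ b _ h => Nat.eq_of_mul_eq_mul_right hd h
    · intro k hk
      rw [Finset.mem_filter, Finset.mem_Icc] at hk
      obtain ⟨⟨h1, h2⟩, ⟨j, rfl⟩, h4⟩ := hk
      rw [Nat.mul_div_cancel_left _ hd, hpow P hP'] at h4
      refine ⟨j, Finset.mem_Icc.2 ⟨?_, h4⟩, mul_comm _ _⟩
      exact Nat.pos_of_ne_zero (by rintro rfl; simp at h1)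
  · simp

theorem mul_sum_polyWeight (hK : ∀ k ≠ 0, Module.finrank (ZMod p) (K k) = k)
    (T : Finset (ZMod p)) (θ : ZMod p → MulChar (ZMod p) ℂ) (n : ℕ) :
    (n : ℂ) * ∑ g ∈ monicsOfDegree p n, polyWeight T θ g = ∑ k ∈ Finset.Icc 1 n,
      (∑ x : K k, ∏ t ∈ T, θ t (Algebra.norm (ZMod p) (x + algebraMap _ (K k) t)))
        * ∑ g ∈ monicsOfDegree p (n - k), polyWeight T θ g := by
  classical
  have h1 : (n : ℂ) * ∑ g ∈ monicsOfDegree p n, polyWeight T θ g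
      = ∑ g ∈ monicsOfDegree p n, ∑ k ∈ Finset.Icc 1 n, ∑ x : K k,
        if minpoly (ZMod p) x ^ (k / (minpoly (ZMod p) x).natDegree) ∣ g then polyWeight T θ g else 0 := by
    rw [Finset.mul_sum]
    refine Finset.sum_congr rfl fun g hg => ?_
    conv_lhs => rw [← sum_card_minpoly_pow_dvd K hK hg]
    rw [Nat.cast_sum, Finset.sum_mul]
    refine Finset.sum_congr rfl fun k _ => ?_
    rw [← Finset.sum_filter, Finset.sum_const, nsmul_eq_mul]
  rw [h1, Finset.sum_comm]
  refine Finset.sum_congr rfl fun k hk => ?_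
  rw [Finset.mem_Icc] at hk
  rw [Finset.sum_comm, Finset.sum_mul]
  refine Finset.sum_congr rfl fun x _ => ?_
  have hw := polyWeight_minpoly (K k) T θ x
  rw [hK k (by omega)] at hw
  rw [← hw, ← Finset.sum_filter, Finset.mul_sum]
  have h_int : IsIntegral (ZMod p) x := Algebra.IsIntegral.isIntegral x
  have hdv : (minpoly (ZMod p) x).natDegree ∣ k := by
    have := minpoly.degree_dvd h_int
    rwa [hK k (by omega)] at this
  set c := minpoly (ZMod p) x ^ (k / (minpoly (ZMod p) x).natDegree) with hc
  have hcm : c.Monic := (minpoly.monic h_int).pow _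
  have hcd : c.natDegree = k := by rw [hc, natDegree_pow, Nat.div_mul_cancel hdv]
  symm
  refine Finset.sum_bij (fun g _ => c * g) ?_ ?_ ?_ ?_
  · intro g hg
    rw [mem_monicsOfDegree] at hg
    rw [Finset.mem_filter, mem_monicsOfDegree, hcm.natDegree_mul hg.1]
    exact ⟨⟨hcm.mul hg.1, by omega⟩, Dvd.intro _ rfl⟩
  · exact fun a _ b _ h => mul_left_cancel₀ hcm.ne_zero h
  · intro g hg
    rw [Finset.mem_filter, mem_monicsOfDegree] at hg
    obtain ⟨⟨h2, h3⟩, q, rfl⟩ := hg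
    have hq := hcm.of_mul_monic_left h2
    rw [hcm.natDegree_mul hq] at h3
    exact ⟨q, mem_monicsOfDegree.2 ⟨hq, by omega⟩, rfl⟩
  · exact fun g hg => (polyWeight_mul T θ hcm (mem_monicsOfDegree.1 hg).1).symm

end Relation

section PowerSums
open PowerSeries

theorem X_mul_deriv_prod_one_sub (R : Multiset ℂ) :
    (X : PowerSeries ℂ) * PowerSeries.derivative ℂ ((R.map fun ω => 1 - C ω * X).prod)
      = (R.map fun ω => (1 : PowerSeries ℂ) - C ω * X).prod
        * PowerSeries.mk fun k => if k = 0 then 0 else -(R.map fun ω => ω ^ k).sum := by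
  induction R using Multiset.induction_on with
  | empty =>
    simp
    ext k; simp
  | cons ω R ih =>
    have h1 : (1 - C ω * X) * (PowerSeries.mk fun k => if k = 0 then 0 else -ω ^ k) = -(C ω * X) := by
      ext k
      rcases k with _ | k
      · simp
      · rw [sub_mul, one_mul, map_sub, mul_assoc, coeff_C_mul, coeff_succ_X_mul, coeff_mk, coeff_mk,
          map_neg, coeff_C_mul, coeff_X]
        rcases k with _ | k
        · simp
        · simp [pow_succ]; ring
    have h2 : (PowerSeries.mk fun k => if k = 0 then 0 else -((ω ::ₘ R).map fun ω => ω ^ k).sum)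
        = (PowerSeries.mk fun k => if k = 0 then (0 : ℂ) else -ω ^ k)
          + PowerSeries.mk fun k => if k = 0 then 0 else -(R.map fun ω => ω ^ k).sum := by
      ext k
      simp only [coeff_mk, map_add, Multiset.map_cons, Multiset.sum_cons]
      split_ifs
      · simp
      · ring
    have h3 : PowerSeries.derivative ℂ (1 - C ω * X) = - C ω := by
      rw [map_sub, Derivation.leibniz]
      simp
    rw [h2, Multiset.map_cons, Multiset.prod_cons, Derivation.leibniz, h3]
    simp only [smul_eq_mul]
    linear_combination (1 - C ω * X) * ih - (R.map fun ω => (1 : PowerSeries ℂ) - C ω * X).prod * h1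

theorem exists_roots_powerSums {A S : ℕ → ℂ} {D : ℕ} (hA0 : A 0 = 1) (hA : ∀ n, D < n → A n = 0)
    (hrel : ∀ n : ℕ, (n : ℂ) * A n = ∑ k ∈ Finset.Icc 1 n, S k * A (n - k)) :
    ∃ R : Multiset ℂ, R.card ≤ D ∧ ∀ k ≠ 0, S k = -(R.map fun ω => ω ^ k).sum := by
  classical
  set P : Polynomial ℂ := ∑ n ∈ Finset.range (D + 1), Polynomial.C (A n) * Polynomial.X ^ n with hP
  have hPc : ∀ n, P.coeff n = A n := by
    intro n
    rw [hP, Polynomial.finsetSum_coeff]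
    simp only [Polynomial.coeff_C_mul, Polynomial.coeff_X_pow, mul_ite, mul_one, mul_zero,
      Finset.sum_ite_eq, Finset.mem_range]
    split_ifs with h
    · rfl
    · exact (hA n (by omega)).symm
  have hP0 : P ≠ 0 := fun h => by have := hPc 0; rw [h, hA0] at this; simp at this
  have hPd : P.natDegree ≤ D := by
    rw [Polynomial.natDegree_le_iff_coeff_eq_zero]
    intro n hn
    rw [hPc, hA n hn]
  have hfac := (IsAlgClosed.splits P).eq_prod_roots
  have hroot : ∀ z ∈ P.roots, z ≠ 0 := by
    rintro z hz rfl
    have h1 := (Polynomial.mem_roots'.1 hz).2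
    rw [Polynomial.IsRoot.def, ← Polynomial.coeff_zero_eq_eval_zero, hPc, hA0] at h1
    exact one_ne_zero h1
  have hPprod : P = ((P.roots.map fun z => z⁻¹).map fun ω => 1 - Polynomial.C ω * Polynomial.X).prod := by
    have h1 : (P.roots.map fun z => Polynomial.X - Polynomial.C z)
        = P.roots.map fun z => Polynomial.C (-z) * (1 - Polynomial.C z⁻¹ * Polynomial.X) := by
      refine Multiset.map_congr rfl fun z hz => ?_
      have h2 : (Polynomial.C z : Polynomial ℂ) * Polynomial.C z⁻¹ = 1 := by
        rw [← Polynomial.C_mul, mul_inv_cancel₀ (hroot z hz), Polynomial.C_1]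
      rw [Polynomial.C_neg]
      linear_combination (-Polynomial.X) * h2
    rw [h1, Multiset.prod_map_mul] at hfac
    have h3 : (P.roots.map fun z => (Polynomial.C (-z) : Polynomial ℂ)).prod
        = Polynomial.C (P.roots.map fun z => -z).prod := by
      rw [map_multiset_prod Polynomial.C, Multiset.map_map]; rfl
    rw [h3, ← mul_assoc, ← Polynomial.C_mul] at hfac
    have h5 : (P.roots.map (Polynomial.eval 0 ∘ fun z => (1 - Polynomial.C z⁻¹ * Polynomial.X))).prod = 1 := by
      refine Multiset.prod_eq_one fun x hx => ?_
      obtain ⟨z, -, rfl⟩ := Multiset.mem_map.1 hx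
      simp
    have h4 := congrArg (Polynomial.eval 0) hfac
    rw [← Polynomial.coeff_zero_eq_eval_zero, hPc, hA0, Polynomial.eval_mul, Polynomial.eval_C,
      Polynomial.eval_multiset_prod, Multiset.map_map, h5, mul_one] at h4
    rw [Multiset.map_map]
    conv_lhs => rw [hfac, ← h4, Polynomial.C_1, one_mul]
    rfl
  refine ⟨P.roots.map fun z => z⁻¹, ?_, ?_⟩
  · rw [Multiset.card_map]
    exact (Polynomial.card_roots' P).trans hPd
  set R := P.roots.map fun z => z⁻¹ with hR
  have hPs : (P : PowerSeries ℂ) = (R.map fun ω => (1 : PowerSeries ℂ) - C ω * X).prod := by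
    conv_lhs => rw [hPprod]
    rw [← Polynomial.coeToPowerSeries.ringHom_apply, map_multiset_prod, Multiset.map_map]
    congr 1
    refine Multiset.map_congr rfl fun z _ => ?_
    simp
  have h5 := X_mul_deriv_prod_one_sub R
  rw [← hPs] at h5
  have h6 : (X : PowerSeries ℂ) * PowerSeries.derivative ℂ (P : PowerSeries ℂ)
      = P * PowerSeries.mk fun k => if k = 0 then 0 else S k := by
    ext n
    have h7 : coeff n ((X : PowerSeries ℂ) * PowerSeries.derivative ℂ (P : PowerSeries ℂ)) = n * A n := by
      rcases n with _ | n
      · simp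
      · rw [coeff_succ_X_mul, PowerSeries.coeff_derivative, Polynomial.coeff_coe, hPc]
        push_cast; ring
    rw [h7, hrel, mul_comm (P : PowerSeries ℂ), coeff_mul,
      Finset.Nat.sum_antidiagonal_eq_sum_range_succ_mk, Finset.range_eq_Ico, Finset.sum_eq_sum_Ico_succ_bot (by omega)]
    simp only [coeff_mk, if_true, zero_mul, zero_add, Polynomial.coeff_coe, hPc]
    refine Finset.sum_congr ?_ ?_
    · ext k; simp
    · intro k hk
      rw [Finset.mem_Ico] at hk
      rw [if_neg (by omega)]
  have h8 := mul_left_cancel₀ (by simpa using hP0) (h6.symm.trans h5)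
  intro k hk
  have h9 := congrArg (coeff k) h8
  simpa [hk] using h9

theorem norm_le_of_powerSum_bound {ι : Type*} (s : Finset ι) (z : ι → ℂ) (hz : Set.InjOn z s)
    (m : ι → ℂ) {C ρ : ℝ} (hρ : 0 < ρ) (e₀ : ℕ)
    (h : ∀ e ≥ e₀, ‖∑ i ∈ s, m i * z i ^ e‖ ≤ C * ρ ^ e) {i : ι} (hi : i ∈ s) (hm : m i ≠ 0) :
    ‖z i‖ ≤ ρ := by
  classical
  set L : Polynomial ℂ := ∏ j ∈ s.erase i, (Polynomial.X - Polynomial.C (z j)) with hL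
  have hLi : L.eval (z i) ≠ 0 := by
    rw [hL, Polynomial.eval_prod, Finset.prod_ne_zero_iff]
    intro j hj
    rw [Finset.mem_erase] at hj
    simp only [Polynomial.eval_sub, Polynomial.eval_X, Polynomial.eval_C]
    exact sub_ne_zero.2 fun heq => hj.1 (hz hj.2 hi heq.symm)
  have hLj : ∀ j ∈ s, j ≠ i → L.eval (z j) = 0 := by
    intro j hj hne
    rw [hL, Polynomial.eval_prod]
    exact Finset.prod_eq_zero (Finset.mem_erase.2 ⟨hne, hj⟩) (by simp)
  have key : ∀ e, m i * L.eval (z i) * z i ^ e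
      = ∑ k ∈ Finset.range (L.natDegree + 1), L.coeff k * ∑ j ∈ s, m j * z j ^ (e + k) := by
    intro e
    have h1 : ∀ j, m j * L.eval (z j) * z j ^ e
        = ∑ k ∈ Finset.range (L.natDegree + 1), L.coeff k * (m j * z j ^ (e + k)) := by
      intro j
      rw [Polynomial.eval_eq_sum_range, Finset.mul_sum, Finset.sum_mul]
      refine Finset.sum_congr rfl fun k _ => ?_
      rw [pow_add]; ring
    simp_rw [Finset.mul_sum]
    rw [Finset.sum_comm]
    simp_rw [← h1]
    rw [← Finset.add_sum_erase _ _ hi, Finset.sum_eq_zero, add_zero]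
    intro j hj
    rw [Finset.mem_erase] at hj
    rw [hLj j hj.2 hj.1]; ring
  set B : ℝ := ∑ k ∈ Finset.range (L.natDegree + 1), ‖L.coeff k‖ * (C * ρ ^ k) with hB
  have hb : ∀ e ≥ e₀, ‖m i * L.eval (z i)‖ * ‖z i‖ ^ e ≤ B * ρ ^ e := by
    intro e he
    rw [← norm_pow, ← norm_mul, key, hB, Finset.sum_mul]
    refine (norm_sum_le _ _).trans (Finset.sum_le_sum fun k _ => ?_)
    rw [norm_mul, mul_assoc, mul_assoc, ← pow_add, add_comm k e]
    exact mul_le_mul_of_nonneg_left (h _ (by omega)) (norm_nonneg _)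
  by_contra! hlt
  have hpos : 0 < ‖m i * L.eval (z i)‖ := norm_pos_iff.2 (mul_ne_zero hm hLi)
  have hratio : 1 < ‖z i‖ / ρ := (one_lt_div hρ).2 hlt
  obtain ⟨n, hn⟩ := pow_unbounded_of_one_lt (B / ‖m i * L.eval (z i)‖) hratio
  have h1 := hb (max n e₀) (le_max_right _ _)
  have h2 : (‖z i‖ / ρ) ^ n ≤ (‖z i‖ / ρ) ^ (max n e₀) := pow_le_pow_right₀ hratio.le (le_max_left _ _)
  have h3 := hn.trans_le h2
  rw [div_pow, div_lt_div_iff₀ hpos (by positivity)] at h3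
  linarith

theorem norm_le_sqrt_of_powerSum (R : Multiset ℂ) {C ρ : ℝ} (hρ : 0 < ρ) (e₀ : ℕ)
    (h : ∀ e ≥ e₀, ‖(R.map fun ω => ω ^ (2 * e)).sum‖ ≤ C * ρ ^ e) {ω : ℂ} (hω : ω ∈ R) :
    ‖ω‖ ≤ √ρ := by
  classical
  have h1 : ∀ e, (R.map fun ω => ω ^ (2 * e)).sum
      = ∑ z ∈ (R.map fun ω => ω ^ 2).toFinset, ((R.map fun ω => ω ^ 2).count z : ℂ) * z ^ e := by
    intro e
    have : (R.map fun ω => ω ^ (2 * e)) = (R.map fun ω => ω ^ 2).map fun z => z ^ e := by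
      rw [Multiset.map_map]; exact Multiset.map_congr rfl fun x _ => by simp [pow_mul]
    rw [this, Finset.sum_multiset_map_count]
    simp
  have h2 : ω ^ 2 ∈ (R.map fun ω => ω ^ 2).toFinset :=
    Multiset.mem_toFinset.2 (Multiset.mem_map_of_mem _ hω)
  have h3 := norm_le_of_powerSum_bound _ id (Set.injOn_id _)
    (fun z => ((R.map fun ω => ω ^ 2).count z : ℂ)) hρ e₀ (fun e he => by
      simp only [id]; rw [← h1]; exact h e he) h2 (by
      simp only [ne_eq, Nat.cast_eq_zero, Multiset.count_eq_zero, not_not]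
      exact Multiset.mem_map_of_mem _ hω)
  rw [id, norm_pow] at h3
  exact Real.le_sqrt_of_sq_le h3

end PowerSums

section WeilBound

theorem mulChar_prod_apply {R J : Type*} [CommMonoid R] {s : Finset J} (hs : s.Nonempty)
    (c : J → MulChar R ℂ) (a : R) : (∏ j ∈ s, c j) a = ∏ j ∈ s, c j a := by
  induction hs using Finset.Nonempty.cons_induction with
  | singleton j => simp
  | cons j s hj hs ih => rw [Finset.prod_cons, Finset.prod_cons, MulChar.mul_apply, ih]

theorem prod_fiber_mulChar {R S J : Type*} [CommMonoid R] [DecidableEq S] [Fintype J]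
    (h : J → S) (c : J → MulChar R ℂ) (y : S → R) :
    ∏ t ∈ Finset.univ.image h, (∏ j with h j = t, c j) (y t) = ∏ j, c j (y (h j)) := by
  rw [← Finset.prod_fiberwise_of_maps_to (g := h) (t := Finset.univ.image h)
    (fun j _ => Finset.mem_image_of_mem _ (Finset.mem_univ j))]
  refine Finset.prod_congr rfl fun t ht => ?_
  obtain ⟨j, -, rfl⟩ := Finset.mem_image.1 ht
  rw [mulChar_prod_apply ⟨j, by simp⟩]
  refine Finset.prod_congr rfl fun i hi => ?_
  rw [(Finset.mem_filter.1 hi).2]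

theorem weil_bound {p : ℕ} [Fact p.Prime] {ι κ : Type*} [Fintype ι] [Fintype κ]
    (hκ : Fintype.card κ = Fintype.card ι + 1) (χ : MulChar (ZMod p) ℂ) (hχ : χ ≠ 1)
    (a₀ : ZMod p) (α : ι → ZMod p) (β : κ → ZMod p) (hα : ∀ i, α i ≠ a₀) (hβ : ∀ i, β i ≠ a₀) :
    ‖∑ x : ZMod p, χ (x + a₀) * (∏ i, χ (x + α i)) * ∏ i, χ⁻¹ (x + β i)‖
      ≤ 2 * Fintype.card κ * √p := by
  classical
  have hp : p.Prime := Fact.out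
  let K : ℕ → Type := fun k => GaloisField p k
  let : ∀ k, Fintype (K k) := fun k => Fintype.ofFinite _
  have hK : ∀ k ≠ 0, Module.finrank (ZMod p) (K k) = k := fun k hk => GaloisField.finrank p hk
  let h : Option (ι ⊕ κ) → ZMod p := fun j => j.elim a₀ (Sum.elim α β)
  let c : Option (ι ⊕ κ) → MulChar (ZMod p) ℂ :=
    fun j => j.elim χ (Sum.elim (fun _ => χ) fun _ => χ⁻¹)
  set T : Finset (ZMod p) := Finset.univ.image h with hT
  set θ : ZMod p → MulChar (ZMod p) ℂ := fun t => ∏ j with h j = t, c j with hθ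
  have ha₀ : a₀ ∈ T := Finset.mem_image.2 ⟨none, Finset.mem_univ _, rfl⟩
  have hθ₀ : θ a₀ ≠ 1 := by
    have : (Finset.univ.filter fun j => h j = a₀) = {none} := by
      ext j
      rcases j with _ | i | i
      · simp [h]
      · simp [h, hα i]
      · simp [h, hβ i]
    simp only [hθ, this, Finset.prod_singleton]
    exact hχ
  have hTc : T.card ≤ 2 * Fintype.card κ := by
    refine Finset.card_image_le.trans ?_
    simp; omega
  have hprod : ∀ y : ZMod p → ZMod p, ∏ t ∈ T, θ t (y t)
      = χ (y a₀) * (∏ i, χ (y (α i))) * ∏ i, χ⁻¹ (y (β i)) := by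
    intro y
    rw [hT, hθ, prod_fiber_mulChar h c y, Fintype.prod_option, Fintype.prod_sum_type, mul_assoc]
    rfl
  let A : ℕ → ℂ := fun n => ∑ g ∈ monicsOfDegree p n, polyWeight T θ g
  let S : ℕ → ℂ := fun k =>
    ∑ x : K k, ∏ t ∈ T, θ t (Algebra.norm (ZMod p) (x + algebraMap _ (K k) t))
  obtain ⟨R, hRc, hRS⟩ := exists_roots_powerSums (A := A) (S := S) (D := T.card - 1)
    (polyWeight_sum_zero T θ) (fun n hn => polyWeight_sum_eq_zero T θ ha₀ hθ₀ (by omega))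
    (fun n => mul_sum_polyWeight K hK T θ n)
  have hS1 : S 1 = ∑ x : ZMod p, χ (x + a₀) * (∏ i, χ (x + α i)) * ∏ i, χ⁻¹ (x + β i) := by
    have e := GaloisField.equivZmodP p
    change ∑ x : K 1, _ = _
    rw [← Equiv.sum_comp e.symm.toEquiv]
    refine Finset.sum_congr rfl fun x _ => ?_
    rw [← hprod fun t => x + t]
    refine Finset.prod_congr rfl fun t _ => ?_
    congr 1
    rw [← Algebra.norm_eq_of_algEquiv e]
    have h1 : e (algebraMap (ZMod p) (K 1) t) = t := by
      rw [show e (algebraMap (ZMod p) (K 1) t) = algebraMap (ZMod p) (ZMod p) t from e.commutes t]; rfl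
    simp [Algebra.norm_self, h1]
  obtain ⟨e₀, he₀⟩ : ∃ e₀ : ℕ, ∀ e ≥ e₀, Fintype.card κ + 8 ≤ p ^ e := by
    refine ⟨Fintype.card κ + 8, fun e he => he.trans (Nat.lt_pow_self hp.one_lt).le⟩
  have hroots : ∀ ω ∈ R, ‖ω‖ ≤ √p := by
    intro ω hω
    refine norm_le_sqrt_of_powerSum R (C := p * (2 * Fintype.card κ + 5) + (2 * Fintype.card κ + 1))
      (ρ := p) (by exact_mod_cast hp.pos) (e₀ + 1) ?_ hω
    intro e he
    have h1 := hRS (2 * e) (by omega)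
    have h2 : Fintype.card (K (2 * e)) = (p ^ e) ^ 2 := by
      rw [← Nat.card_eq_fintype_card, GaloisField.card p _ (by omega), ← pow_mul, mul_comm]
    have h3 := norm_charSum_norm_le hκ χ hχ a₀ α β hα hβ (K (2 * e)) h2 (he₀ e (by omega))
    have h4 : S (2 * e) = ∑ x : K (2 * e), normChar (K (2 * e)) χ (x + algebraMap _ _ a₀)
        * (∏ i, normChar (K (2 * e)) χ (x + algebraMap _ _ (α i)))
        * ∏ i, normChar (K (2 * e)) χ⁻¹ (x + algebraMap _ _ (β i)) := by
      refine Finset.sum_congr rfl fun x _ => ?_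
      rw [hprod fun t => Algebra.norm (ZMod p) (x + algebraMap _ (K (2 * e)) t)]
      rfl
    rw [← h4, h1, norm_neg] at h3
    refine h3.trans ?_
    have h5 : (1 : ℝ) ≤ (p : ℝ) ^ e := one_le_pow₀ (by exact_mod_cast hp.one_lt.le)
    have h6 : (2 * Fintype.card κ + 1 : ℝ) * 1 ≤ (2 * Fintype.card κ + 1) * (p : ℝ) ^ e :=
      mul_le_mul_of_nonneg_left h5 (by positivity)
    rw [add_mul]
    linarith
  rw [← hS1, hRS 1 one_ne_zero, norm_neg]
  refine (norm_multiset_sum_le _).trans ?_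
  rw [Multiset.map_map]
  refine (Multiset.sum_le_card_nsmul _ (√p) ?_).trans ?_
  · intro x hx
    obtain ⟨ω, hω, rfl⟩ := Multiset.mem_map.1 hx
    simpa using hroots ω hω
  · rw [Multiset.card_map, nsmul_eq_mul]
    refine mul_le_mul_of_nonneg_right ?_ (Real.sqrt_nonneg _)
    exact_mod_cast (by omega : R.card ≤ 2 * Fintype.card κ)

end WeilBound

section Phase
open ComplexConjugate

/-- Polynomial phases of degree at most `D` with leading term `ζ`: all `D`-fold multiplicative
differences with shifts `h₁, …, h_D` are constant, equal to `ζ ^ (h₁ ⋯ h_D)`. -/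
def IsPhase : ℕ → ℂ → (ℕ → ℂ) → Prop
  | 0, ζ, f => ∀ t, f t = ζ
  | D + 1, ζ, f => ∀ h : ℕ, IsPhase D (ζ ^ h) fun t => f (t + h) * conj (f t)

section Nilpotent

variable {R : Type*} [CommRing R]

/-- The algebra of functions of `t` which are polynomial in `z * t`. -/
def scaledPoly (z : R) : Subalgebra R (ℕ → R) := Algebra.adjoin R {fun t : ℕ => z * (t : R)}

theorem scaledPoly_shift (z : R) (h : ℕ) {E : ℕ → R} (hE : E ∈ scaledPoly z) :
    ∃ E' ∈ scaledPoly z, ∀ t, E (t + h) = E t + z * E' t := by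
  induction hE using Algebra.adjoin_induction with
  | mem x hx =>
    rw [Set.mem_singleton_iff] at hx
    subst hx
    refine ⟨algebraMap R _ h, Subalgebra.algebraMap_mem _ _, fun t => ?_⟩
    simp [Pi.algebraMap_apply]; ring
  | algebraMap r =>
    exact ⟨0, Subalgebra.zero_mem _, fun t => by simp [Pi.algebraMap_apply]⟩
  | add x y _ _ hx hy =>
    obtain ⟨x', hx', hx⟩ := hx
    obtain ⟨y', hy', hy⟩ := hy
    exact ⟨x' + y', add_mem hx' hy', fun t => by simp [hx, hy]; ring⟩
  | mul x y hxm hym hx hy =>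
    obtain ⟨x', hx', hx⟩ := hx
    obtain ⟨y', hy', hy⟩ := hy
    refine ⟨x' * y + x * y' + z • (x' * y'), ?_, fun t => by simp [hx, hy]; ring⟩
    exact add_mem (add_mem (mul_mem hx' hym) (mul_mem hxm hy'))
      (Subalgebra.smul_mem _ (mul_mem hx' hy') z)

theorem exists_inv_of_nilpotent (z : R) {D : ℕ} (hz : z ^ (D + 1) = 0) {P : ℕ → R}
    (hP : P ∈ scaledPoly z) : ∃ W ∈ scaledPoly z, ∀ t, (1 + z * P t) * (1 + z * W t) = 1 := by
  refine ⟨-P * ∑ i ∈ Finset.range D, (-(z • P)) ^ i, ?_, fun t => ?_⟩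
  · exact mul_mem (neg_mem hP) (sum_mem fun i _ => pow_mem (neg_mem (Subalgebra.smul_mem _ hP z)) i)
  · have h1 := geom_sum_mul_neg (-(z * P t)) (D + 1)
    have h2 : (-(z * P t)) ^ (D + 1) = 0 := by rw [neg_pow, mul_pow, hz]; ring
    rw [h2, Finset.sum_range_succ'] at h1
    simp only [Pi.mul_apply, Pi.neg_apply, Finset.sum_apply, Pi.pow_apply, Pi.smul_apply, smul_eq_mul]
    simp only [pow_succ, ← Finset.sum_mul] at h1
    linear_combination h1

theorem exists_pow_shift (z : R) {V w : ℕ → R} (hV : V ∈ scaledPoly z) (hw : w ∈ scaledPoly z)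
    (j : ℕ) : ∃ E ∈ scaledPoly z, ∀ t, (V t + z * w t) ^ (j + 1)
      = V t ^ (j + 1) + (j + 1 : ℕ) * z * w t * V t ^ j + z ^ 2 * E t := by
  induction j with
  | zero => exact ⟨0, zero_mem _, fun t => by simp⟩
  | succ j ih =>
    obtain ⟨E, hE, h⟩ := ih
    refine ⟨V * E + (((j + 1 : ℕ) : R) • (w * w * V ^ j)) + z • (w * E), ?_, fun t => ?_⟩
    · exact add_mem (add_mem (mul_mem hV hE) (Subalgebra.smul_mem _ (mul_mem (mul_mem hw hw)
        (pow_mem hV j)) _)) (Subalgebra.smul_mem _ (mul_mem hw hE) _)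
    · rw [pow_succ, h]
      simp only [Pi.add_apply, Pi.mul_apply, Pi.smul_apply, Pi.pow_apply, smul_eq_mul]
      push_cast; ring

end Nilpotent

variable {n : ℕ} [NeZero n] (χ : DirichletCharacter ℂ n)

theorem norm_eq_one_of_isUnit {x : ZMod n} (hx : IsUnit x) : ‖χ x‖ = 1 := by
  obtain ⟨u, rfl⟩ := hx
  exact χ.unit_norm_eq_one u

theorem apply_mul_conj_of_mul_eq_one {x y w : ZMod n} (h : x * w = 1) :
    χ y * conj (χ x) = χ (y * w) := by
  have hx : IsUnit x := IsUnit.of_mul_eq_one _ h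
  have h1 : χ x * χ w = 1 := by rw [← map_mul, h, map_one]
  have h2 : χ x * conj (χ x) = 1 := by
    rw [Complex.mul_conj, Complex.normSq_eq_norm_sq, norm_eq_one_of_isUnit χ hx]; simp
  have h3 : χ x ≠ 0 := left_ne_zero_of_mul_eq_one h1
  rw [map_mul, mul_left_cancel₀ h3 (h2.trans h1.symm)]

theorem pow_apply_one_add {x : ZMod n} (hx : x * x = 0) (y : ZMod n) (h : ℕ) :
    χ (1 + x * y) ^ h = χ (1 + x * (h * y)) := by
  rw [← map_pow]
  congr 1
  induction h with
  | zero => simp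
  | succ h ih =>
    rw [pow_succ, ih]
    push_cast
    linear_combination (h * y ^ 2) * hx

theorem isPhase_of_nilpotent_aux {z : ZMod n} {D : ℕ} (hz : z ^ (D + 1) = 0) {V : ℕ → ZMod n}
    (hV : V ∈ scaledPoly z) (hVi : ∀ t, (1 + z * t) * V t = 1) (k j : ℕ) (hkj : j + 1 + k = D)
    (c : ZMod n) {E : ℕ → ZMod n} (hE : E ∈ scaledPoly z) :
    IsPhase k (χ (1 + z ^ D * (c * (-1) ^ k * ((j + 1).ascFactorial k : ℕ))))
      fun t => χ (1 + z ^ (j + 1) * (c * V t ^ (j + 1) + z * E t)) := by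
  induction k generalizing j c E with
  | zero =>
    intro t
    simp only [add_zero] at hkj
    subst hkj
    have h1 : ∀ i, ∃ y, V t ^ i = 1 + z * y := by
      intro i
      induction i with
      | zero => exact ⟨0, by simp⟩
      | succ i ih =>
        obtain ⟨y, hy⟩ := ih
        exact ⟨y * V t - t * V t, by rw [pow_succ, hy]; linear_combination hVi t⟩
    obtain ⟨y, hy⟩ := h1 (j + 1)
    simp only [hy, pow_zero, mul_one, Nat.ascFactorial_zero, Nat.cast_one]
    congr 1
    linear_combination (c * y + E t) * hz
  | succ k ih =>
    intro h
    set P : ℕ → ZMod n := fun t => c * V t ^ (j + 1) + z * E t with hPdef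
    have hP : P ∈ scaledPoly z :=
      add_mem (Subalgebra.smul_mem _ (pow_mem hV _) c) (Subalgebra.smul_mem _ hE z)
    obtain ⟨W, hW, hWi⟩ := exists_inv_of_nilpotent z hz
      (P := z ^ j • P) (Subalgebra.smul_mem _ hP _)
    obtain ⟨E', hE', hEs⟩ := scaledPoly_shift z h hE
    obtain ⟨V', hV', hVs⟩ := scaledPoly_shift z h hV
    have hV'' : ∀ t, V' t * z = (-h * V t ^ 2 + z * (-h * V t * V' t)) * z := by
      intro t
      have h1 := hVi (t + h)
      rw [hVs] at h1
      push_cast at h1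
      linear_combination (V t) * h1 - (V t + z * V' t) * hVi t
    obtain ⟨V₂, hV₂, hVp⟩ := exists_pow_shift z hV
      (w := -(h : ZMod n) • V ^ 2 + z • (-(h : ZMod n) • (V * V')))
      (add_mem (Subalgebra.smul_mem _ (pow_mem hV 2) _)
        (Subalgebra.smul_mem _ (Subalgebra.smul_mem _ (mul_mem hV hV') _) _)) j
    set Q : ℕ → ZMod n := c • (((j + 1 : ℕ) : ZMod n) • (-(h : ZMod n) • (V * V' * V ^ j)) + V₂) + E' with hQ
    have hQm : Q ∈ scaledPoly z :=
      add_mem (Subalgebra.smul_mem _ (add_mem (Subalgebra.smul_mem _ (Subalgebra.smul_mem _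
        (mul_mem (mul_mem hV hV') (pow_mem hV j)) _) _) hV₂) _) hE'
    have hdiff : ∀ t, P (t + h) = P t + z * (-(c * (j + 1 : ℕ) * h) * V t ^ (j + 2) + z * Q t) := by
      intro t
      have h1 : V (t + h) = V t + z * (-(h : ZMod n) • V ^ 2 + z • (-(h : ZMod n) • (V * V'))) t := by
        rw [hVs]
        simp only [Pi.add_apply, Pi.smul_apply, Pi.mul_apply, Pi.pow_apply, smul_eq_mul]
        linear_combination hV'' t
      simp only [hPdef]
      rw [h1, hVp, hEs, hQ]
      simp only [Pi.add_apply, Pi.smul_apply, Pi.mul_apply, Pi.pow_apply, smul_eq_mul]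
      ring
    have h2 := ih (j + 1) (by omega) (-(c * (j + 1 : ℕ) * h))
      (E := Q + W * (-(c * (j + 1 : ℕ) * h) • V ^ (j + 2) + z • Q))
      (add_mem hQm (mul_mem hW (add_mem (Subalgebra.smul_mem _ (pow_mem hV _) _)
        (Subalgebra.smul_mem _ hQm _))))
    rw [pow_apply_one_add χ (by rw [← pow_add, show D + D = D + 1 + (D - 1) by omega, pow_add, hz, zero_mul])]
    convert h2 using 2
    · congr 1
      have h6 := Nat.succ_ascFactorial (j + 1) k
      rw [← Nat.ascFactorial_succ] at h6
      have h7 := congrArg (Nat.cast (R := ZMod n)) h6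
      push_cast at h7 ⊢
      rw [pow_succ]
      linear_combination (z ^ D * h * c * (-1) ^ k) * h7
    · rename_i t
      have h5 := hWi t
      simp only [Pi.smul_apply, smul_eq_mul] at h5
      change χ (1 + z ^ (j + 1) * P (t + h)) * conj (χ (1 + z ^ (j + 1) * P t)) = _
      rw [apply_mul_conj_of_mul_eq_one χ (w := 1 + z * W t) (by linear_combination h5)]
      congr 1
      rw [hdiff]
      simp only [Pi.add_apply, Pi.smul_apply, Pi.mul_apply, Pi.pow_apply, smul_eq_mul]
      linear_combination h5

theorem isPhase_of_nilpotent {z : ZMod n} {D : ℕ} (hz : z ^ (D + 2) = 0) :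
    IsPhase (D + 1) (χ (1 + z ^ (D + 1) * ((-1) ^ D * (D.factorial : ℕ))))
      fun t => χ (1 + z * t) := by
  intro h
  set V : ℕ → ZMod n := ∑ i ∈ Finset.range (D + 2), (-fun t : ℕ => z * (t : ZMod n)) ^ i with hVdef
  have hV : V ∈ scaledPoly z :=
    sum_mem fun i _ => pow_mem (neg_mem (Algebra.subset_adjoin (Set.mem_singleton _))) i
  have hVi : ∀ t, (1 + z * t) * V t = 1 := by
    intro t
    have h1 := geom_sum_mul_neg (-(z * t)) (D + 2)
    have h2 : (-(z * t)) ^ (D + 2) = 0 := by rw [neg_pow, mul_pow, hz]; ring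
    rw [h2] at h1
    simp only [hVdef, Finset.sum_apply, Pi.pow_apply, Pi.neg_apply]
    linear_combination h1
  have h1 := isPhase_of_nilpotent_aux χ hz hV hVi D 0 (by omega) h (zero_mem _)
  rw [pow_apply_one_add χ (by rw [← pow_add, show D + 1 + (D + 1) = D + 2 + D by omega, pow_add, hz, zero_mul])]
  convert h1 using 2
  · congr 1
    rw [Nat.one_ascFactorial]; ring
  · rename_i t
    rw [apply_mul_conj_of_mul_eq_one χ (hVi t)]
    congr 1
    push_cast
    simp only [Pi.zero_apply]
    linear_combination hVi t

end Phase

section Weyl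
open ComplexConjugate

theorem IsPhase.newton {D : ℕ} {ζ : ℂ} {f : ℕ → ℂ} (hf : IsPhase D ζ f) (h1 : ∀ t, ‖f t‖ = 1) :
    ∃ ψ : ℕ → ℂ, (∀ j, ‖ψ j‖ = 1) ∧ ∀ t, f t = ∏ j ∈ Finset.range (D + 1), ψ j ^ t.choose j := by
  induction D generalizing ζ f with
  | zero => exact ⟨fun _ => ζ, fun _ => by rw [← hf 0, h1], fun t => by simp [hf t]⟩
  | succ D ih =>
    obtain ⟨ψ, hψ, h⟩ := ih (hf 1) (fun t => by simp [h1])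
    refine ⟨fun j => j.casesOn (f 0) ψ, fun j => ?_, fun t => ?_⟩
    · rcases j with _ | j
      · exact h1 0
      · exact hψ j
    · induction t with
      | zero =>
        rw [Finset.prod_range_succ', Finset.prod_eq_one]
        · simp
        · intro j _; simp
      | succ t iht =>
        have h2 : f (t + 1) = f (t + 1) * conj (f t) * f t := by
          rw [mul_assoc, mul_comm (conj (f t)), Complex.mul_conj, Complex.normSq_eq_norm_sq, h1]
          simp
        rw [h2, h t, iht, Finset.prod_range_succ' _ (D + 1), Finset.prod_range_succ' _ (D + 1), ← mul_assoc,
          ← Finset.prod_mul_distrib]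
        congr 1
        · refine Finset.prod_congr rfl fun j _ => ?_
          rw [← pow_add, Nat.choose_succ_succ]
        · simp

theorem norm_pow_sub_pow_le {a b : ℂ} (ha : ‖a‖ ≤ 1) (hb : ‖b‖ ≤ 1) (k : ℕ) :
    ‖a ^ k - b ^ k‖ ≤ k * ‖a - b‖ := by
  induction k with
  | zero => simp
  | succ k ih =>
    have h : a ^ (k + 1) - b ^ (k + 1) = a * (a ^ k - b ^ k) + (a - b) * b ^ k := by ring
    rw [h]
    refine (norm_add_le _ _).trans ?_
    rw [norm_mul, norm_mul, norm_pow]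
    have h1 : ‖a‖ * ‖a ^ k - b ^ k‖ ≤ 1 * (k * ‖a - b‖) := by gcongr
    have h2 : ‖a - b‖ * ‖b‖ ^ k ≤ ‖a - b‖ * 1 := by
      gcongr
      exact pow_le_one₀ (norm_nonneg _) hb
    push_cast
    linarith

theorem norm_prod_sub_prod_le {ι : Type*} (s : Finset ι) {a b : ι → ℂ} (ha : ∀ i ∈ s, ‖a i‖ ≤ 1)
    (hb : ∀ i ∈ s, ‖b i‖ ≤ 1) : ‖∏ i ∈ s, a i - ∏ i ∈ s, b i‖ ≤ ∑ i ∈ s, ‖a i - b i‖ := by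
  induction s using Finset.cons_induction with
  | empty => simp
  | cons i s hi ih =>
    rw [Finset.prod_cons, Finset.prod_cons, Finset.sum_cons]
    have ih := ih (fun j hj => ha j (Finset.mem_cons_of_mem hj)) fun j hj => hb j (Finset.mem_cons_of_mem hj)
    have hi1 := ha i (Finset.mem_cons_self _ _)
    have h : a i * ∏ j ∈ s, a j - b i * ∏ j ∈ s, b j
      = a i * (∏ j ∈ s, a j - ∏ j ∈ s, b j) + (a i - b i) * ∏ j ∈ s, b j := by ring
    rw [h]
    refine (norm_add_le _ _).trans ?_
    rw [norm_mul, norm_mul]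
    have h1 : ‖a i‖ * ‖∏ j ∈ s, a j - ∏ j ∈ s, b j‖ ≤ 1 * ∑ j ∈ s, ‖a j - b j‖ := by gcongr
    have h2 : ‖a i - b i‖ * ‖∏ j ∈ s, b j‖ ≤ ‖a i - b i‖ * 1 := by
      gcongr
      rw [norm_prod]
      exact Finset.prod_le_one (fun _ _ => norm_nonneg _) fun j hj => hb j (Finset.mem_cons_of_mem hj)
    linarith

theorem exists_root_of_unity_near {w : ℂ} (hw : ‖w‖ = 1) {Q : ℕ} (hQ : 0 < Q) :
    ∃ k : Fin Q, ‖w - Complex.exp (2 * Real.pi * (k / Q : ℝ) * Complex.I)‖ ≤ 2 * Real.pi / Q := by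
  have hπ := Real.pi_pos
  obtain ⟨θ, hθ0, hθ1, hθ⟩ : ∃ θ : ℝ, 0 ≤ θ ∧ θ < 2 * Real.pi ∧ w = Complex.exp (θ * Complex.I) := by
    have h1 : w = Complex.exp (Complex.arg w * Complex.I) := by
      have := Complex.norm_mul_exp_arg_mul_I w
      rw [hw] at this; simpa using this.symm
    have h2 := Complex.neg_pi_lt_arg w
    have h3 := Complex.arg_le_pi w
    rcases le_or_gt 0 (Complex.arg w) with h | h
    · exact ⟨_, h, by linarith, h1⟩
    · refine ⟨Complex.arg w + 2 * Real.pi, by linarith, by linarith, ?_⟩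
      push_cast
      rw [add_mul, Complex.exp_add, Complex.exp_two_pi_mul_I, mul_one, ← h1]
  have hQ' : (0 : ℝ) < Q := by exact_mod_cast hQ
  have hf0 : 0 ≤ θ * Q / (2 * Real.pi) := by positivity
  set k := ⌊θ * Q / (2 * Real.pi)⌋₊ with hk
  have hk1 : (k : ℝ) ≤ θ * Q / (2 * Real.pi) := Nat.floor_le hf0
  have hk2 : θ * Q / (2 * Real.pi) < k + 1 := Nat.lt_floor_add_one _
  rw [le_div_iff₀ (by positivity)] at hk1
  rw [div_lt_iff₀ (by positivity)] at hk2
  have hkQ : k < Q := by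
    have : (k : ℝ) < Q := by
      by_contra! h
      nlinarith [mul_le_mul_of_nonneg_right h (by positivity : (0:ℝ) ≤ 2 * Real.pi)]
    exact_mod_cast this
  refine ⟨⟨k, hkQ⟩, ?_⟩
  have h4 : w - Complex.exp (2 * Real.pi * (k / Q : ℝ) * Complex.I)
      = Complex.exp (2 * Real.pi * (k / Q : ℝ) * Complex.I)
        * (Complex.exp (Complex.I * ((θ - 2 * Real.pi * (k / Q) : ℝ) : ℂ)) - 1) := by
    rw [mul_sub, mul_one, ← Complex.exp_add, hθ]
    congr 2
    push_cast; ring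
  change ‖w - Complex.exp (2 * Real.pi * (k / Q : ℝ) * Complex.I)‖ ≤ _
  rw [h4, norm_mul]
  have h5 : ‖Complex.exp (2 * Real.pi * (k / Q : ℝ) * Complex.I)‖ = 1 := by
    have := Complex.norm_exp_ofReal_mul_I (2 * Real.pi * (k / Q))
    push_cast at this ⊢; exact this
  rw [h5, one_mul]
  refine (Real.norm_exp_I_mul_ofReal_sub_one_le (x := θ - 2 * Real.pi * (k / Q))).trans ?_
  rw [Real.norm_eq_abs, abs_le]
  have e1 : 2 * Real.pi * (k / Q) * Q = k * (2 * Real.pi) := by field_simp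
  constructor
  · rw [neg_le, neg_sub, sub_le_iff_le_add]
    rw [show 2 * Real.pi * ((k : ℝ) / Q) = (k * (2 * Real.pi)) / Q by ring, ← sub_le_iff_le_add', ← sub_nonneg]
    have : 0 ≤ 2 * Real.pi / Q := by positivity
    have : (k * (2 * Real.pi)) / Q ≤ θ := by rw [div_le_iff₀ hQ']; exact hk1
    linarith
  · rw [sub_le_iff_le_add, show 2 * Real.pi / Q + 2 * Real.pi * ((k : ℝ) / Q) = ((k + 1) * (2 * Real.pi)) / Q by ring,
      le_div_iff₀ hQ']
    exact hk2.le

/-- Bounded-degree phases are uniformly approximated on `[0, H]` by a small finite family. -/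
theorem exists_phase_net (D : ℕ) {Q H : ℕ} (hQ : 0 < Q) (hH : 0 < H) :
    ∃ 𝒢 : Finset (ℕ → ℂ), 𝒢.card ≤ Q ^ (D + 1) ∧ (∀ g ∈ 𝒢, ∀ h, ‖g h‖ ≤ 1) ∧
      ∀ ζ f, IsPhase D ζ f → (∀ t, ‖f t‖ = 1) → ∃ g ∈ 𝒢, ∀ h ≤ H,
        ‖f h - g h‖ ≤ (D + 1) * (H : ℝ) ^ D * (2 * Real.pi / Q) := by
  classical
  let ρ : Fin Q → ℂ := fun k => Complex.exp (2 * Real.pi * (k / Q : ℝ) * Complex.I)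
  have hρ : ∀ k, ‖ρ k‖ = 1 := by
    intro k
    have := Complex.norm_exp_ofReal_mul_I (2 * Real.pi * (k / Q))
    simp only [ρ]
    push_cast at this ⊢; exact this
  let G : (Fin (D + 1) → Fin Q) → ℕ → ℂ := fun k h => ∏ j : Fin (D + 1), ρ (k j) ^ h.choose j
  refine ⟨Finset.univ.image G, ?_, ?_, ?_⟩
  · refine Finset.card_image_le.trans ?_
    simp
  · intro g hg h
    obtain ⟨k, -, rfl⟩ := Finset.mem_image.1 hg
    simp only [G, norm_prod, norm_pow, hρ]
    simp
  · intro ζ f hf h1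
    obtain ⟨ψ, hψ, hfψ⟩ := hf.newton h1
    choose k hk using fun j => exists_root_of_unity_near (hψ j) hQ
    refine ⟨G fun j => k j, Finset.mem_image_of_mem _ (Finset.mem_univ _), fun h hh => ?_⟩
    rw [hfψ, Finset.prod_range]
    refine (norm_prod_sub_prod_le _ (fun i _ => by simp [hψ]) (fun i _ => by simp [hρ])).trans ?_
    have : ∀ i ∈ (Finset.univ : Finset (Fin (D + 1))), ‖ψ i ^ h.choose i - ρ (k i) ^ h.choose i‖
        ≤ (H : ℝ) ^ D * (2 * Real.pi / Q) := by
      intro i _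
      refine (norm_pow_sub_pow_le (hψ i).le (hρ _).le _).trans ?_
      refine mul_le_mul ?_ (hk i) (norm_nonneg _) (by positivity)
      have : h.choose i ≤ H ^ D := (Nat.choose_le_pow h i).trans
        ((Nat.pow_le_pow_left hh _).trans (Nat.pow_le_pow_right hH (by omega)))
      exact_mod_cast this
    refine (Finset.sum_le_sum this).trans ?_
    simp [mul_assoc]

end Weyl

section WeylCount
open ComplexConjugate

theorem abs_arg_le_mul_norm {w : ℂ} (hw : ‖w‖ = 1) : |Complex.arg w| ≤ Real.pi / 2 * ‖1 - w‖ := by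
  have h0 : w ≠ 0 := by rintro rfl; simp at hw
  have := Complex.angle_le_mul_norm_sub (x := w) (y := 1) hw norm_one
  rw [Complex.angle_eq_abs_arg h0 one_ne_zero, div_one, norm_sub_rev] at this
  exact this

theorem card_near_one_le {ζ : ℂ} {v : ℕ} (hv : 0 < v) (hζ : IsPrimitiveRoot ζ v) {ρ : ℝ} (hρ : 0 ≤ ρ)
    (Y : ℕ) : (((Finset.Icc 1 Y).filter fun y => ‖1 - ζ ^ y‖ ≤ ρ).card : ℝ)
      ≤ (Y / v + 1) * (1 + ρ * v) := by
  classical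
  have hπ := Real.pi_pos
  have hv' : (0 : ℝ) < v := by exact_mod_cast hv
  set B := (Finset.range v).filter fun y => ‖1 - ζ ^ y‖ ≤ ρ with hB
  have hnorm : ∀ r : ℕ, ‖ζ ^ r‖ = 1 := fun r => by
    rw [norm_pow, hζ.norm'_eq_one hv.ne', one_pow]
  have hk : ∀ r : ℕ, ∃ k : ℤ, v * Complex.arg (ζ ^ r) = k * (2 * Real.pi) := by
    intro r
    have h1 : Complex.exp ((v * Complex.arg (ζ ^ r) : ℝ) * Complex.I) = 1 := by
      have h2 := Complex.norm_mul_exp_arg_mul_I (ζ ^ r)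
      rw [hnorm, Complex.ofReal_one, one_mul] at h2
      have h3 := congrArg (· ^ v) h2
      rw [← Complex.exp_nat_mul, ← pow_mul, mul_comm r, pow_mul, hζ.pow_eq_one, one_pow] at h3
      rw [← h3]; congr 1; push_cast; ring
    obtain ⟨k, hk⟩ := Complex.exp_eq_one_iff.1 h1
    refine ⟨k, ?_⟩
    have h4 := congrArg Complex.im hk
    simpa using h4
  choose k hk using hk
  have hBc : (B.card : ℝ) ≤ 1 + ρ * v := by
    set n : ℕ := ⌊ρ * v / 4⌋₊ with hn
    have hn1 : (n : ℝ) ≤ ρ * v / 4 := Nat.floor_le (by positivity)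
    have h1 : B.card ≤ (Finset.Icc (-(n : ℤ)) n).card := by
      refine Finset.card_le_card_of_injOn k ?_ ?_
      · intro r hr
        have hr := (Finset.mem_filter.1 hr).2
        have h2 := abs_arg_le_mul_norm (hnorm r)
        have h3 : |(k r : ℝ)| * (2 * Real.pi) = v * |Complex.arg (ζ ^ r)| := by
          have := congrArg abs (hk r)
          rw [abs_mul, abs_mul, abs_of_pos hv', abs_of_pos (by positivity : 0 < 2 * Real.pi)] at this
          exact this.symm
        have h4 : |(k r : ℝ)| ≤ ρ * v / 4 := by
          have h5 : Real.pi / 2 * ‖1 - ζ ^ r‖ ≤ Real.pi / 2 * ρ := by gcongr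
          have h6 : v * |Complex.arg (ζ ^ r)| ≤ v * (Real.pi / 2 * ρ) := by gcongr; linarith
          nlinarith
        have h7 : |k r| ≤ n := by
          rw [← Int.natCast_natAbs]
          have : (k r).natAbs ≤ n := by
            rw [hn, Nat.le_floor_iff (by positivity)]
            rw [Nat.cast_natAbs]; push_cast; exact h4
          exact_mod_cast this
        rw [Finset.mem_coe, Finset.mem_Icc]
        exact abs_le.1 h7
      · intro r hr s hs h
        have hr := Finset.mem_range.1 (Finset.mem_filter.1 hr).1
        have hs := Finset.mem_range.1 (Finset.mem_filter.1 hs).1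
        refine hζ.pow_inj hr hs (Complex.ext_norm_arg ((hnorm r).trans (hnorm s).symm) ?_)
        have h2 := hk r
        rw [h, ← hk s] at h2
        exact mul_left_cancel₀ hv'.ne' h2
    have h2 : (Finset.Icc (-(n : ℤ)) n).card = 2 * n + 1 := by simp; omega
    rw [h2] at h1
    have h3 : (B.card : ℝ) ≤ 2 * n + 1 := by exact_mod_cast h1
    nlinarith [mul_nonneg hρ hv'.le]
  have h1 : ((Finset.Icc 1 Y).filter fun y => ‖1 - ζ ^ y‖ ≤ ρ).card
      ≤ ((Finset.range (Y / v + 1)) ×ˢ B).card := by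
    refine Finset.card_le_card_of_injOn (fun y => (y / v, y % v)) ?_ ?_
    · intro y hy
      obtain ⟨hy1, hy2⟩ := Finset.mem_filter.1 hy
      rw [Finset.mem_Icc] at hy1
      rw [Finset.mem_coe, Finset.mem_product, Finset.mem_range, Finset.mem_filter, Finset.mem_range]
      refine ⟨Nat.lt_succ_of_le (Nat.div_le_div_right hy1.2), Nat.mod_lt _ hv, ?_⟩
      rw [← pow_mod_orderOf, ← hζ.eq_orderOf] at hy2
      exact hy2
    · intro x _ y _ h
      simp only [Prod.mk.injEq] at h
      rw [← Nat.div_add_mod x v, ← Nat.div_add_mod y v, h.1, h.2]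
  rw [Finset.card_product, Finset.card_range] at h1
  have h2 : (((Finset.Icc 1 Y).filter fun y => ‖1 - ζ ^ y‖ ≤ ρ).card : ℝ) ≤ ((Y / v : ℕ) + 1 : ℝ) * B.card := by
    exact_mod_cast h1
  refine h2.trans ?_
  gcongr
  exact Nat.cast_div_le

theorem norm_sq_sum_le_vanDerCorput (f : ℕ → ℂ) (L : ℕ) (hf : ∀ t, ‖f t‖ = 1) :
    ‖∑ t ∈ Finset.range L, f t‖ ^ 2 ≤ L + 2 * ∑ h ∈ Finset.Ico 1 L,
      ‖∑ t ∈ Finset.range (L - h), f (t + h) * conj (f t)‖ := by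
  have h1 : ∀ L : ℕ, ((‖∑ t ∈ Finset.range L, f t‖ ^ 2 : ℝ) : ℂ) = L
      + ∑ h ∈ Finset.Ico 1 L, ∑ t ∈ Finset.range (L - h), f (t + h) * conj (f t)
      + conj (∑ h ∈ Finset.Ico 1 L, ∑ t ∈ Finset.range (L - h), f (t + h) * conj (f t)) := by
    intro L
    have hc : ∀ L : ℕ, ∑ h ∈ Finset.Ico 1 L, ∑ t ∈ Finset.range (L - h), f (t + h) * conj (f t)
        = ∑ s ∈ Finset.range L, ∑ t ∈ Finset.range s, f s * conj (f t) := by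
      intro L
      rw [Finset.sum_sigma', Finset.sum_sigma']
      refine Finset.sum_nbij' (fun x => ⟨x.2 + x.1, x.2⟩) (fun x => ⟨x.1 - x.2, x.2⟩) ?_ ?_ ?_ ?_ ?_
      · rintro ⟨h, t⟩ hx; simp at hx ⊢; omega
      · rintro ⟨h, t⟩ hx; simp at hx ⊢; omega
      · rintro ⟨h, t⟩ hx; simp at hx ⊢
      · rintro ⟨h, t⟩ hx; simp at hx ⊢; omega
      · rintro ⟨h, t⟩ hx; rfl
    rw [hc]
    induction L with
    | zero => simp
    | succ L ih =>
      have hsq : ∀ z : ℂ, ((‖z‖ ^ 2 : ℝ) : ℂ) = z * conj z := fun z => by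
        rw [Complex.mul_conj, Complex.normSq_eq_norm_sq]
      have hL : f L * conj (f L) = 1 := by rw [← hsq, hf]; simp
      rw [hsq] at ih ⊢
      rw [Finset.sum_range_succ, Finset.sum_range_succ, ← Finset.mul_sum]
      simp only [map_add, map_mul] at ih ⊢
      rw [map_sum conj _ (Finset.range L)] at ih ⊢
      push_cast
      simp only [map_sum, Complex.conj_conj] at ih ⊢
      linear_combination ih + hL
  have h2 := congrArg norm (h1 L)
  rw [Complex.norm_real, Real.norm_of_nonneg (by positivity)] at h2
  rw [h2]
  refine (norm_add_le _ _).trans ?_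
  rw [Complex.norm_conj]
  have h3 := norm_add_le (L : ℂ) (∑ h ∈ Finset.Ico 1 L, ∑ t ∈ Finset.range (L - h), f (t + h) * conj (f t))
  rw [Complex.norm_natCast] at h3
  have h4 := norm_sum_le (Finset.Ico 1 L) fun h => ∑ t ∈ Finset.range (L - h), f (t + h) * conj (f t)
  linarith

theorem weyl_count {H T E : ℕ} (hH : 0 < H) (hT : ∀ y, 0 < y → y ≤ H ^ E → y.divisors.card ≤ T)
    (D : ℕ) (hD : D ≤ E) (K : ℝ) (hK : 1 ≤ K) (hKH : (8 * K) ^ 2 ^ D / 8 ≤ H) {L : ℕ} (hL : L ≤ H)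
    {ζ : ℂ} {f : ℕ → ℂ} (hf : IsPhase (D + 1) ζ f) (hf1 : ∀ t, ‖f t‖ = 1)
    (hS : H / K ≤ ‖∑ t ∈ Finset.range L, f t‖) :
    ((H : ℝ) / ((8 * K) ^ 2 ^ D / 8)) ^ D ≤ T ^ D * (((Finset.Icc 1 (H ^ D)).filter
      fun y => ‖1 - ζ ^ y‖ ≤ 2 * ((8 * K) ^ 2 ^ D / 8) / H).card : ℝ) := by
  classical
  have hH' : (0 : ℝ) < H := by exact_mod_cast hH
  induction D generalizing K L ζ f with
  | zero =>
    have h1 : ∀ t, f t = f 0 * ζ ^ t := by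
      intro t
      induction t with
      | zero => simp
      | succ t ih =>
        have h2 := hf 1 t
        simp only [pow_one] at h2
        have h3 : f t * conj (f t) = 1 := by
          rw [Complex.mul_conj, Complex.normSq_eq_norm_sq, hf1]; simp
        rw [pow_succ, ← mul_assoc, ← ih, ← h2]
        linear_combination -f (t + 1) * h3
    have hζ : ‖ζ‖ = 1 := by
      have h2 := hf1 1
      rw [h1, norm_mul, hf1, pow_one, one_mul] at h2
      exact h2
    have h4 : (∑ t ∈ Finset.range L, f t) * (1 - ζ) = f 0 * (1 - ζ ^ L) := by
      rw [Finset.sum_congr rfl fun t _ => h1 t, ← Finset.mul_sum, mul_assoc, geom_sum_mul_neg]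
    have h5 := congrArg norm h4
    rw [norm_mul, norm_mul, hf1, one_mul] at h5
    have h6 : ‖1 - ζ ^ L‖ ≤ 2 := by
      refine (norm_sub_le _ _).trans ?_
      rw [norm_pow, hζ]; norm_num
    have h7 : H / K * ‖1 - ζ‖ ≤ 2 := by
      refine le_trans ?_ (h5.trans_le h6)
      gcongr
    have h8 : ‖1 - ζ‖ ≤ 2 * K / H := by
      rw [le_div_iff₀ hH']
      have : H / K * ‖1 - ζ‖ = ‖1 - ζ‖ * H / K := by ring
      rw [this, div_le_iff₀ (by linarith)] at h7
      exact h7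
    simp [h8, Finset.filter_singleton]
  | succ D ih =>
    set κ : ℝ := (8 * K) ^ 2 ^ (D + 1) / 8 with hκ
    have hκ' : (8 * (8 * K ^ 2)) ^ 2 ^ D / 8 = κ := by
      rw [hκ, pow_succ 2 D, mul_comm (2 ^ D) 2, pow_mul]; congr 2; ring
    have hKκ : 8 * K ^ 2 ≤ κ := by
      rw [← hκ']
      have h1 : 1 ≤ 8 * (8 * K ^ 2) := by nlinarith
      have h2 := pow_le_pow_right₀ h1 (Nat.one_le_two_pow (n := D))
      rw [pow_one] at h2
      linarith
    have hκ0 : 0 < κ := by nlinarith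
    set G : ℕ → ℝ := fun h => ‖∑ t ∈ Finset.range (L - h), f (t + h) * conj (f t)‖ with hG
    have hGle : ∀ h, G h ≤ H := by
      intro h
      refine (norm_sum_le _ _).trans ?_
      simp only [norm_mul, Complex.norm_conj, hf1]
      simp
      exact_mod_cast (by omega : L ≤ H + h)
    set 𝓗 := (Finset.Ico 1 L).filter fun h => H / (8 * K ^ 2) ≤ G h with h𝓗
    have h𝓗c : H / (8 * K ^ 2) ≤ (𝓗.card : ℝ) := by
      have h1 := norm_sq_sum_le_vanDerCorput f L hf1
      have h2 : (H / K) ^ 2 ≤ ‖∑ t ∈ Finset.range L, f t‖ ^ 2 := by gcongr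
      have h3 : ∑ h ∈ Finset.Ico 1 L, G h ≤ 𝓗.card * H + H * (H / (8 * K ^ 2)) := by
        rw [← Finset.sum_filter_add_sum_filter_not _ fun h => H / (8 * K ^ 2) ≤ G h]
        refine add_le_add ?_ ?_
        · refine (Finset.sum_le_card_nsmul _ _ (H : ℝ) fun h _ => hGle h).trans ?_
          rw [nsmul_eq_mul]
        · refine (Finset.sum_le_card_nsmul _ _ (H / (8 * K ^ 2)) fun h hh => ?_).trans ?_
          · exact (not_le.1 (Finset.mem_filter.1 hh).2).le
          · rw [nsmul_eq_mul]
            gcongr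
            refine (Finset.card_filter_le _ _).trans ?_
            simp; omega
      have hLH : (L : ℝ) ≤ H := by exact_mod_cast hL
      have h4 : (H / K) ^ 2 ≤ H + 2 * (𝓗.card * H + H * (H / (8 * K ^ 2))) := by linarith
      have h5 : (H / K) ^ 2 = H * (8 * (H / (8 * K ^ 2))) := by field_simp
      have h6 : 8 * (H / (8 * K ^ 2)) ≤ 1 + 2 * 𝓗.card + 2 * (H / (8 * K ^ 2)) := by
        rw [h5] at h4
        refine le_of_mul_le_mul_left (h4.trans_eq ?_) hH'
        ring
      have h7 : 1 ≤ H / (8 * K ^ 2) := by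
        rw [le_div_iff₀ (by positivity)]; linarith
      linarith
    set Y : ℕ → Finset ℕ := fun h => (Finset.Icc 1 (H ^ D)).filter
      fun y => ‖1 - (ζ ^ h) ^ y‖ ≤ 2 * κ / H with hY
    have hYc : ∀ h ∈ 𝓗, (H / κ) ^ D ≤ T ^ D * ((Y h).card : ℝ) := by
      intro h hh
      have h1 := ih (by omega) (8 * K ^ 2) (by nlinarith) (by rw [hκ']; exact hKH) (L := L - h) (by omega)
        (hf h) (fun t => by simp [hf1]) (Finset.mem_filter.1 hh).2
      rw [hκ'] at h1
      exact h1
    set Z := (Finset.Icc 1 (H ^ (D + 1))).filter fun y => ‖1 - ζ ^ y‖ ≤ 2 * κ / H with hZ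
    have hcard : (𝓗.sigma Y).card ≤ T * Z.card := by
      refine Finset.card_le_mul_card_image_of_maps_to (f := fun x => x.1 * x.2) ?_ T ?_
      · rintro ⟨h, y⟩ hx
        rw [Finset.mem_sigma] at hx
        obtain ⟨hx1, hx2⟩ := hx
        have hx1 := Finset.mem_Ico.1 (Finset.mem_filter.1 hx1).1
        obtain ⟨hx2, hx3⟩ := Finset.mem_filter.1 hx2
        rw [Finset.mem_Icc] at hx2
        refine Finset.mem_filter.2 ⟨Finset.mem_Icc.2 ⟨Nat.mul_pos hx1.1 hx2.1, ?_⟩, ?_⟩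
        · rw [pow_succ, mul_comm (H ^ D)]
          exact Nat.mul_le_mul (by omega) hx2.2
        · simp only at hx3 ⊢
          rw [pow_mul]; exact hx3
      · intro z hz
        have hz1 := Finset.mem_Icc.1 (Finset.mem_filter.1 hz).1
        refine le_trans ?_ (hT z hz1.1 (hz1.2.trans (Nat.pow_le_pow_right hH hD)))
        refine Finset.card_le_card_of_injOn (fun x => x.1) ?_ ?_
        · intro x hx
          obtain ⟨-, rfl⟩ := Finset.mem_filter.1 hx
          exact Nat.mem_divisors.2 ⟨Dvd.intro _ rfl, by omega⟩
        · rintro ⟨h, y⟩ hx ⟨h', y'⟩ hx' heq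
          simp only at heq
          subst heq
          have e1 := (Finset.mem_filter.1 hx).2
          have e2 := (Finset.mem_filter.1 hx').2
          simp only at e1 e2
          have : h ≠ 0 := by rintro rfl; omega
          rw [Nat.eq_of_mul_eq_mul_left (Nat.pos_of_ne_zero this) (e1.trans e2.symm)]
    have h1 : (𝓗.card : ℝ) * (H / κ) ^ D ≤ T ^ D * (𝓗.sigma Y).card := by
      rw [Finset.card_sigma, ← nsmul_eq_mul, ← Finset.sum_const]
      push_cast
      rw [Finset.mul_sum]
      exact Finset.sum_le_sum hYc
    have h2 : ((𝓗.sigma Y).card : ℝ) ≤ T * Z.card := by exact_mod_cast hcard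
    have h3 : H / κ ≤ (𝓗.card : ℝ) := le_trans (by gcongr) h𝓗c
    calc (H / κ) ^ (D + 1) = (H / κ) * (H / κ) ^ D := by rw [pow_succ, mul_comm]
      _ ≤ 𝓗.card * (H / κ) ^ D := by gcongr
      _ ≤ T ^ D * (𝓗.sigma Y).card := h1
      _ ≤ T ^ D * (T * Z.card) := by gcongr
      _ = T ^ (D + 1) * Z.card := by ring

end WeylCount

section Utilities

theorem exists_forall_mul_rpow_le (C : ℝ) {a b : ℝ} (hab : a < b) :
    ∃ M : ℝ, 1 ≤ M ∧ ∀ X : ℝ, M ≤ X → C * X ^ a ≤ X ^ b := by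
  have h := (tendsto_rpow_atTop (sub_pos.2 hab)).eventually (Filter.eventually_ge_atTop C)
  obtain ⟨M, hM⟩ := Filter.eventually_atTop.1 h
  refine ⟨max M 1, le_max_right _ _, fun X hX => ?_⟩
  have hX0 : 0 < X := lt_of_lt_of_le one_pos ((le_max_right _ _).trans hX)
  have h1 := hM X ((le_max_left _ _).trans hX)
  calc C * X ^ a ≤ X ^ (b - a) * X ^ a := by gcongr
    _ = X ^ b := by rw [← Real.rpow_add hX0]; congr 1; ring

theorem exists_card_divisors_le {η : ℝ} (hη : 0 < η) :
    ∃ C : ℝ, 1 ≤ C ∧ ∀ n : ℕ, n ≠ 0 → (n.divisors.card : ℝ) ≤ C * (n : ℝ) ^ η := by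
  classical
  set P : ℕ := ⌈(2 : ℝ) ^ (1 / η)⌉₊ with hP
  set c₀ : ℝ := 1 + 1 / (η * Real.log 2) with hc₀
  have hlog : 0 < Real.log 2 := Real.log_pos (by norm_num)
  have hc1 : 1 ≤ c₀ := by rw [hc₀]; linarith [show 0 < 1 / (η * Real.log 2) by positivity]
  refine ⟨c₀ ^ P, one_le_pow₀ hc1, fun n hn => ?_⟩
  have hloc : ∀ p ∈ n.primeFactors, ((n.factorization p + 1 : ℕ) : ℝ)
      ≤ (if p < P then c₀ else 1) * ((p : ℝ) ^ n.factorization p) ^ η := by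
    intro p hp
    have hp2 : (2 : ℝ) ≤ p := by exact_mod_cast (Nat.prime_of_mem_primeFactors hp).two_le
    set k := n.factorization p
    have h0 : ((p : ℝ) ^ k) ^ η = ((p : ℝ) ^ η) ^ k := by
      rw [← Real.rpow_natCast, ← Real.rpow_natCast, ← Real.rpow_mul (by linarith),
        ← Real.rpow_mul (by linarith), mul_comm]
    split_ifs with hpP
    · have h1 : ((2 : ℝ) ^ η) ^ k ≤ ((p : ℝ) ^ η) ^ k := by gcongr
      have h2 : 1 + k * (η * Real.log 2) ≤ ((2 : ℝ) ^ η) ^ k := by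
        rw [Real.rpow_def_of_pos (by norm_num), ← Real.exp_nat_mul]
        have := Real.add_one_le_exp (k * (Real.log 2 * η))
        linarith
      have h3 : ((k + 1 : ℕ) : ℝ) ≤ c₀ * (1 + k * (η * Real.log 2)) := by
        rw [hc₀]
        have h4 : (1 / (η * Real.log 2)) * (k * (η * Real.log 2)) = k := by field_simp
        have h5 : 0 < 1 / (η * Real.log 2) := by positivity
        have h6 : 0 ≤ k * (η * Real.log 2) := by positivity
        push_cast
        linarith
      rw [h0]
      exact h3.trans (by gcongr; exact h2.trans h1)
    · rw [h0, one_mul]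
      have h1 : (2 : ℝ) ≤ (p : ℝ) ^ η := by
        have h2 : (2 : ℝ) ^ (1 / η) ≤ p := (Nat.le_ceil _).trans (by exact_mod_cast not_lt.1 hpP)
        calc (2 : ℝ) = ((2 : ℝ) ^ (1 / η)) ^ η := by
              rw [← Real.rpow_mul (by norm_num), one_div_mul_cancel hη.ne', Real.rpow_one]
          _ ≤ _ := by gcongr
      have h2 : (2 : ℝ) ^ k ≤ ((p : ℝ) ^ η) ^ k := by gcongr
      have h3 : k + 1 ≤ 2 ^ k := Nat.lt_two_pow_self
      exact le_trans (by exact_mod_cast h3) h2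
  rw [Nat.card_divisors hn]
  push_cast
  have hprod : ∏ p ∈ n.primeFactors, ((p : ℝ) ^ n.factorization p) ^ η = (n : ℝ) ^ η := by
    rw [Real.finsetProd_rpow _ _ (fun i _ => by positivity)]
    congr 1
    conv_rhs => rw [← Nat.prod_factorization_pow_eq_self hn]
    rw [Finsupp.prod, Nat.support_factorization]; push_cast; rfl
  calc ∏ p ∈ n.primeFactors, ((n.factorization p : ℝ) + 1)
      ≤ ∏ p ∈ n.primeFactors, (if p < P then c₀ else 1) * ((p : ℝ) ^ n.factorization p) ^ η :=
        Finset.prod_le_prod (fun _ _ => by positivity) fun p hp => by exact_mod_cast hloc p hp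
    _ = (∏ p ∈ n.primeFactors, (if p < P then c₀ else 1)) * (n : ℝ) ^ η := by
        rw [Finset.prod_mul_distrib, hprod]
    _ ≤ c₀ ^ P * (n : ℝ) ^ η := by
        gcongr
        rw [Finset.prod_ite, Finset.prod_const_one, mul_one, Finset.prod_const]
        refine pow_le_pow_right₀ hc1 ?_
        calc _ ≤ (Finset.range P).card := Finset.card_le_card fun p hp =>
              Finset.mem_range.2 (Finset.mem_filter.1 hp).2
          _ = P := Finset.card_range P

theorem norm_sum_range_shift_sub_le {f : ℕ → ℂ} (hf : ∀ n, ‖f n‖ ≤ 1) (N k : ℕ) :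
    ‖∑ n ∈ Finset.range N, f (n + k) - ∑ n ∈ Finset.range N, f n‖ ≤ 2 * k := by
  have h1 : ∑ n ∈ Finset.range N, f (n + k) - ∑ n ∈ Finset.range N, f n
      = ∑ i ∈ Finset.range k, f (N + i) - ∑ i ∈ Finset.range k, f i := by
    have h2 := Finset.sum_range_add f N k
    have h3 := Finset.sum_range_add f k N
    rw [add_comm k N] at h3
    simp_rw [add_comm k] at h3
    linear_combination h2 - h3
  rw [h1]
  have h4 : ∀ g : ℕ → ℂ, (∀ n, ‖g n‖ ≤ 1) → ‖∑ i ∈ Finset.range k, g i‖ ≤ k := fun g hg => by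
    refine (norm_sum_le _ _).trans ((Finset.sum_le_card_nsmul _ _ 1 fun i _ => hg i).trans ?_)
    simp
  have h5 := h4 (fun i => f (N + i)) fun i => hf _
  have h6 := h4 f hf
  exact (norm_sub_le _ _).trans (by linarith)

end Utilities

section Primitive

/-- `χ` is nontrivial on the kernel of reduction modulo `n / p` for every prime `p ∣ n`. -/
def IsLocallyPrimitive {n : ℕ} (χ : DirichletCharacter ℂ n) : Prop :=
  ∀ p : ℕ, p.Prime → p ∣ n → ∃ y : ZMod n,
    IsUnit (1 + ((n / p : ℕ) : ZMod n) * y) ∧ χ (1 + ((n / p : ℕ) : ZMod n) * y) ≠ 1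

theorem IsLocallyPrimitive.of_isPrimitive {n : ℕ} [NeZero n] {χ : DirichletCharacter ℂ n}
    (hχ : χ.IsPrimitive) : IsLocallyPrimitive χ := by
  intro p hp hpn
  by_contra! hcon
  have hd : n / p ∣ n := Nat.div_dvd_of_dvd hpn
  have hn : 0 < n := NeZero.pos n
  have h1 : χ.FactorsThrough (n / p) := by
    rw [DirichletCharacter.factorsThrough_iff_ker_unitsMap hd]
    intro u hu
    rw [MonoidHom.mem_ker] at hu ⊢
    have h2 : ZMod.castHom hd (ZMod (n / p)) (u : ZMod n) = 1 := by
      have := congrArg Units.val hu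
      simpa [ZMod.unitsMap_def] using this
    obtain ⟨k, hk⟩ : ∃ k : ℤ, ((u : ZMod n).val : ℤ) = 1 + (n / p : ℕ) * k := by
      rw [← ZMod.natCast_zmod_val (u : ZMod n), map_natCast] at h2
      have h3 : (((u : ZMod n).val : ℤ) : ZMod (n / p)) = ((1 : ℤ) : ZMod (n / p)) := by
        push_cast; exact h2
      rw [ZMod.intCast_eq_intCast_iff_dvd_sub] at h3
      obtain ⟨k, hk⟩ := h3
      exact ⟨-k, by linarith⟩
    have h4 : (u : ZMod n) = 1 + ((n / p : ℕ) : ZMod n) * (k : ZMod n) := by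
      rw [← ZMod.natCast_zmod_val (u : ZMod n)]
      have := congrArg (Int.cast (R := ZMod n)) hk
      simpa only [Int.cast_add, Int.cast_mul, Int.cast_natCast, Int.cast_one] using this
    have h5 := hcon k (h4 ▸ u.isUnit)
    rw [← h4] at h5
    apply Units.ext
    rw [MulChar.coe_toUnitHom, h5, Units.val_one]
  have h2 : χ.conductor ≤ n / p := Nat.sInf_le ((DirichletCharacter.mem_conductorSet_iff χ).2 h1)
  rw [hχ] at h2
  exact absurd h2 (not_le.2 (Nat.div_lt_self hn hp.one_lt))

theorem orderOf_apply_one_add {q : ℕ} [NeZero q] {χ : DirichletCharacter ℂ q}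
    (hχ : IsLocallyPrimitive χ) {W : ℕ} {u u' : ZMod q} (hu : u * u' = 1)
    (hW : ((W : ZMod q) * u) * ((W : ZMod q) * u) = 0) :
    orderOf (χ (1 + (W : ZMod q) * u)) = q / q.gcd W := by
  have hq : 0 < q := NeZero.pos q
  set g := q.gcd W with hg
  have hg0 : 0 < g := Nat.gcd_pos_of_pos_left _ hq
  obtain ⟨v, hv⟩ : g ∣ q := Nat.gcd_dvd_left _ _
  obtain ⟨w, hw⟩ : g ∣ W := Nat.gcd_dvd_right _ _
  have hvq : q / g = v := by rw [hv, Nat.mul_div_cancel_left _ hg0]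
  have hv0 : 0 < v := Nat.pos_of_ne_zero (by rintro rfl; omega)
  have hcop : Nat.Coprime v w := by
    have := Nat.coprime_div_gcd_div_gcd (m := q) (n := W) hg0
    rwa [← hg, hvq, show W / g = w by rw [hw, Nat.mul_div_cancel_left _ hg0]] at this
  have hpow : ∀ k : ℕ, χ (1 + (W : ZMod q) * u) ^ k = χ (1 + (W : ZMod q) * u * k) := by
    intro k
    have := pow_apply_one_add χ hW 1 k
    rwa [mul_one, mul_one] at this
  rw [hvq]
  refine orderOf_eq_of_pow_and_pow_div_prime hv0 ?_ ?_
  · rw [hpow]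
    have h1 : (W : ZMod q) * v = 0 := by
      rw [← Nat.cast_mul, ZMod.natCast_eq_zero_iff]
      exact ⟨w, by rw [hw]; conv_rhs => rw [hv]
                   ring⟩
    rw [show (W : ZMod q) * u * v = (W * v) * u by ring, h1, zero_mul, add_zero, map_one]
  · intro p hp hpv heq
    obtain ⟨y, hy, hy1⟩ := hχ p hp (hpv.trans ⟨g, by rw [mul_comm]; exact hv⟩)
    apply hy1
    have hpw : Nat.Coprime w p := (Nat.Coprime.coprime_dvd_left hpv hcop).symm
    obtain ⟨c, hc⟩ : ∃ c : ℤ, (p : ℤ) ∣ w * c - 1 := by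
      have h1 := Int.emod_emod_of_dvd
      have h2 := Nat.gcd_eq_gcd_ab w p
      rw [hpw] at h2
      exact ⟨Nat.gcdA w p, -Nat.gcdB w p, by push_cast at h2; linarith⟩
    obtain ⟨d, hd⟩ := hc
    have hqp : ((q / p : ℕ) : ZMod q) * (w * c) = ((q / p : ℕ) : ZMod q) := by
      have h1 : ((q / p : ℕ) : ZMod q) * p = 0 := by
        rw [← Nat.cast_mul, Nat.div_mul_cancel (hpv.trans ⟨g, by rw [mul_comm]; exact hv⟩),
          ZMod.natCast_self]
      have h2 := congrArg (Int.cast (R := ZMod q)) hd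
      push_cast at h2
      linear_combination ((q / p : ℕ) : ZMod q) * h2 + (d : ZMod q) * h1
    have hWv : (W : ZMod q) * (v / p : ℕ) = ((q / p : ℕ) : ZMod q) * w := by
      rw [← Nat.cast_mul, ← Nat.cast_mul]
      congr 1
      obtain ⟨e, rfl⟩ := hpv
      rw [Nat.mul_div_cancel_left _ hp.pos, hw, hv, show g * (p * e) = p * (g * e) by ring,
        Nat.mul_div_cancel_left _ hp.pos]
      ring
    have h3 := congrArg (· ^ (u' * c * y).val) heq
    simp only [one_pow] at h3
    rw [← pow_mul, hpow] at h3
    rw [← h3]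
    congr 2
    push_cast
    rw [ZMod.natCast_zmod_val]
    linear_combination (-y) * hqp - (u * u' * c * y) * hWv - (((q / p : ℕ) : ZMod q) * w * c * y) * hu

end Primitive

section ShortSums

theorem norm_sum_le_of_shift {f : ℕ → ℂ} (hf : ∀ n, ‖f n‖ ≤ 1) {w H : ℕ} (hH : 0 < H) {B : ℝ}
    (hB : ∀ n, ‖∑ h ∈ Finset.range H, f (n + w * h)‖ ≤ H * B) (N : ℕ) :
    ‖∑ n ∈ Finset.range N, f n‖ ≤ N * B + 2 * (w * H) := by
  have hH' : (0 : ℝ) < H := by exact_mod_cast hH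
  set S := ∑ n ∈ Finset.range N, f n with hS
  have h1 : ∀ h ∈ Finset.range H, ‖∑ n ∈ Finset.range N, f (n + w * h) - S‖ ≤ 2 * (w * H) := by
    intro h hh
    refine (norm_sum_range_shift_sub_le hf N (w * h)).trans ?_
    have : (h : ℝ) ≤ H := by exact_mod_cast (Finset.mem_range.1 hh).le
    push_cast
    gcongr
  have h2 : (H : ℂ) * S = ∑ n ∈ Finset.range N, ∑ h ∈ Finset.range H, f (n + w * h) -
      ∑ h ∈ Finset.range H, (∑ n ∈ Finset.range N, f (n + w * h) - S) := by
    rw [Finset.sum_sub_distrib, Finset.sum_comm, Finset.sum_const, Finset.card_range, nsmul_eq_mul]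
    ring
  have h3 : (H : ℝ) * ‖S‖ ≤ N * (H * B) + H * (2 * (w * H)) := by
    have h4 : (H : ℝ) * ‖S‖ = ‖(H : ℂ) * S‖ := by simp
    rw [h4, h2]
    refine (norm_sub_le _ _).trans (add_le_add ?_ ?_)
    · refine (norm_sum_le _ _).trans ((Finset.sum_le_card_nsmul _ _ _ fun n _ => hB n).trans ?_)
      simp
    · refine (norm_sum_le _ _).trans ((Finset.sum_le_card_nsmul _ _ _ h1).trans ?_)
      simp
  have h5 : (H : ℝ) * ‖S‖ ≤ H * (N * B + 2 * (w * H)) := by linarith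
  exact le_of_mul_le_mul_left h5 hH'

theorem weyl_numerics {D : ℕ} {κ T v o H M : ℝ} (hκ : 1 ≤ κ) (hT : 1 ≤ T) (hH : 0 < H) (hM : 1 ≤ M)
    (ho : v ≤ o * M) (ho0 : 0 < o) (hov : o ≤ v)
    (h1 : 8 * M * κ ^ (D + 1) * T ^ D < v) (h2 : 8 * M * κ ^ (D + 1) * T ^ D < H)
    (h3 : 8 * M * κ ^ (D + 1) * T ^ D * v < H ^ (D + 1)) (hD : 1 ≤ D) :
    T ^ D * ((H ^ D / o + 1) * (1 + 2 * κ / H * o)) < (H / κ) ^ D := by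
  have hκ0 : 0 < κ := by linarith
  have hv : 0 < v := ho0.trans_le hov
  have hTD : 1 ≤ T ^ D := one_le_pow₀ hT
  have hκD : 1 ≤ κ ^ D := one_le_pow₀ hκ
  have hR : κ ^ D * T ^ D ≤ κ ^ (D + 1) * T ^ D := by
    have := pow_le_pow_right₀ hκ (Nat.le_succ D)
    gcongr
  have hR1 : 1 ≤ κ ^ (D + 1) * T ^ D := by nlinarith
  set R := κ ^ (D + 1) * T ^ D with hRdef
  have e1 : 8 * M * κ ^ (D + 1) * T ^ D = 8 * M * R := by rw [hRdef]; ring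
  rw [e1] at h1 h2 h3
  have hH1 : 1 ≤ H := by nlinarith
  rw [div_pow, lt_div_iff₀ (by positivity)]
  have hHD : H ≤ H ^ D := by
    calc H = H ^ 1 := (pow_one H).symm
      _ ≤ H ^ D := pow_le_pow_right₀ hH1 hD
  have hHD0 : 0 < H ^ D := by positivity
  have key : T ^ D * ((H ^ D / o + 1) * (1 + 2 * κ / H * o)) * κ ^ D =
      (κ ^ D * T ^ D) * (H ^ D / o) + (κ ^ D * T ^ D) + 2 * R * (H ^ D / H) + 2 * R * (o / H) := by
    rw [hRdef]
    field_simp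
    ring
  rw [key]
  have t1 : (κ ^ D * T ^ D) * (H ^ D / o) < H ^ D / 4 := by
    rw [mul_div_assoc', div_lt_iff₀ ho0]
    have : κ ^ D * T ^ D * 4 < o := by
      have : 8 * R * M < o * M := by nlinarith
      have := lt_of_mul_lt_mul_right this (by linarith)
      nlinarith
    nlinarith
  have t2 : κ ^ D * T ^ D < H ^ D / 4 := by nlinarith
  have t3 : 2 * R * (H ^ D / H) < H ^ D / 4 := by
    rw [mul_div_assoc', div_lt_iff₀ hH]
    have : 8 * R < H := by nlinarith
    nlinarith
  have t4 : 2 * R * (o / H) < H ^ D / 4 := by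
    rw [mul_div_assoc', div_lt_iff₀ hH]
    have : 8 * R * o ≤ 8 * M * R * v := by
      have : R * o ≤ R * v := by gcongr
      nlinarith [mul_nonneg (by linarith : 0 ≤ R) hv.le]
    rw [pow_succ] at h3
    nlinarith
  linarith

theorem norm_sum_apply_add_mul_le {q : ℕ} [NeZero q] {χ : DirichletCharacter ℂ q}
    (hχ : IsLocallyPrimitive χ) {w D E : ℕ} (hw : q ∣ w ^ (D + 2)) (hD : 1 ≤ D) (hDE : D ≤ E)
    {H T : ℕ} (hH : 0 < H) (hT : ∀ y, 0 < y → y ≤ H ^ E → y.divisors.card ≤ T)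
    {K κ v : ℝ} (hK : 1 ≤ K) (hκ : κ = (8 * K) ^ 2 ^ D / 8)
    (hv : v = (q / q.gcd (w ^ (D + 1)) : ℕ))
    (h1 : 8 * D.factorial * κ ^ (D + 1) * T ^ D < v)
    (h2 : 8 * D.factorial * κ ^ (D + 1) * T ^ D < H)
    (h3 : 8 * D.factorial * κ ^ (D + 1) * T ^ D * v < (H : ℝ) ^ (D + 1)) (n : ℕ) :
    ‖∑ h ∈ Finset.range H, χ ((n + w * h : ℕ) : ZMod q)‖ ≤ H * K⁻¹ := by
  have hq : 0 < q := NeZero.pos q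
  have hwz : (w : ZMod q) ^ (D + 2) = 0 := by
    rw [← Nat.cast_pow, ZMod.natCast_eq_zero_iff]; exact hw
  by_cases hn : IsUnit (n : ZMod q)
  swap
  · have h0 : ∀ h ∈ Finset.range H, χ ((n + w * h : ℕ) : ZMod q) = 0 := by
      intro h _
      apply χ.map_nonunit
      intro hu
      apply hn
      push_cast at hu
      have hnil : IsNilpotent ((w : ZMod q) * h) := ⟨D + 2, by rw [mul_pow, hwz, zero_mul]⟩
      simpa using hnil.neg.isUnit_add_left_of_commute hu (Commute.all _ _)
    rw [Finset.sum_eq_zero h0, norm_zero]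
    positivity
  obtain ⟨n', hn'⟩ := hn.exists_right_inv
  set z : ZMod q := w * n' with hz
  have hzD : z ^ (D + 2) = 0 := by rw [hz, mul_pow, hwz, zero_mul]
  have hκ1 : 1 ≤ κ := by
    rw [hκ, le_div_iff₀ (by norm_num)]
    calc (1 : ℝ) * 8 ≤ (8 * K) ^ 1 := by linarith
      _ ≤ (8 * K) ^ 2 ^ D := pow_le_pow_right₀ (by linarith) Nat.one_le_two_pow
  have hT1 : 1 ≤ T := by
    have := hT 1 one_pos (Nat.one_le_pow _ _ hH)
    simpa using this
  have hphase := isPhase_of_nilpotent χ hzD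
  set ζ := χ (1 + z ^ (D + 1) * ((-1) ^ D * (D.factorial : ℕ))) with hζ
  have hM1 : 1 ≤ D.factorial := Nat.factorial_pos D
  have hord : orderOf ζ = q / q.gcd (w ^ (D + 1) * D.factorial) := by
    have hu : n' ^ (D + 1) * (-1) ^ D * (((n : ZMod q)) ^ (D + 1) * (-1) ^ D) = 1 := by
      calc _ = ((n : ZMod q) * n') ^ (D + 1) * ((-1) * (-1)) ^ D := by
            rw [mul_pow, mul_pow (-1 : ZMod q)]; ring
        _ = 1 := by rw [hn']; simp
    have h5 := orderOf_apply_one_add hχ (W := w ^ (D + 1) * D.factorial) hu (by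
      push_cast
      calc _ = (w : ZMod q) ^ (D + 2) * (w ^ D * (D.factorial * (n' ^ (D + 1) * (-1) ^ D)) ^ 2) := by
            ring
        _ = 0 := by rw [hwz, zero_mul])
    rw [← h5, hζ, hz]
    congr 2
    push_cast
    ring
  set o := orderOf ζ with ho
  have hg := Nat.gcd_pos_of_pos_left (w ^ (D + 1)) hq
  have hg' := Nat.gcd_pos_of_pos_left (w ^ (D + 1) * D.factorial) hq
  have ho0 : 0 < o := by
    rw [hord]
    exact Nat.div_pos (Nat.gcd_le_left _ hq) hg'
  have hov : o ≤ q / q.gcd (w ^ (D + 1)) := by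
    rw [hord]
    exact Nat.div_le_div_left (Nat.le_of_dvd hg' (Nat.gcd_dvd_gcd_mul_right_right _ _ _)) hg
  have hvo : q / q.gcd (w ^ (D + 1)) ≤ o * D.factorial := by
    rw [hord]
    obtain ⟨A, hA⟩ := Nat.gcd_dvd_left q (w ^ (D + 1) * D.factorial)
    have hA' : q / q.gcd (w ^ (D + 1) * D.factorial) = A :=
      Nat.div_eq_of_eq_mul_right hg' hA
    rw [hA']
    apply Nat.div_le_of_le_mul
    conv_lhs => rw [hA]
    have : q.gcd (w ^ (D + 1) * D.factorial) ≤ q.gcd (w ^ (D + 1)) * D.factorial := by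
      refine (Nat.le_of_dvd (Nat.mul_pos hg (Nat.gcd_pos_of_pos_left _ hq))
        (Nat.gcd_mul_right_dvd_mul_gcd _ _ _)).trans ?_
      exact Nat.mul_le_mul_left _ (Nat.gcd_le_right _ hM1)
    calc _ ≤ (q.gcd (w ^ (D + 1)) * D.factorial) * A := Nat.mul_le_mul_right _ this
      _ = _ := by ring
  have hHr : (0 : ℝ) < H := by exact_mod_cast hH
  have hTr : (1 : ℝ) ≤ T := by exact_mod_cast hT1
  have hMr : (1 : ℝ) ≤ D.factorial := by exact_mod_cast hM1
  have hor : (0 : ℝ) < o := by exact_mod_cast ho0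
  have hnum := weyl_numerics (D := D) hκ1 hTr hHr hMr (v := v) (o := o)
    (by rw [hv]; exact_mod_cast hvo) hor (by rw [hv]; exact_mod_cast hov) h1 h2 h3 hD
  have hf1 : ∀ t : ℕ, ‖χ (1 + z * t)‖ = 1 := fun t => by
    apply norm_eq_one_of_isUnit
    have hnil : IsNilpotent (z * t) := ⟨D + 2, by rw [mul_pow, hzD, zero_mul]⟩
    exact hnil.isUnit_one_add
  have heq : ∀ h ∈ Finset.range H, χ ((n + w * h : ℕ) : ZMod q) = χ n * χ (1 + z * h) := by
    intro h _
    rw [← map_mul]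
    congr 1
    push_cast
    rw [hz]
    linear_combination (-(w : ZMod q) * h) * hn'
  rw [Finset.sum_congr rfl heq, ← Finset.mul_sum, norm_mul, norm_eq_one_of_isUnit χ hn, one_mul]
  by_contra! hcon
  have hκH : κ ≤ H := by
    have : κ ≤ κ ^ (D + 1) := le_self_pow₀ hκ1 (by omega)
    have h6 : (1 : ℝ) ≤ T ^ D := one_le_pow₀ hTr
    have h7 : κ ^ (D + 1) ≤ 8 * D.factorial * κ ^ (D + 1) * T ^ D := by
      have h8 : (1 : ℝ) ≤ 8 * D.factorial * T ^ D := by nlinarith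
      have h9 : 0 ≤ κ ^ (D + 1) := by positivity
      nlinarith
    linarith
  have hw := weyl_count hH hT D hDE K hK (hκ ▸ hκH) le_rfl hphase hf1 (by
    rw [div_eq_mul_inv]; exact hcon.le)
  rw [← hκ] at hw
  have hc := card_near_one_le ho0 (IsPrimitiveRoot.orderOf ζ) (ρ := 2 * κ / H) (by positivity) (H ^ D)
  push_cast at hc
  have : (T : ℝ) ^ D * (((H : ℝ) ^ D / o + 1) * (1 + 2 * κ / H * o)) < (H / κ) ^ D := hnum
  have h9 : (T : ℝ) ^ D * ((Finset.Icc 1 (H ^ D)).filter fun y : ℕ => ‖1 - ζ ^ y‖ ≤ 2 * κ / H).card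
      ≤ (T : ℝ) ^ D * (((H : ℝ) ^ D / o + 1) * (1 + 2 * κ / H * o)) := by
    gcongr
  linarith

end ShortSums

section SmallFourthPowerFreePart

theorem gcd_pow_facts {q a u v w j : ℕ} (hq : 0 < q) (hj : 3 ≤ j)
    (hau : a * u ^ 4 ∣ q) (hv : v = q / q.gcd ((a * u) ^ (j + 1))) (hw : w = a * u * v) :
    q ∣ w ^ (j + 1) ∧ (q / q.gcd (w ^ j)) * (a * u ^ 3) ≤ q ∧
      q / q.gcd ((a * u) ^ j) ≤ (q / q.gcd (w ^ j)) * v ^ j := by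
  have hg1 := Nat.gcd_pos_of_pos_left ((a * u) ^ (j + 1)) hq
  have hg2 := Nat.gcd_pos_of_pos_left (w ^ j) hq
  have hg3 := Nat.gcd_pos_of_pos_left ((a * u) ^ j) hq
  have hqv : q = q.gcd ((a * u) ^ (j + 1)) * v := by
    rw [hv, Nat.mul_div_cancel' (Nat.gcd_dvd_left _ _)]
  have hv0 : 0 < v := Nat.pos_of_ne_zero (by rintro rfl; omega)
  refine ⟨?_, ?_, ?_⟩
  · rw [hw, mul_pow]
    conv_lhs => rw [hqv]
    exact mul_dvd_mul (Nat.gcd_dvd_right _ _) (dvd_pow_self _ (by omega))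
  · have h1 : a * u ^ 3 ∣ q.gcd (w ^ j) := by
      apply Nat.dvd_gcd
      · exact (mul_dvd_mul_left a (pow_dvd_pow u (by norm_num))).trans hau
      · rw [hw, mul_pow, mul_pow]
        exact (mul_dvd_mul (dvd_pow_self a (by omega)) (pow_dvd_pow u hj)).mul_right _
    calc _ ≤ (q / q.gcd (w ^ j)) * q.gcd (w ^ j) :=
          Nat.mul_le_mul_left _ (Nat.le_of_dvd hg2 h1)
      _ ≤ q := Nat.div_mul_le_self _ _
  · obtain ⟨A, hA⟩ := Nat.gcd_dvd_left q (w ^ j)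
    rw [Nat.div_eq_of_eq_mul_right hg2 hA]
    apply Nat.div_le_of_le_mul
    have h1 : q.gcd (w ^ j) ≤ q.gcd ((a * u) ^ j) * v ^ j := by
      rw [hw, mul_pow]
      refine (Nat.le_of_dvd (Nat.mul_pos hg3 (Nat.gcd_pos_of_pos_left _ hq))
        (Nat.gcd_mul_right_dvd_mul_gcd _ _ _)).trans ?_
      exact Nat.mul_le_mul_left _ (Nat.gcd_le_right _ (pow_pos hv0 _))
    conv_lhs => rw [hA]
    calc _ ≤ (q.gcd ((a * u) ^ j) * v ^ j) * A := Nat.mul_le_mul_right _ h1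
      _ = _ := by ring

theorem exists_drop {V : ℕ → ℝ} {X ε : ℝ} (h3 : X ^ (ε / 10) ≤ V 3) (h7 : V 7 < X ^ (ε / 655360)) :
    ∃ D, 2 ≤ D ∧ D ≤ 5 ∧ ∃ c, 0 < c ∧ c ≤ 1 / 160 ∧ 1 / 65536 ≤ 10 * c ∧
      X ^ (16 * c * ε) ≤ V (D + 1) ∧ V (D + 2) < X ^ (c * ε) := by
  by_cases h4 : X ^ (ε / 160) ≤ V 4
  swap
  · refine ⟨2, by norm_num, by norm_num, 1 / 160, by norm_num, by norm_num, by norm_num, ?_, ?_⟩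
    · exact (congrArg (X ^ ·) (by ring)).trans_le h3
    · exact (not_le.1 h4).trans_eq (congrArg (X ^ ·) (by ring))
  by_cases h5 : X ^ (ε / 2560) ≤ V 5
  swap
  · refine ⟨3, by norm_num, by norm_num, 1 / 2560, by norm_num, by norm_num, by norm_num, ?_, ?_⟩
    · exact (congrArg (X ^ ·) (by ring)).trans_le h4
    · exact (not_le.1 h5).trans_eq (congrArg (X ^ ·) (by ring))
  by_cases h6 : X ^ (ε / 40960) ≤ V 6
  swap
  · refine ⟨4, by norm_num, by norm_num, 1 / 40960, by norm_num, by norm_num, by norm_num, ?_, ?_⟩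
    · exact (congrArg (X ^ ·) (by ring)).trans_le h5
    · exact (not_le.1 h6).trans_eq (congrArg (X ^ ·) (by ring))
  · refine ⟨5, by norm_num, by norm_num, 1 / 655360, by norm_num, by norm_num, by norm_num, ?_, ?_⟩
    · exact (congrArg (X ^ ·) (by ring)).trans_le h6
    · exact h7.trans_eq (congrArg (X ^ ·) (by ring))

theorem exists_weyl_constant : ∃ A : ℝ, ∀ {D : ℕ} {K κ T C : ℝ}, D ≤ 5 → 1 ≤ K →
    κ = (8 * K) ^ 2 ^ D / 8 → 1 ≤ T → T ≤ C * K →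
    8 * D.factorial * κ ^ (D + 1) * T ^ D ≤ A * C ^ 5 * K ^ 197 := by
  obtain ⟨M, hM⟩ : ∃ M : ℝ, M = 8 ^ 32 := ⟨_, rfl⟩
  refine ⟨8 * 120 * M ^ 6, fun {D K κ T C} hD5 hK1 hκ hT1r hTX => ?_⟩
  have h8K : 1 ≤ 8 * K := by linarith
  have hκ1 : 1 ≤ κ := by
    rw [hκ, le_div_iff₀ (by norm_num)]
    calc (1 : ℝ) * 8 ≤ (8 * K) ^ 1 := by linarith
      _ ≤ (8 * K) ^ 2 ^ D := pow_le_pow_right₀ h8K Nat.one_le_two_pow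
  have h1 : (D.factorial : ℝ) ≤ 120 := by
    have : D.factorial ≤ Nat.factorial 5 := Nat.factorial_le hD5
    have h5 : Nat.factorial 5 = 120 := rfl
    rw [h5] at this
    exact_mod_cast this
  have h2 : κ ≤ M * K ^ 32 := by
    have h25 : 2 ^ D ≤ 2 ^ 5 := Nat.pow_le_pow_right (by norm_num) hD5
    rw [hM, ← mul_pow, hκ]
    exact (div_le_self (by positivity) (by norm_num)).trans (pow_le_pow_right₀ h8K h25)
  have h3 : κ ^ (D + 1) ≤ (M * K ^ 32) ^ 6 :=
    (pow_le_pow_right₀ hκ1 (by omega : D + 1 ≤ 6)).trans (pow_le_pow_left₀ (by linarith) h2 6)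
  have h4 : T ^ D ≤ (C * K) ^ 5 :=
    (pow_le_pow_right₀ hT1r hD5).trans (by gcongr)
  calc 8 * D.factorial * κ ^ (D + 1) * T ^ D ≤ 8 * 120 * (M * K ^ 32) ^ 6 * (C * K) ^ 5 := by
        gcongr
    _ = _ := by ring

set_option maxHeartbeats 1000000 in
theorem norm_sum_le_of_small_part {ε : ℝ} (hε : 0 < ε) (hε1 : ε ≤ 1 / 2) :
    ∃ Q : ℝ, ∀ (q : ℕ) [NeZero q], Q ≤ q → ∀ χ : DirichletCharacter ℂ q, IsLocallyPrimitive χ →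
      ∀ a u : ℕ, a * u ^ 4 ∣ q → q ∣ a * u ^ 7 → (a : ℝ) ≤ (q : ℝ) ^ (ε / 100) →
      ∀ N : ℕ, (q : ℝ) ^ (1 / 3 + ε) ≤ N →
      ‖∑ n ∈ Finset.range N, χ (n : ZMod q)‖ ≤ 3 * (N * (q : ℝ) ^ (-(ε / 20000000))) := by
  set s := ε / 20000000 with hs
  have hs0 : 0 < s := by positivity
  obtain ⟨C, hC1, hC⟩ := exists_card_divisors_le (η := s / 5) (by positivity)
  obtain ⟨A, hA⟩ := exists_weyl_constant
  obtain ⟨Q₁, hQ₁1, hQ₁⟩ := exists_forall_mul_rpow_le (A * C ^ 5)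
    (a := 197 * s) (b := 198 * s) (by linarith)
  obtain ⟨Q₂, hQ₂1, hQ₂⟩ := exists_forall_mul_rpow_le 16 (a := 0) (b := s) hs0
  refine ⟨max Q₁ Q₂, fun q _ hqQ χ hχ a u hau hqau ha N hN => ?_⟩
  have hq : 0 < q := NeZero.pos q
  set X : ℝ := (q : ℝ) with hX
  have hXQ₁ : Q₁ ≤ X := (le_max_left _ _).trans hqQ
  have hX1 : 1 ≤ X := hQ₁1.trans hXQ₁
  have hX0 : 0 < X := by linarith
  have hR := hQ₁ X hXQ₁
  have h16 := hQ₂ X ((le_max_right _ _).trans hqQ)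
  rw [Real.rpow_zero, mul_one] at h16
  have hXmul : ∀ x y : ℝ, X ^ x * X ^ y = X ^ (x + y) := fun x y => (Real.rpow_add hX0 x y).symm
  have hXpow : ∀ (x : ℝ) (k : ℕ), (X ^ x) ^ k = X ^ (x * k) := fun x k => by
    rw [← Real.rpow_natCast, ← Real.rpow_mul hX0.le]
  have hXmono : ∀ {x y : ℝ}, x ≤ y → X ^ x ≤ X ^ y := fun h => Real.rpow_le_rpow_of_exponent_le hX1 h
  have hXpos : ∀ x : ℝ, 0 < X ^ x := fun x => Real.rpow_pos_of_pos hX0 x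
  have hX16 : 1 < X := by
    by_contra h
    have : X = 1 := le_antisymm (not_lt.1 h) hX1
    rw [this, Real.one_rpow] at h16
    norm_num at h16
  have hXlt : ∀ {x y : ℝ}, x < y → X ^ x < X ^ y := fun h => Real.rpow_lt_rpow_of_exponent_lt hX16 h
  have hauq : a * u ^ 4 ≤ q := Nat.le_of_dvd hq hau
  have ha0 : 0 < a := Nat.pos_of_ne_zero (by rintro rfl; simp at hau; omega)
  have hu0 : 0 < u := Nat.pos_of_ne_zero (by rintro rfl; simp at hau; omega)
  have ha1 : (1 : ℝ) ≤ a := by exact_mod_cast ha0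
  have hu1 : (1 : ℝ) ≤ u := by exact_mod_cast hu0
  have huX : (u : ℝ) ≤ X ^ (1 / 4 : ℝ) := by
    have h1 : (u : ℝ) ^ 4 ≤ X := by
      have : ((a * u ^ 4 : ℕ) : ℝ) ≤ X := Nat.cast_le.2 hauq
      push_cast at this
      have h4 : (0 : ℝ) ≤ (u : ℝ) ^ 4 := by positivity
      nlinarith
    calc (u : ℝ) = ((u : ℝ) ^ (4 : ℕ)) ^ (1 / 4 : ℝ) := by
          rw [← Real.rpow_natCast, ← Real.rpow_mul (by positivity)]; norm_num
      _ ≤ X ^ (1 / 4 : ℝ) := Real.rpow_le_rpow (by positivity) h1 (by norm_num)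
  set V : ℕ → ℝ := fun j => ((q / q.gcd ((a * u) ^ j) : ℕ) : ℝ) with hV
  have hV3 : X ^ (ε / 10) ≤ V 3 := by
    have h1 : V 3 * (a * u) ^ 3 ≥ X := by
      have : q ≤ q / q.gcd ((a * u) ^ 3) * (a * u) ^ 3 := by
        conv_lhs => rw [← Nat.div_mul_cancel (Nat.gcd_dvd_left q ((a * u) ^ 3))]
        exact Nat.mul_le_mul_left _ (Nat.gcd_le_right _ (by positivity))
      have : (q : ℝ) ≤ ((q / q.gcd ((a * u) ^ 3) * (a * u) ^ 3 : ℕ) : ℝ) := by exact_mod_cast this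
      push_cast at this
      exact this
    have h2 : ((a : ℝ) * u) ^ 3 ≤ X ^ (3 * ε / 100 + 3 / 4) := by
      calc ((a : ℝ) * u) ^ 3 ≤ (X ^ (ε / 100) * X ^ (1 / 4 : ℝ)) ^ 3 := by gcongr
        _ = X ^ (3 * ε / 100 + 3 / 4) := by rw [hXmul, hXpow]; congr 1; push_cast; ring
    have h3 : X ^ (ε / 10) * ((a : ℝ) * u) ^ 3 ≤ V 3 * (a * u) ^ 3 := by
      calc X ^ (ε / 10) * ((a : ℝ) * u) ^ 3 ≤ X ^ (ε / 10) * X ^ (3 * ε / 100 + 3 / 4) := by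
            gcongr
        _ ≤ X ^ (1 : ℝ) := by rw [hXmul]; apply hXmono; linarith
        _ ≤ _ := by rw [Real.rpow_one]; exact h1
    exact le_of_mul_le_mul_right h3 (by positivity)
  have hV7 : V 7 < X ^ (ε / 655360) := by
    have h1 : q.gcd ((a * u) ^ 7) = q := by
      apply Nat.gcd_eq_left
      rw [mul_pow]
      exact hqau.trans (mul_dvd_mul_right (dvd_pow_self a (by norm_num)) _)
    have h2 : V 7 = 1 := by
      simp only [hV, h1]
      rw [Nat.div_self hq, Nat.cast_one]
    rw [h2]
    exact Real.one_lt_rpow hX16 (by positivity)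
  obtain ⟨D, hD2, hD5, c, hc0, hc1, hc2, hVc, hVc'⟩ := exists_drop hV3 hV7
  obtain ⟨v', hv'⟩ : ∃ v' : ℕ, v' = q / q.gcd ((a * u) ^ (D + 1 + 1)) := ⟨_, rfl⟩
  obtain ⟨w, hw⟩ : ∃ w : ℕ, w = a * u * v' := ⟨_, rfl⟩
  obtain ⟨hqw, hvq, hVv⟩ := gcd_pow_facts hq (j := D + 1) (by omega) hau hv' hw
  set v : ℝ := ((q / q.gcd (w ^ (D + 1)) : ℕ) : ℝ) with hv
  have hv'X : (v' : ℝ) ≤ X ^ (c * ε) := by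
    rw [hv']; exact hVc'.le
  have hv'0 : 0 < v' := by
    rw [hv']; exact Nat.div_pos (Nat.gcd_le_left _ hq) (Nat.gcd_pos_of_pos_left _ hq)
  have hv'1 : (1 : ℝ) ≤ v' := by exact_mod_cast hv'0
  have hw0 : 0 < w := by rw [hw]; positivity
  have hw1 : (1 : ℝ) ≤ w := by exact_mod_cast hw0
  have hwr : (w : ℝ) = a * u * v' := by rw [hw]; push_cast; ring
  have hvX : X ^ (10 * c * ε) ≤ v := by
    have h1 : V (D + 1) ≤ v * (v' : ℝ) ^ (D + 1) := by
      simp only [hV, hv]; exact_mod_cast hVv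
    have h2 : (v' : ℝ) ^ (D + 1) ≤ X ^ (6 * c * ε) := by
      calc (v' : ℝ) ^ (D + 1) ≤ (v' : ℝ) ^ 6 := pow_le_pow_right₀ hv'1 (by omega)
        _ ≤ (X ^ (c * ε)) ^ 6 := by gcongr
        _ = _ := by rw [hXpow]; congr 1; push_cast; ring
    have h3 : X ^ (10 * c * ε) * X ^ (6 * c * ε) ≤ v * X ^ (6 * c * ε) := by
      calc _ = X ^ (16 * c * ε) := by rw [hXmul]; congr 1; ring
        _ ≤ v * (v' : ℝ) ^ (D + 1) := hVc.trans h1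
        _ ≤ _ := by gcongr
    exact le_of_mul_le_mul_right h3 (hXpos _)
  have hv0 : 0 < v := (hXpos _).trans_le hvX
  set K : ℝ := X ^ s with hK
  have hK1 : 1 ≤ K := Real.one_le_rpow hX1 hs0.le
  set κ : ℝ := (8 * K) ^ 2 ^ D / 8 with hκ
  set Y : ℝ := X ^ (1 / 3 + ε) / (w * K) with hY
  set H : ℕ := ⌊Y⌋₊ with hH
  have hwX : (w : ℝ) ≤ X ^ (ε / 100 + 1 / 4 + c * ε) := by
    rw [hwr, ← hXmul, ← hXmul]; gcongr
  have hYX : X ^ (ε / 2) ≤ Y := by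
    rw [hY, le_div_iff₀ (by positivity)]
    calc X ^ (ε / 2) * (w * K) ≤ X ^ (ε / 2) * (X ^ (ε / 100 + 1 / 4 + c * ε) * X ^ s) := by
          gcongr
      _ = X ^ (ε / 2 + (ε / 100 + 1 / 4 + c * ε + s)) := by rw [hXmul, hXmul]
      _ ≤ _ := hXmono (by rw [hs]; nlinarith)
  have hY2 : 2 ≤ Y := by
    have h1 : X ^ s ≤ X ^ (ε / 2) := hXmono (by rw [hs]; linarith)
    linarith
  have hHY : Y / 2 ≤ H := by
    have := Nat.lt_floor_add_one Y
    rw [← hH] at this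
    linarith
  have hHY' : (H : ℝ) ≤ Y := Nat.floor_le (by linarith)
  have hH0 : 0 < H := by
    have : (0 : ℝ) < H := by linarith
    exact_mod_cast this
  have hwK : 1 ≤ w * K := by nlinarith
  have hHX : (H : ℝ) ≤ X := by
    refine hHY'.trans ?_
    rw [hY]
    refine (div_le_self (hXpos _).le hwK).trans ?_
    calc _ ≤ X ^ (1 : ℝ) := hXmono (by linarith)
      _ = X := Real.rpow_one X
  set T : ℕ := ⌊C * X ^ s⌋₊ with hT
  have hTX : (T : ℝ) ≤ C * X ^ s := Nat.floor_le (by positivity)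
  have hTdiv : ∀ y, 0 < y → y ≤ H ^ 5 → y.divisors.card ≤ T := by
    intro y hy0 hy
    apply Nat.le_floor
    refine (hC y hy0.ne').trans ?_
    have h1 : (y : ℝ) ≤ X ^ 5 := by
      calc (y : ℝ) ≤ (H : ℝ) ^ 5 := by exact_mod_cast hy
        _ ≤ X ^ 5 := by gcongr
    have h2 : (y : ℝ) ^ (s / 5) ≤ X ^ s := by
      calc (y : ℝ) ^ (s / 5) ≤ (X ^ 5) ^ (s / 5) := Real.rpow_le_rpow (by positivity) h1 (by positivity)
        _ = X ^ s := by
          rw [← Real.rpow_natCast, ← Real.rpow_mul hX0.le]; congr 1; push_cast; ring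
    have hC0 : 0 ≤ C := by linarith
    gcongr
  have hκ1 : 1 ≤ κ := by
    rw [hκ, le_div_iff₀ (by norm_num)]
    calc (1 : ℝ) * 8 ≤ (8 * K) ^ 1 := by linarith
      _ ≤ (8 * K) ^ 2 ^ D := pow_le_pow_right₀ (by linarith) Nat.one_le_two_pow
  have hT1 : 1 ≤ T := by
    have := hTdiv 1 one_pos (Nat.one_le_pow _ _ hH0)
    simpa using this
  have hT1r : (1 : ℝ) ≤ T := by exact_mod_cast hT1
  have hRX : 8 * D.factorial * κ ^ (D + 1) * T ^ D ≤ X ^ (198 * s) := by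
    refine (hA hD5 hK1 hκ hT1r hTX).trans ?_
    rw [hK, hXpow]
    refine le_trans (le_of_eq ?_) hR
    congr 2
    push_cast; ring
  have key := norm_sum_le_of_shift (f := fun n => χ (n : ZMod q)) (fun n => χ.norm_le_one _) hH0 (w := w)
    (B := K⁻¹) (fun n => norm_sum_apply_add_mul_le hχ (w := w) (D := D) (E := 5) hqw (by omega) hD5 hH0
      hTdiv hK1 hκ hv
      (hRX.trans_lt ((hXlt (by rw [hs]; nlinarith)).trans_le hvX))
      (hRX.trans_lt (by
        have h1 : 2 * X ^ (198 * s) < 2 * H := by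
          calc 2 * X ^ (198 * s) < 16 * X ^ (198 * s) := by linarith [hXpos (198 * s)]
            _ ≤ X ^ s * X ^ (198 * s) := by gcongr
            _ ≤ X ^ (ε / 2) := by rw [hXmul]; apply hXmono; rw [hs]; linarith
            _ ≤ Y := hYX
            _ ≤ _ := by linarith
        linarith))
      (by
        have h1 : X * X ^ (3 * ε) = Y ^ 3 * ((w : ℝ) * K) ^ 3 := by
          rw [← mul_pow, hY, div_mul_cancel₀ _ (by positivity), hXpow]
          nth_rewrite 1 [← Real.rpow_one X]
          rw [hXmul]; congr 1; push_cast; ring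
        have h2 : v * (a * u ^ 3) ≤ X := by
          have := Nat.cast_le (α := ℝ).2 hvq
          push_cast at this
          rw [hv, hX]
          exact this
        have h3 : 8 * X ^ (198 * s) * v * ((w : ℝ) * K) ^ 3 < Y ^ 3 * ((w : ℝ) * K) ^ 3 := by
          rw [← h1]
          calc 8 * X ^ (198 * s) * v * ((w : ℝ) * K) ^ 3
              = 8 * X ^ (198 * s) * (v * (a * u ^ 3)) * (a ^ 2 * v' ^ 3 * K ^ 3) := by
                rw [hwr]; ring
            _ ≤ 8 * X ^ (198 * s) * X * ((X ^ (ε / 100)) ^ 2 * (X ^ (c * ε)) ^ 3 * K ^ 3) := by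
                gcongr
            _ < 16 * X ^ (198 * s) * X * ((X ^ (ε / 100)) ^ 2 * (X ^ (c * ε)) ^ 3 * K ^ 3) := by
                have : 0 < X ^ (198 * s) * X * ((X ^ (ε / 100)) ^ 2 * (X ^ (c * ε)) ^ 3 * K ^ 3) := by
                  have := hXpos (198 * s)
                  have := hXpos (ε / 100)
                  have := hXpos (c * ε)
                  positivity
                linarith
            _ ≤ X ^ s * X ^ (198 * s) * X * ((X ^ (ε / 100)) ^ 2 * (X ^ (c * ε)) ^ 3 * K ^ 3) := by
                gcongr
            _ = X * X ^ (s + 198 * s + (ε / 100 * 2 + c * ε * 3 + s * 3)) := by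
                rw [hK, hXpow, hXpow, hXpow, ← hXmul, ← hXmul, ← hXmul, ← hXmul]
                push_cast; ring
            _ ≤ _ := by
                refine mul_le_mul_of_nonneg_left (hXmono ?_) hX0.le
                rw [hs]; nlinarith
        have h4 := lt_of_mul_lt_mul_right h3 (by positivity)
        have hH1 : (1 : ℝ) ≤ H := by exact_mod_cast hH0
        have h5 : Y ^ 3 / 8 ≤ (H : ℝ) ^ (D + 1) := by
          calc Y ^ 3 / 8 = (Y / 2) ^ 3 := by ring
            _ ≤ (H : ℝ) ^ 3 := by gcongr
            _ ≤ _ := pow_le_pow_right₀ hH1 (by omega)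
        calc 8 * D.factorial * κ ^ (D + 1) * T ^ D * v ≤ X ^ (198 * s) * v := by gcongr
          _ < Y ^ 3 / 8 := by linarith
          _ ≤ _ := h5) n) N
  refine key.trans ?_
  have h1 : (w : ℝ) * H ≤ N * K⁻¹ := by
    calc (w : ℝ) * H ≤ w * Y := by gcongr
      _ = X ^ (1 / 3 + ε) * K⁻¹ := by rw [hY]; field_simp
      _ ≤ _ := by gcongr
  rw [Real.rpow_neg hX0.le, ← hK]
  linarith

end SmallFourthPowerFreePart

section ChineseRemainder

theorem chineseRemainder_fst {a b : ℕ} (hab : a.Coprime b) (x : ZMod (a * b)) :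
    (ZMod.chineseRemainder hab x).1 = ZMod.castHom (dvd_mul_right a b) (ZMod a) x :=
  RingHom.congr_fun (RingHom.ext_zmod
    ((RingHom.fst (ZMod a) (ZMod b)).comp (ZMod.chineseRemainder hab).toRingHom) _) x

theorem chineseRemainder_snd {a b : ℕ} (hab : a.Coprime b) (x : ZMod (a * b)) :
    (ZMod.chineseRemainder hab x).2 = ZMod.castHom (dvd_mul_left b a) (ZMod b) x :=
  RingHom.congr_fun (RingHom.ext_zmod
    ((RingHom.snd (ZMod a) (ZMod b)).comp (ZMod.chineseRemainder hab).toRingHom) _) x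

theorem exists_mul_decomposition {a b : ℕ} [NeZero a] [NeZero b] (hab : a.Coprime b)
    (χ : DirichletCharacter ℂ (a * b)) :
    ∃ (χ₁ : DirichletCharacter ℂ a) (χ₂ : DirichletCharacter ℂ b),
      (∀ x : ZMod (a * b), χ x = χ₁ (ZMod.castHom (dvd_mul_right a b) (ZMod a) x) *
        χ₂ (ZMod.castHom (dvd_mul_left b a) (ZMod b) x)) ∧
      (IsLocallyPrimitive χ → IsLocallyPrimitive χ₁ ∧ IsLocallyPrimitive χ₂) := by
  set e := ZMod.chineseRemainder hab with he
  have he1 := chineseRemainder_fst hab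
  have he2 := chineseRemainder_snd hab
  rw [← he] at he1 he2
  let χ₁ : DirichletCharacter ℂ a :=
    { toMonoidHom := (χ.toMonoidHom.comp (e.symm.toMulEquiv.toMonoidHom)).comp
        (MonoidHom.inl (ZMod a) (ZMod b))
      map_nonunit' := fun x hx => χ.map_nonunit fun hu => hx (by
        have := hu.map e
        have h2 : IsUnit ((x, 1) : ZMod a × ZMod b) := by simpa using this
        exact (Prod.isUnit_iff.1 h2).1) }
  let χ₂ : DirichletCharacter ℂ b :=
    { toMonoidHom := (χ.toMonoidHom.comp (e.symm.toMulEquiv.toMonoidHom)).comp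
        (MonoidHom.inr (ZMod a) (ZMod b))
      map_nonunit' := fun x hx => χ.map_nonunit fun hu => hx (by
        have := hu.map e
        have h2 : IsUnit ((1, x) : ZMod a × ZMod b) := by simpa using this
        exact (Prod.isUnit_iff.1 h2).2) }
  have h₁ : ∀ x, χ₁ x = χ (e.symm (x, 1)) := fun _ => rfl
  have h₂ : ∀ x, χ₂ x = χ (e.symm (1, x)) := fun _ => rfl
  refine ⟨χ₁, χ₂, fun x => ?_, fun hχ => ⟨fun p hp hpa => ?_, fun p hp hpb => ?_⟩⟩
  · rw [← he1, ← he2, h₁, h₂, ← map_mul, ← map_mul, Prod.mk_mul_mk, mul_one, one_mul, Prod.mk.eta,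
      e.symm_apply_apply]
  · obtain ⟨y, hy, hy1⟩ := hχ p hp (hpa.mul_right b)
    have hdiv : a * b / p = (a / p) * b := (Nat.div_mul_right_comm hpa b).symm
    have key : e (1 + ((a * b / p : ℕ) : ZMod (a * b)) * y) =
        (1 + ((a / p : ℕ) : ZMod a) * ((b : ZMod a) * (e y).1), 1) := by
      rw [hdiv]
      refine Prod.ext ?_ ?_
      · simp [mul_assoc]
      · simp
    refine ⟨(b : ZMod a) * (e y).1, ?_, ?_⟩
    · have := hy.map e
      have h2 : IsUnit (e (1 + ((a * b / p : ℕ) : ZMod (a * b)) * y)) := this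
      rw [key] at h2
      exact (Prod.isUnit_iff.1 h2).1
    · rw [h₁, ← key, e.symm_apply_apply]
      exact hy1
  · obtain ⟨y, hy, hy1⟩ := hχ p hp (hpb.mul_left a)
    have hdiv : a * b / p = a * (b / p) := Nat.mul_div_assoc a hpb
    have key : e (1 + ((a * b / p : ℕ) : ZMod (a * b)) * y) =
        (1, 1 + ((b / p : ℕ) : ZMod b) * ((a : ZMod b) * (e y).2)) := by
      rw [hdiv]
      refine Prod.ext ?_ ?_
      · simp
      · simp; ring
    refine ⟨(a : ZMod b) * (e y).2, ?_, ?_⟩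
    · have := hy.map e
      have h2 : IsUnit (e (1 + ((a * b / p : ℕ) : ZMod (a * b)) * y)) := this
      rw [key] at h2
      exact (Prod.isUnit_iff.1 h2).2
    · rw [h₂, ← key, e.symm_apply_apply]
      exact hy1

theorem inv_decomposition {a b : ℕ} {χ : DirichletCharacter ℂ (a * b)}
    {χ₁ : DirichletCharacter ℂ a} {χ₂ : DirichletCharacter ℂ b}
    (h : ∀ x : ZMod (a * b), χ x = χ₁ (ZMod.castHom (dvd_mul_right a b) (ZMod a) x) *
        χ₂ (ZMod.castHom (dvd_mul_left b a) (ZMod b) x)) (x : ZMod (a * b)) :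
    χ⁻¹ x = χ₁⁻¹ (ZMod.castHom (dvd_mul_right a b) (ZMod a) x) *
        χ₂⁻¹ (ZMod.castHom (dvd_mul_left b a) (ZMod b) x) := by
  rw [MulChar.inv_apply_eq_inv', MulChar.inv_apply_eq_inv', MulChar.inv_apply_eq_inv', h, mul_inv]

/-- `χ` or its inverse, according to the sign. -/
noncomputable def signed {n : ℕ} (χ : DirichletCharacter ℂ n) (s : Bool) : DirichletCharacter ℂ n :=
  if s then χ else χ⁻¹

/-- The complete sum of a product of shifts of `χ` and `χ⁻¹`. -/
noncomputable def shiftSum {n : ℕ} [NeZero n] (χ : DirichletCharacter ℂ n) {τ : Type*} [Fintype τ]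
    (s : τ → Bool) (c : τ → ℤ) : ℂ :=
  ∑ x : ZMod n, ∏ i, signed χ (s i) (x + (c i : ZMod n))

theorem shiftSum_mul {a b : ℕ} [NeZero a] [NeZero b] [NeZero (a * b)] (hab : a.Coprime b)
    {χ : DirichletCharacter ℂ (a * b)}
    {χ₁ : DirichletCharacter ℂ a} {χ₂ : DirichletCharacter ℂ b}
    (h : ∀ x : ZMod (a * b), χ x = χ₁ (ZMod.castHom (dvd_mul_right a b) (ZMod a) x) *
        χ₂ (ZMod.castHom (dvd_mul_left b a) (ZMod b) x)) {τ : Type*} [Fintype τ]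
    (s : τ → Bool) (c : τ → ℤ) :
    shiftSum χ s c = shiftSum χ₁ s c * shiftSum χ₂ s c := by
  have hs : ∀ (t : Bool) (x : ZMod (a * b)), signed χ t x =
      signed χ₁ t (ZMod.castHom (dvd_mul_right a b) (ZMod a) x) *
        signed χ₂ t (ZMod.castHom (dvd_mul_left b a) (ZMod b) x) := by
    intro t x
    cases t
    · simpa [signed] using inv_decomposition h x
    · simpa [signed] using h x
  set e := ZMod.chineseRemainder hab with he
  have he1 := chineseRemainder_fst hab
  have he2 := chineseRemainder_snd hab
  rw [← he] at he1 he2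
  unfold shiftSum
  rw [Finset.sum_mul_sum, ← Finset.sum_product', Finset.univ_product_univ,
    ← e.toEquiv.sum_comp]
  refine Finset.sum_congr rfl fun x _ => ?_
  rw [← Finset.prod_mul_distrib]
  refine Finset.prod_congr rfl fun i _ => ?_
  rw [hs, ← he1, ← he2, map_add e, map_intCast e]
  rfl

theorem exists_fourth_power_free_decomposition (q : ℕ) (hq : 0 < q) :
    ∃ a b u : ℕ, q = a * b ∧ a.Coprime b ∧ a.Coprime u ∧ u ^ 4 ∣ b ∧ b ∣ u ^ 7 ∧
      ∀ p : ℕ, p.Prime → ¬ p ^ 4 ∣ a := by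
  induction q using Nat.recOnPosPrimePosCoprime with
  | prime_pow p k hp hk =>
    by_cases h4 : k < 4
    · refine ⟨p ^ k, 1, 1, by simp, by simp, by simp, by simp, by simp, fun l hl h => ?_⟩
      have h1 : l ∣ p := hl.dvd_of_dvd_pow ((dvd_pow_self l (by norm_num)).trans h)
      obtain rfl := (Nat.prime_dvd_prime_iff_eq hl hp).1 h1
      have := (Nat.pow_dvd_pow_iff_le_right hl.one_lt).1 h
      omega
    · refine ⟨1, p ^ k, p ^ (k / 4), by simp, by simp, by simp, ?_, ?_, fun l hl h => ?_⟩
      · rw [← pow_mul]; exact pow_dvd_pow p (by omega)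
      · rw [← pow_mul]; exact pow_dvd_pow p (by omega)
      · have := Nat.dvd_one.1 ((dvd_pow_self l (by norm_num)).trans h)
        exact hl.one_lt.ne' this
  | zero => omega
  | one => exact ⟨1, 1, 1, by simp, by simp, by simp, by simp, by simp, fun l hl h =>
      hl.one_lt.ne' (Nat.dvd_one.1 ((dvd_pow_self l (by norm_num)).trans h))⟩
  | coprime m n hm hn hmn ihm ihn =>
    obtain ⟨a, b, u, hab, h1, h2, h3, h4, h5⟩ := ihm (by omega)
    obtain ⟨a', b', u', hab', h1', h2', h3', h4', h5'⟩ := ihn (by omega)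
    have hmn' := hmn
    rw [hab, hab'] at hmn'
    have haa' : a.Coprime a' := hmn'.coprime_mul_right.coprime_mul_right_right
    have hab'' : a.Coprime b' := hmn'.coprime_mul_right.coprime_mul_left_right
    have hba'' : b.Coprime a' := hmn'.coprime_mul_left.coprime_mul_right_right
    have hub : u ∣ b := (dvd_pow_self u (by norm_num)).trans h3
    have hub' : u' ∣ b' := (dvd_pow_self u' (by norm_num)).trans h3'
    refine ⟨a * a', b * b', u * u', by rw [hab, hab']; ring, ?_, ?_, ?_, ?_, fun p hp h => ?_⟩
    · exact Nat.Coprime.mul_left (Nat.Coprime.mul_right h1 hab'')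
        (Nat.Coprime.mul_right hba''.symm h1')
    · exact Nat.Coprime.mul_left (Nat.Coprime.mul_right h2 (hab''.coprime_dvd_right hub'))
        (Nat.Coprime.mul_right (hba''.symm.coprime_dvd_right hub) h2')
    · rw [mul_pow]; exact mul_dvd_mul h3 h3'
    · rw [mul_pow]; exact mul_dvd_mul h4 h4'
    · by_cases hpa : p ∣ a
      · have : (p ^ 4).Coprime a' := (haa'.coprime_dvd_left hpa).pow_left 4
        exact h5 p hp (this.dvd_of_dvd_mul_right h)
      · have : (p ^ 4).Coprime a := ((Nat.Prime.coprime_iff_not_dvd hp).2 hpa).pow_left 4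
        exact h5' p hp (this.dvd_of_dvd_mul_left h)

end ChineseRemainder

section LocalBounds

variable {τ : Type*} [Fintype τ]

theorem signed_inv {n : ℕ} (χ : DirichletCharacter ℂ n) (s : Bool) :
    (signed χ s)⁻¹ = signed χ (!s) := by
  cases s <;> simp [signed]

theorem norm_shiftSum_le_card {n : ℕ} [NeZero n] (χ : DirichletCharacter ℂ n) (s : τ → Bool)
    (c : τ → ℤ) : ‖shiftSum χ s c‖ ≤ n := by
  refine (norm_sum_le _ _).trans ((Finset.sum_le_card_nsmul _ _ 1 fun x _ => ?_).trans ?_)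
  · rw [norm_prod]
    exact Finset.prod_le_one (fun _ _ => norm_nonneg _) fun i _ => DirichletCharacter.norm_le_one _ _
  · simp [ZMod.card]

theorem norm_shiftSum_le_of_prime [DecidableEq τ] {p : ℕ} [Fact p.Prime] {χ : DirichletCharacter ℂ p}
    (hχ : χ ≠ 1) {s : τ → Bool} (c : τ → ℤ) {i₀ : τ}
    (hs : (Finset.univ.filter fun i => s i = s i₀).card =
      (Finset.univ.filter fun i => s i ≠ s i₀).card)
    (hc : ∀ i ≠ i₀, ((c i - c i₀ : ℤ) : ZMod p) ≠ 0) :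
    ‖shiftSum χ s c‖ ≤ 2 * Fintype.card τ * √p := by
  have hχ' : signed χ (s i₀) ≠ 1 := by
    cases s i₀
    · simpa [signed] using hχ
    · simpa [signed] using hχ
  have hc' : ∀ i ≠ i₀, (c i : ZMod p) ≠ c i₀ := fun i hi h => hc i hi (by push_cast; rw [h, sub_self])
  have hcard : Fintype.card {i // s i ≠ s i₀} = Fintype.card {i // i ≠ i₀ ∧ s i = s i₀} + 1 := by
    rw [Fintype.card_subtype, Fintype.card_subtype, ← hs]
    have : (Finset.univ.filter fun i => i ≠ i₀ ∧ s i = s i₀) =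
        (Finset.univ.filter fun i => s i = s i₀).erase i₀ := by
      ext i; simp
    rw [this, Finset.card_erase_add_one (by simp)]
  have hw := weil_bound hcard (signed χ (s i₀)) hχ' (c i₀ : ZMod p) (fun i => (c i.1 : ZMod p))
    (fun i => (c i.1 : ZMod p)) (fun i => hc' i.1 i.2.1)
    (fun i => hc' i.1 fun h => i.2 (by rw [h]))
  have heq : shiftSum χ s c = ∑ x : ZMod p, signed χ (s i₀) (x + (c i₀ : ZMod p)) *
      (∏ i : {i // i ≠ i₀ ∧ s i = s i₀}, signed χ (s i₀) (x + (c i.1 : ZMod p))) *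
      ∏ i : {i // s i ≠ s i₀}, (signed χ (s i₀))⁻¹ (x + (c i.1 : ZMod p)) := by
    unfold shiftSum
    refine Finset.sum_congr rfl fun x _ => ?_
    rw [← Finset.prod_filter_mul_prod_filter_not Finset.univ (fun i => s i = s i₀)]
    congr 1
    · rw [← Finset.mul_prod_erase _ _ (show i₀ ∈ Finset.univ.filter fun i => s i = s i₀ by simp)]
      congr 1
      rw [Finset.prod_subtype _ (p := fun i => i ≠ i₀ ∧ s i = s i₀) (by intro i; simp)]
      exact Finset.prod_congr rfl fun i _ => by rw [i.2.2]
    · rw [Finset.prod_subtype _ (p := fun i => s i ≠ s i₀) (by intro i; simp)]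
      refine Finset.prod_congr rfl fun i _ => ?_
      rw [signed_inv]
      have : s i.1 = !(s i₀) := by
        have := i.2
        revert this
        cases s i.1 <;> cases s i₀ <;> simp
      rw [this]
  rw [heq]
  refine hw.trans ?_
  gcongr
  exact Fintype.card_subtype_le _

theorem signed_apply_one_add {n : ℕ} {χ : DirichletCharacter ℂ n} {m : ZMod n} (hm : m * m = 0)
    (t : Bool) (y : ZMod n) :
    signed χ t (1 + m * y) = χ (1 + m * (if t then y else -y)) := by
  cases t
  · simp only [signed, Bool.false_eq_true, if_false]
    rw [MulChar.inv_apply_eq_inv']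
    apply inv_eq_of_mul_eq_one_right
    rw [← map_mul, show (1 + m * y) * (1 + m * -y) = 1 - (m * m) * (y * y) by ring, hm]
    simp
  · simp [signed]

theorem prod_apply_one_add {n : ℕ} {χ : DirichletCharacter ℂ n} {m : ZMod n} (hm : m * m = 0)
    (S : Finset τ) (y : τ → ZMod n) : ∏ i ∈ S, χ (1 + m * y i) = χ (1 + m * ∑ i ∈ S, y i) := by
  classical
  induction S using Finset.induction_on with
  | empty => simp
  | insert i S hi ih =>
    rw [Finset.prod_insert hi, Finset.sum_insert hi, ih, ← map_mul]
    congr 1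
    linear_combination (y i * ∑ i ∈ S, y i) * hm

theorem sum_apply_one_add_eq_zero {n : ℕ} [NeZero n] {χ : DirichletCharacter ℂ n} {m : ZMod n}
    (hm : m * m = 0) (hχ : ∃ y, χ (1 + m * y) ≠ 1) {E : ZMod n} (hE : IsUnit E) :
    ∑ z : ZMod n, χ (1 + m * (z * E)) = 0 := by
  obtain ⟨y, hy⟩ := hχ
  obtain ⟨E', hE'⟩ := hE.exists_left_inv
  have h1 : ∑ z : ZMod n, χ (1 + m * (z * E)) =
      χ (1 + m * y) * ∑ z : ZMod n, χ (1 + m * (z * E)) := by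
    rw [Finset.mul_sum, ← Equiv.sum_comp (Equiv.addRight (y * E'))]
    refine Finset.sum_congr rfl fun z _ => ?_
    rw [← map_mul]
    congr 1
    simp only [Equiv.coe_addRight]
    linear_combination (m * y) * hE' - (y * z * E) * hm
  have h2 : (χ (1 + m * y) - 1) * ∑ z : ZMod n, χ (1 + m * (z * E)) = 0 := by
    rw [sub_mul, one_mul, ← h1, sub_self]
  exact (mul_eq_zero.1 h2).resolve_left (sub_ne_zero.2 hy)

/-- The number of points at which a logarithmic derivative of a product of linear factors vanishes. -/
theorem card_log_deriv_zero_le [DecidableEq τ] {F : Type*} [Field F] [Fintype F] [DecidableEq F]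
    (ε c : τ → F)
    {i₀ : τ} (hε : ε i₀ ≠ 0) (hc : ∀ i ≠ i₀, c i ≠ c i₀) :
    (Finset.univ.filter fun x : F => (∀ i, x + c i ≠ 0) ∧ ∑ i, ε i * (x + c i)⁻¹ = 0).card ≤
      Fintype.card τ := by
  open Polynomial in
  set P : F[X] := ∑ i, C (ε i) * ∏ j ∈ Finset.univ.erase i, (X + C (c j)) with hP
  have hdeg : P.natDegree ≤ Fintype.card τ := by
    refine natDegree_sum_le_of_forall_le _ _ fun i _ => ?_
    refine (natDegree_C_mul_le _ _).trans ((natDegree_prod_le _ _).trans ?_)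
    refine (Finset.sum_le_card_nsmul _ _ 1 fun j _ => (natDegree_X_add_C _).le).trans ?_
    rw [smul_eq_mul, mul_one]
    exact Finset.card_le_univ _
  have heval : ∀ x, P.eval x = ∑ i, ε i * ∏ j ∈ Finset.univ.erase i, (x + c j) := by
    intro x
    rw [hP, eval_finsetSum]
    refine Finset.sum_congr rfl fun i _ => ?_
    rw [eval_C_mul, eval_prod]
    simp
  have hP0 : P ≠ 0 := by
    intro h0
    have h1 := heval (-c i₀)
    rw [h0, eval_zero, Finset.sum_eq_single i₀] at h1
    · refine (mul_ne_zero hε (Finset.prod_ne_zero_iff.2 fun j hj => ?_)) h1.symm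
      rw [neg_add_eq_sub]
      exact sub_ne_zero.2 (hc j (Finset.ne_of_mem_erase hj))
    · intro i _ hi
      rw [Finset.prod_eq_zero (Finset.mem_erase.2 ⟨hi.symm, Finset.mem_univ i₀⟩) (by ring), mul_zero]
    · simp
  have hsub : (Finset.univ.filter fun x : F => (∀ i, x + c i ≠ 0) ∧ ∑ i, ε i * (x + c i)⁻¹ = 0) ⊆
      P.roots.toFinset := by
    intro x hx
    obtain ⟨-, hx1, hx2⟩ := Finset.mem_filter.1 hx
    rw [Multiset.mem_toFinset, mem_roots hP0, IsRoot.def, heval]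
    have : ∑ i, ε i * ∏ j ∈ Finset.univ.erase i, (x + c j) =
        (∏ j, (x + c j)) * ∑ i, ε i * (x + c i)⁻¹ := by
      rw [Finset.mul_sum]
      refine Finset.sum_congr rfl fun i _ => ?_
      rw [← Finset.mul_prod_erase Finset.univ (fun j => x + c j) (Finset.mem_univ i)]
      have := hx1 i
      field_simp
    rw [this, hx2, mul_zero]
  calc _ ≤ P.roots.toFinset.card := Finset.card_le_card hsub
    _ ≤ P.roots.card := Multiset.toFinset_card_le _
    _ ≤ P.natDegree := card_roots' P
    _ ≤ _ := hdeg

theorem card_fiber_castHom {p n : ℕ} [NeZero n] [NeZero p] (hpn : p ∣ n) (y : ZMod p) :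
    (Finset.univ.filter fun x : ZMod n => ZMod.castHom hpn (ZMod p) x = y).card = n / p := by
  have hsurj := ZMod.castHom_surjective hpn
  have h1 : ∀ z : ZMod p, (Finset.univ.filter fun x : ZMod n => ZMod.castHom hpn (ZMod p) x = z).card =
      (Finset.univ.filter fun x : ZMod n => ZMod.castHom hpn (ZMod p) x = y).card := fun z =>
    AddMonoidHom.card_fiber_eq_of_mem_range (ZMod.castHom hpn (ZMod p)) (hsurj z) (hsurj y)
  have h2 := Finset.card_eq_sum_card_fiberwise (f := ZMod.castHom hpn (ZMod p))
    (s := (Finset.univ : Finset (ZMod n))) (t := Finset.univ) (fun _ _ => Finset.mem_coe.2 (Finset.mem_univ _))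
  rw [Finset.sum_congr rfl fun z _ => h1 z, Finset.sum_const, Finset.card_univ, Finset.card_univ,
    ZMod.card, ZMod.card, smul_eq_mul] at h2
  exact (Nat.div_eq_of_eq_mul_right (NeZero.pos p) h2).symm

theorem norm_shiftSum_le_of_sq_dvd [DecidableEq τ] {p n k : ℕ} [NeZero n] (hp : p.Prime)
    (hn : n = p ^ k) (hk : 2 ≤ k)
    {χ : DirichletCharacter ℂ n} (hχ : IsLocallyPrimitive χ) {s : τ → Bool} (c : τ → ℤ) {i₀ : τ}
    (hc : ∀ i ≠ i₀, ((c i - c i₀ : ℤ) : ZMod p) ≠ 0) :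
    ‖shiftSum χ s c‖ ≤ Fintype.card τ * (n / p : ℕ) := by
  have : Fact p.Prime := ⟨hp⟩
  have hpn : p ∣ n := hn ▸ dvd_pow_self p (by omega)
  have hn0 : 0 < n := NeZero.pos n
  have hnp : n / p = p ^ (k - 1) := by
    rw [hn, ← Nat.sub_add_cancel (show 1 ≤ k by omega), pow_succ, Nat.mul_div_cancel _ hp.pos]
    simp
  set m : ZMod n := ((n / p : ℕ) : ZMod n) with hm
  have hmm : m * m = 0 := by
    rw [hm, ← Nat.cast_mul, ZMod.natCast_eq_zero_iff, hnp, ← pow_add]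
    nth_rewrite 1 [hn]
    exact pow_dvd_pow p (by omega)
  obtain ⟨y, -, hy⟩ := hχ p hp hpn
  set F : ZMod n → ℂ := fun x => ∏ i, signed χ (s i) (x + (c i : ZMod n)) with hF
  have hunit : ∀ x : ZMod n, IsUnit x ↔ ZMod.castHom hpn (ZMod p) x ≠ 0 := by
    intro x
    rw [← ZMod.natCast_zmod_val x, map_natCast, ZMod.isUnit_iff_coprime, Ne, ZMod.natCast_eq_zero_iff]
    nth_rewrite 2 [hn]
    rw [Nat.coprime_pow_right_iff (by omega), Nat.coprime_comm, hp.coprime_iff_not_dvd]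
  set E : ZMod n → ZMod n := fun x => ∑ i, (if s i then (x + c i)⁻¹ else -(x + c i)⁻¹) with hE
  set bad := Finset.univ.filter fun x : ZMod n => (∀ i, IsUnit (x + (c i : ZMod n))) ∧ ¬ IsUnit (E x)
    with hbad
  have hFs : ∀ x z, (∀ i, IsUnit (x + (c i : ZMod n))) → F (x + m * z) = F x * χ (1 + m * (z * E x)) := by
    intro x z hx
    simp only [hF]
    have h1 : ∀ i, signed χ (s i) (x + m * z + (c i : ZMod n)) = signed χ (s i) (x + (c i : ZMod n)) *
        χ (1 + m * (z * (if s i then (x + c i)⁻¹ else -(x + c i)⁻¹))) := by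
      intro i
      have h2 := ZMod.mul_inv_of_unit _ (hx i)
      have h3 : x + m * z + (c i : ZMod n) =
          (x + (c i : ZMod n)) * (1 + m * (z * (x + (c i : ZMod n))⁻¹)) := by
        linear_combination (-(m * z)) * h2
      rw [h3, map_mul, signed_apply_one_add hmm]
      congr 3
      split_ifs <;> ring
    rw [Finset.prod_congr rfl fun i _ => h1 i, Finset.prod_mul_distrib, prod_apply_one_add hmm,
      ← Finset.mul_sum]
  have hinner : ∀ x, ‖∑ z : ZMod n, F (x + m * z)‖ ≤ if x ∈ bad then (n : ℝ) else 0 := by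
    intro x
    by_cases hx : ∀ i, IsUnit (x + (c i : ZMod n))
    · by_cases hEx : IsUnit (E x)
      · rw [Finset.sum_congr rfl fun z _ => hFs x z hx, ← Finset.mul_sum,
          sum_apply_one_add_eq_zero hmm ⟨y, hy⟩ hEx, mul_zero, norm_zero]
        split_ifs <;> positivity
      · rw [if_pos (Finset.mem_filter.2 ⟨Finset.mem_univ _, hx, hEx⟩)]
        refine (norm_sum_le _ _).trans ((Finset.sum_le_card_nsmul _ _ 1 fun z _ => ?_).trans ?_)
        · rw [norm_prod]
          exact Finset.prod_le_one (fun _ _ => norm_nonneg _)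
            fun i _ => DirichletCharacter.norm_le_one _ _
        · simp [ZMod.card]
    · have h0 : ∀ z ∈ Finset.univ, F (x + m * z) = 0 := by
        intro z _
        push Not at hx
        obtain ⟨i, hi⟩ := hx
        refine Finset.prod_eq_zero (Finset.mem_univ i) (MulChar.map_nonunit _ ?_)
        have hm0 : ZMod.castHom hpn (ZMod p) m = 0 := by
          rw [hm, map_natCast, ZMod.natCast_eq_zero_iff, hnp]
          exact dvd_pow_self p (by omega)
        rw [hunit] at hi ⊢
        rwa [map_add, map_add, map_mul, hm0, zero_mul, add_zero, ← map_add]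
      rw [Finset.sum_eq_zero h0, norm_zero]
      split_ifs <;> positivity
  have hsum : (n : ℂ) * shiftSum χ s c = ∑ x, ∑ z : ZMod n, F (x + m * z) := by
    rw [Finset.sum_comm]
    have : ∀ z ∈ (Finset.univ : Finset (ZMod n)), ∑ x, F (x + m * z) = shiftSum χ s c := fun z _ =>
      Equiv.sum_comp (Equiv.addRight (m * z)) F
    rw [Finset.sum_congr rfl this, Finset.sum_const, Finset.card_univ, ZMod.card, nsmul_eq_mul]
  have hbound : (n : ℝ) * ‖shiftSum χ s c‖ ≤ n * bad.card := by
    calc (n : ℝ) * ‖shiftSum χ s c‖ = ‖(n : ℂ) * shiftSum χ s c‖ := by simp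
      _ ≤ ∑ x, (if x ∈ bad then (n : ℝ) else 0) := by
          rw [hsum]; exact (norm_sum_le _ _).trans (Finset.sum_le_sum fun x _ => hinner x)
      _ = n * bad.card := by rw [Finset.sum_ite_mem, Finset.univ_inter, Finset.sum_const]; simp [mul_comm]
  have hcard : bad.card ≤ Fintype.card τ * (n / p) := by
    set R := Finset.univ.filter fun x : ZMod p => (∀ i, x + (c i : ZMod p) ≠ 0) ∧
      ∑ i, (if s i then 1 else -1) * (x + (c i : ZMod p))⁻¹ = 0 with hR
    have hmaps : Set.MapsTo (ZMod.castHom hpn (ZMod p)) bad R := by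
      intro x hx
      obtain ⟨-, hx1, hx2⟩ := Finset.mem_filter.1 (Finset.mem_coe.1 hx)
      have h1 : ∀ i, ZMod.castHom hpn (ZMod p) x + (c i : ZMod p) ≠ 0 := by
        intro i
        have := (hunit _).1 (hx1 i)
        rwa [map_add, map_intCast] at this
      refine Finset.mem_coe.2 (Finset.mem_filter.2 ⟨Finset.mem_univ _, h1, ?_⟩)
      rw [hunit, not_not] at hx2
      rw [← hx2, hE, map_sum]
      refine Finset.sum_congr rfl fun i _ => ?_
      have h2 : ZMod.castHom hpn (ZMod p) (x + c i)⁻¹ =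
          (ZMod.castHom hpn (ZMod p) x + (c i : ZMod p))⁻¹ := by
        apply eq_inv_of_mul_eq_one_right
        have := congrArg (ZMod.castHom hpn (ZMod p)) (ZMod.mul_inv_of_unit _ (hx1 i))
        rwa [map_mul, map_add, map_intCast, map_one] at this
      split_ifs
      · rw [h2, one_mul]
      · rw [map_neg, h2, neg_one_mul]
    rw [Finset.card_eq_sum_card_fiberwise hmaps]
    have hRcard : R.card ≤ Fintype.card τ := by
      refine card_log_deriv_zero_le (fun i => if s i then 1 else -1) (fun i => (c i : ZMod p))
        (i₀ := i₀) ?_ ?_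
      · split_ifs <;> simp
      · intro i hi h
        exact hc i hi (by push_cast; rw [h, sub_self])
    refine (Finset.sum_le_card_nsmul _ _ (n / p) fun z _ => ?_).trans ?_
    · rw [← card_fiber_castHom hpn z]
      exact Finset.card_le_card (Finset.filter_subset_filter _ (Finset.subset_univ _))
    · rw [smul_eq_mul]
      exact Nat.mul_le_mul_right _ hRcard
  have h1 := le_of_mul_le_mul_left hbound (by exact_mod_cast hn0)
  exact h1.trans (by exact_mod_cast hcard)

end LocalBounds

section CompleteSums

variable {τ : Type*} [Fintype τ] [DecidableEq τ]

theorem norm_shiftSum_le {s : τ → Bool} (c : τ → ℤ) {i₀ : τ}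
    (hs : (Finset.univ.filter fun i => s i = s i₀).card =
      (Finset.univ.filter fun i => s i ≠ s i₀).card) (n : ℕ) :
    ∀ [NeZero n] (χ : DirichletCharacter ℂ n), (∀ p : ℕ, p.Prime → ¬ p ^ 4 ∣ n) →
      IsLocallyPrimitive χ →
      ‖shiftSum χ s c‖ ≤ (2 * Fintype.card τ : ℝ) ^ n.primeFactors.card * (n : ℝ) ^ (2 / 3 : ℝ) *
        ∏ i ∈ Finset.univ.erase i₀, (n.gcd (c i - c i₀).natAbs : ℝ) := by
  have hτ : (1 : ℝ) ≤ Fintype.card τ := by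
    exact_mod_cast Fintype.card_pos_iff.2 ⟨i₀⟩
  induction n using Nat.recOnPosPrimePosCoprime with
  | zero => intro h; exact absurd rfl h.out
  | one =>
    intro _ χ _ _
    refine (norm_shiftSum_le_card χ s c).trans ?_
    simp
  | prime_pow p k hp hk =>
    intro _ χ hfree hχ
    have : Fact p.Prime := ⟨hp⟩
    have hp1 : (1 : ℝ) ≤ p := by exact_mod_cast hp.one_lt.le
    have hp0 : (0 : ℝ) < p := by linarith
    have hk3 : k ≤ 3 := by
      by_contra! h
      exact hfree p hp (pow_dvd_pow p h)
    have hgcd : ∀ i ∈ Finset.univ.erase i₀, (1 : ℝ) ≤ ((p ^ k).gcd (c i - c i₀).natAbs : ℝ) :=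
      fun i _ => by exact_mod_cast Nat.gcd_pos_of_pos_left _ (pow_pos hp.pos k)
    have hω : (p ^ k).primeFactors.card = 1 := by
      rw [Nat.primeFactors_prime_pow hk.ne' hp, Finset.card_singleton]
    rw [hω, pow_one]
    have hcast : ((p ^ k : ℕ) : ℝ) = (p : ℝ) ^ (k : ℝ) := by push_cast; rw [Real.rpow_natCast]
    have hpow : ((p ^ k : ℕ) : ℝ) ^ (2 / 3 : ℝ) = (p : ℝ) ^ ((k : ℝ) * (2 / 3)) := by
      rw [hcast, ← Real.rpow_mul hp0.le]
    have hk1r : (1 : ℝ) ≤ k := by exact_mod_cast hk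
    have hk3r : (k : ℝ) ≤ 3 := by exact_mod_cast hk3
    by_cases hc : ∀ i ≠ i₀, ((c i - c i₀ : ℤ) : ZMod p) ≠ 0
    · have hprod := Finset.one_le_prod hgcd
      suffices h : ‖shiftSum χ s c‖ ≤ (2 * Fintype.card τ : ℝ) * ((p ^ k : ℕ) : ℝ) ^ (2 / 3 : ℝ) by
        exact h.trans (le_mul_of_one_le_right (by positivity) hprod)
      rw [hpow]
      by_cases hk1 : k = 1
      · subst hk1
        have hχ1 : χ ≠ 1 := by
          rintro rfl
          obtain ⟨y, hy, hy1⟩ := hχ p hp (dvd_pow_self p one_ne_zero)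
          exact hy1 (MulChar.one_apply hy)
        have h1 : ∀ (n : ℕ) [NeZero n] (χ : DirichletCharacter ℂ n), n = p → χ ≠ 1 →
            ‖shiftSum χ s c‖ ≤ 2 * Fintype.card τ * √p := by
          intro n _ ψ hn hψ
          subst hn
          exact norm_shiftSum_le_of_prime hψ c hs hc
        refine (h1 _ χ (pow_one p) hχ1).trans ?_
        rw [Real.sqrt_eq_rpow]
        gcongr
        norm_num
      · refine (norm_shiftSum_le_of_sq_dvd hp rfl (by omega) hχ c hc).trans ?_
        have h1 : ((p ^ k / p : ℕ) : ℝ) = (p : ℝ) ^ ((k : ℝ) - 1) := by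
          rw [Nat.cast_div (dvd_pow_self p hk.ne') hp0.ne', hcast, Real.rpow_sub_one hp0.ne']
        rw [h1]
        gcongr
        · linarith
        · linarith
    · push Not at hc
      obtain ⟨j, hj, hj0⟩ := hc
      have hj' : j ∈ Finset.univ.erase i₀ := Finset.mem_erase.2 ⟨hj, Finset.mem_univ j⟩
      have hpj : p ∣ (p ^ k).gcd (c j - c i₀).natAbs := by
        apply Nat.dvd_gcd (dvd_pow_self p hk.ne')
        rw [ZMod.intCast_zmod_eq_zero_iff_dvd] at hj0
        exact Int.natCast_dvd.1 hj0
      have hprod : (p : ℝ) ≤ ∏ i ∈ Finset.univ.erase i₀, ((p ^ k).gcd (c i - c i₀).natAbs : ℝ) := by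
        rw [← Finset.mul_prod_erase _ _ hj']
        have h1 : (p : ℝ) ≤ ((p ^ k).gcd (c j - c i₀).natAbs : ℝ) := by
          exact_mod_cast Nat.le_of_dvd (Nat.gcd_pos_of_pos_left _ (pow_pos hp.pos k)) hpj
        have h2 := Finset.one_le_prod fun i hi => hgcd i (Finset.mem_of_mem_erase (a := j) hi)
        nlinarith
      refine (norm_shiftSum_le_card χ s c).trans ?_
      rw [hpow]
      calc ((p ^ k : ℕ) : ℝ) = (p : ℝ) ^ (k : ℝ) := hcast
        _ ≤ (p : ℝ) ^ ((k : ℝ) * (2 / 3) + 1) := Real.rpow_le_rpow_of_exponent_le hp1 (by linarith)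
        _ = 1 * (p : ℝ) ^ ((k : ℝ) * (2 / 3)) * p := by rw [Real.rpow_add_one hp0.ne', one_mul]
        _ ≤ _ := by gcongr; linarith
  | coprime a b ha hb hab iha ihb =>
    intro _ χ hfree hχ
    have : NeZero a := ⟨by omega⟩
    have : NeZero b := ⟨by omega⟩
    obtain ⟨χ₁, χ₂, h12, hlp⟩ := exists_mul_decomposition hab χ
    obtain ⟨hl1, hl2⟩ := hlp hχ
    have h1 := iha χ₁ (fun p hp h => hfree p hp (h.mul_right b)) hl1
    have h2 := ihb χ₂ (fun p hp h => hfree p hp (h.mul_left a)) hl2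
    rw [shiftSum_mul hab h12, norm_mul]
    refine (mul_le_mul h1 h2 (norm_nonneg _) (by positivity)).trans (le_of_eq ?_)
    have hω : (a * b).primeFactors.card = a.primeFactors.card + b.primeFactors.card := by
      rw [hab.primeFactors_mul, Finset.card_union_of_disjoint hab.disjoint_primeFactors]
    have hg : ∏ i ∈ Finset.univ.erase i₀, ((a * b).gcd (c i - c i₀).natAbs : ℝ) =
        (∏ i ∈ Finset.univ.erase i₀, (a.gcd (c i - c i₀).natAbs : ℝ)) *
        ∏ i ∈ Finset.univ.erase i₀, (b.gcd (c i - c i₀).natAbs : ℝ) := by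
      rw [← Finset.prod_mul_distrib]
      refine Finset.prod_congr rfl fun i _ => ?_
      rw [Nat.gcd_comm, hab.gcd_mul, Nat.gcd_comm a, Nat.gcd_comm b]
      push_cast; rfl
    rw [hω, hg, pow_add, Nat.cast_mul, Real.mul_rpow (by positivity) (by positivity)]
    ring

theorem sum_gcd_Icc_le (a : ℕ) (ha : 0 < a) (H : ℕ) :
    ∑ d ∈ Finset.Icc 1 H, a.gcd d ≤ H * a.divisors.card := by
  calc ∑ d ∈ Finset.Icc 1 H, a.gcd d
      ≤ ∑ d ∈ Finset.Icc 1 H, ∑ e ∈ a.divisors, if e ∣ d then e else 0 := by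
        refine Finset.sum_le_sum fun d _ => ?_
        have h1 : a.gcd d ∈ a.divisors := Nat.mem_divisors.2 ⟨Nat.gcd_dvd_left _ _, ha.ne'⟩
        refine le_trans ?_ (Finset.single_le_sum (f := fun e => if e ∣ d then e else 0)
          (fun _ _ => Nat.zero_le _) h1)
        rw [if_pos (Nat.gcd_dvd_right a d)]
    _ = ∑ e ∈ a.divisors, (H / e) * e := by
        rw [Finset.sum_comm]
        refine Finset.sum_congr rfl fun e _ => ?_
        rw [← Finset.sum_filter, Finset.sum_const, smul_eq_mul]
        congr 1
        exact Nat.Ioc_filter_dvd_card_eq_div H e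
    _ ≤ ∑ e ∈ a.divisors, H := Finset.sum_le_sum fun e _ => Nat.div_mul_le_self H e
    _ = H * a.divisors.card := by rw [Finset.sum_const, smul_eq_mul, mul_comm]

theorem sum_gcd_sub_le (a : ℕ) (ha : 0 < a) (H t : ℕ) (ht : t < H) :
    ∑ h ∈ (Finset.range H).erase t, a.gcd ((h : ℤ) - t).natAbs ≤ 2 * H * a.divisors.card := by
  have hsplit : (Finset.range H).erase t =
      ((Finset.range H).filter fun h => t < h) ∪ ((Finset.range H).filter fun h => h < t) := by
    ext h
    simp only [Finset.mem_erase, Finset.mem_union, Finset.mem_filter, Finset.mem_range]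
    omega
  have h1 : ∑ h ∈ (Finset.range H).filter fun h => t < h, a.gcd ((h : ℤ) - t).natAbs ≤
      ∑ d ∈ Finset.Icc 1 H, a.gcd d := by
    have hinj : Set.InjOn (fun h : ℕ => ((h : ℤ) - t).natAbs) ((Finset.range H).filter fun h => t < h) := by
      intro x hx y hy hxy
      simp only [Finset.coe_filter, Set.mem_setOf_eq, Finset.mem_range] at hx hy hxy
      omega
    rw [← Finset.sum_image (f := fun d => a.gcd d) hinj]
    refine Finset.sum_le_sum_of_subset fun d hd => ?_
    simp only [Finset.mem_image, Finset.mem_filter, Finset.mem_range, Finset.mem_Icc] at hd ⊢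
    omega
  have h2 : ∑ h ∈ (Finset.range H).filter fun h => h < t, a.gcd ((h : ℤ) - t).natAbs ≤
      ∑ d ∈ Finset.Icc 1 H, a.gcd d := by
    have hinj : Set.InjOn (fun h : ℕ => ((h : ℤ) - t).natAbs) ((Finset.range H).filter fun h => h < t) := by
      intro x hx y hy hxy
      simp only [Finset.coe_filter, Set.mem_setOf_eq, Finset.mem_range] at hx hy hxy
      omega
    rw [← Finset.sum_image (f := fun d => a.gcd d) hinj]
    refine Finset.sum_le_sum_of_subset fun d hd => ?_
    simp only [Finset.mem_image, Finset.mem_filter, Finset.mem_range, Finset.mem_Icc] at hd ⊢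
    omega
  have h3 := sum_gcd_Icc_le a ha H
  rw [hsplit]
  rw [Finset.sum_union (Finset.disjoint_filter.2 fun _ _ h => h.not_gt)]
  linarith

end CompleteSums

section Moments

variable {τ : Type*} [Fintype τ] [DecidableEq τ]

theorem card_image_le_of_repeated {β : Type*} [DecidableEq β] {r : ℕ} (hτ : Fintype.card τ = 2 * r)
    {f : τ → β} (hf : ∀ i, ∃ j ≠ i, f j = f i) : (Finset.univ.image f).card ≤ r := by
  have h1 : (Finset.univ.image f).card * 2 ≤ (Finset.univ : Finset τ).card := by
    rw [mul_comm]
    refine Finset.mul_card_image_le_card (f := f) _ _ fun b hb => ?_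
    obtain ⟨i, -, rfl⟩ := Finset.mem_image.1 hb
    obtain ⟨j, hj, hji⟩ := hf i
    exact Finset.one_lt_card.2 ⟨j, by simp [hji], i, by simp, hj⟩
  rw [Finset.card_univ, hτ] at h1
  omega

theorem card_repeated_le {r : ℕ} (hτ : Fintype.card τ = 2 * r) {H : ℕ} (hH : 0 < H) :
    ((Fintype.piFinset fun _ : τ => Finset.range H).filter
      fun f => ∀ i, ∃ j ≠ i, f j = f i).card ≤ r ^ (2 * r) * H ^ r := by
  classical
  have hsub : ((Fintype.piFinset fun _ : τ => Finset.range H).filter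
      fun f => ∀ i, ∃ j ≠ i, f j = f i) ⊆
      ((Finset.univ : Finset (τ → Fin r)) ×ˢ (Fintype.piFinset fun _ : Fin r => Finset.range H)).image
        fun p => p.2 ∘ p.1 := by
    intro f hf
    obtain ⟨hfH, hf⟩ := Finset.mem_filter.1 hf
    rw [Fintype.mem_piFinset] at hfH
    have hc := card_image_le_of_repeated hτ hf
    obtain ⟨e⟩ : Nonempty ((Finset.univ.image f) ↪ Fin r) := by
      apply Function.Embedding.nonempty_of_card_le
      simpa using hc
    refine Finset.mem_image.2 ⟨⟨fun i => e ⟨f i, Finset.mem_image_of_mem f (Finset.mem_univ i)⟩,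
      Function.extend e (fun y => (y : ℕ)) fun _ => 0⟩, ?_, ?_⟩
    · refine Finset.mem_product.2 ⟨Finset.mem_univ _, Fintype.mem_piFinset.2 fun k => ?_⟩
      by_cases hk : ∃ y, e y = k
      · obtain ⟨y, rfl⟩ := hk
        simp only [e.injective.extend_apply]
        obtain ⟨i, -, hi⟩ := Finset.mem_image.1 y.2
        rw [← hi]
        exact hfH i
      · simp only [Function.extend_apply' _ _ _ hk]
        exact Finset.mem_range.2 hH
    · funext i
      simp only [Function.comp, e.injective.extend_apply]
  refine (Finset.card_le_card hsub).trans (Finset.card_image_le.trans ?_)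
  rw [Finset.card_product, Finset.card_univ, Fintype.card_fun, Fintype.card_fin, hτ,
    Fintype.card_piFinset_const, Finset.card_range]

theorem sum_prod_gcd_le (a : ℕ) (ha : 0 < a) (H : ℕ) (i₀ : τ) :
    ∑ f ∈ (Fintype.piFinset fun _ : τ => Finset.range H).filter (fun f => ∀ j ≠ i₀, f j ≠ f i₀),
      ∏ j ∈ Finset.univ.erase i₀, a.gcd ((f j : ℤ) - f i₀).natAbs ≤
      H * (2 * H * a.divisors.card) ^ (Fintype.card τ - 1) := by
  rw [← Finset.sum_fiberwise_of_maps_to (t := Finset.range H) (g := fun f => f i₀)]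
  swap
  · intro f hf
    exact Fintype.mem_piFinset.1 (Finset.mem_filter.1 hf).1 i₀
  have key : ∀ t ∈ Finset.range H, ∑ f ∈ ((Fintype.piFinset fun _ : τ => Finset.range H).filter
      (fun f => ∀ j ≠ i₀, f j ≠ f i₀)).filter (fun f => f i₀ = t),
      ∏ j ∈ Finset.univ.erase i₀, a.gcd ((f j : ℤ) - f i₀).natAbs ≤
      (2 * H * a.divisors.card) ^ (Fintype.card τ - 1) := by
    intro t ht
    calc _ ≤ ∑ f ∈ Fintype.piFinset (fun j : τ => if j = i₀ then {t} else (Finset.range H).erase t),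
          ∏ j, (if j = i₀ then 1 else a.gcd ((f j : ℤ) - t).natAbs) := by
          refine (Finset.sum_congr rfl fun f hf => ?_).trans_le (Finset.sum_le_sum_of_subset ?_)
          · rw [← Finset.mul_prod_erase _ _ (Finset.mem_univ i₀), if_pos rfl, one_mul]
            refine Finset.prod_congr rfl fun j hj => ?_
            rw [if_neg (Finset.ne_of_mem_erase hj), (Finset.mem_filter.1 hf).2]
          · intro f hf
            obtain ⟨hf, hft⟩ := Finset.mem_filter.1 hf
            obtain ⟨hfH, hf⟩ := Finset.mem_filter.1 hf
            refine Fintype.mem_piFinset.2 fun j => ?_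
            by_cases hj : j = i₀
            · rw [if_pos hj, hj, hft]; exact Finset.mem_singleton_self t
            · rw [if_neg hj, Finset.mem_erase, ← hft]
              exact ⟨hf j hj, Fintype.mem_piFinset.1 hfH j⟩
      _ = ∏ j : τ, ∑ h ∈ (if j = i₀ then {t} else (Finset.range H).erase t),
            (if j = i₀ then 1 else a.gcd ((h : ℤ) - t).natAbs) := by
          rw [Finset.prod_univ_sum]
      _ = ∏ j ∈ Finset.univ.erase i₀, ∑ h ∈ (Finset.range H).erase t, a.gcd ((h : ℤ) - t).natAbs := by
          rw [← Finset.mul_prod_erase _ _ (Finset.mem_univ i₀)]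
          simp only [if_true, Finset.sum_singleton, one_mul]
          refine Finset.prod_congr rfl fun j hj => ?_
          simp only [if_neg (Finset.ne_of_mem_erase hj)]
      _ ≤ _ := by
          rw [Finset.prod_const, Finset.card_erase_of_mem (Finset.mem_univ _), Finset.card_univ]
          exact Nat.pow_le_pow_left (sum_gcd_sub_le a ha H t (Finset.mem_range.1 ht)) _
  refine (Finset.sum_le_card_nsmul _ _ _ key).trans ?_
  rw [Finset.card_range, smul_eq_mul]

theorem star_dirichletCharacter_apply {n : ℕ} [NeZero n] (χ : DirichletCharacter ℂ n) (x : ZMod n) :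
    (starRingEnd ℂ) (χ x) = χ⁻¹ x := MulChar.star_apply' χ x

theorem sum_norm_pow_le (a : ℕ) [NeZero a] (hfree : ∀ p : ℕ, p.Prime → ¬ p ^ 4 ∣ a)
    {χ : DirichletCharacter ℂ a} (hχ : IsLocallyPrimitive χ) {u : ℕ} (hu : a.Coprime u)
    {g : ℕ → ℂ} (hg : ∀ h, ‖g h‖ ≤ 1) {H r : ℕ} (hH : 0 < H) :
    ∑ x : ZMod a, ‖∑ h ∈ Finset.range H, g h * χ (x + (u * h : ℕ))‖ ^ (2 * r) ≤
      r ^ (2 * r) * H ^ r * a + (4 * r) ^ a.primeFactors.card * (a : ℝ) ^ (2 / 3 : ℝ) *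
        (2 * r * (H * (2 * H * a.divisors.card) ^ (2 * r - 1))) := by
  classical
  have ha : 0 < a := Nat.pos_of_neZero a
  set T := Fin r ⊕ Fin r
  have hT : Fintype.card T = 2 * r := by simp [T, two_mul]
  set w : T → ℕ → ℂ := fun i h => if i.isLeft then g h else (starRingEnd ℂ) (g h) with hw
  have hw1 : ∀ i h, ‖w i h‖ ≤ 1 := by
    intro i h
    simp only [hw]
    split_ifs
    · exact hg h
    · rw [RCLike.norm_conj]; exact hg h
  set s : T → Bool := Sum.isLeft with hs
  set c : (T → ℕ) → T → ℤ := fun f i => ((u * f i : ℕ) : ℤ) with hc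
  have hexp : ((∑ x : ZMod a, ‖∑ h ∈ Finset.range H, g h * χ (x + (u * h : ℕ))‖ ^ (2 * r) : ℝ) : ℂ) =
      ∑ f ∈ Fintype.piFinset (fun _ : T => Finset.range H),
        (∏ i, w i (f i)) * shiftSum χ s (c f) := by
    simp only [shiftSum, Finset.mul_sum]
    rw [Finset.sum_comm]
    push_cast
    refine Finset.sum_congr rfl fun x _ => ?_
    calc _ = ∏ i : T, ∑ h ∈ Finset.range H, w i h * signed χ (s i) (x + (u * h : ℕ)) := by
          rw [Fintype.prod_sum_type]
          simp only [hw, hs, Sum.isLeft_inl, Sum.isLeft_inr, if_true, signed, Bool.false_eq_true,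
            if_false, Finset.prod_const, Finset.card_univ, Fintype.card_fin]
          have : ∑ h ∈ Finset.range H, (starRingEnd ℂ) (g h) * χ⁻¹ (x + (u * h : ℕ)) =
              (starRingEnd ℂ) (∑ h ∈ Finset.range H, g h * χ (x + (u * h : ℕ))) := by
            rw [map_sum]
            refine Finset.sum_congr rfl fun h _ => ?_
            rw [map_mul, star_dirichletCharacter_apply]
          rw [this, ← mul_pow, RCLike.mul_conj, ← pow_mul]
          simp only [Nat.cast_mul]
          rfl
      _ = _ := by
          rw [Finset.prod_univ_sum]
          refine Finset.sum_congr rfl fun f _ => ?_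
          rw [Finset.prod_mul_distrib]
          simp [hc]
  have hnn : 0 ≤ ∑ x : ZMod a, ‖∑ h ∈ Finset.range H, g h * χ (x + (u * h : ℕ))‖ ^ (2 * r) :=
    Finset.sum_nonneg fun _ _ => by positivity
  rw [← abs_of_nonneg hnn, ← Real.norm_eq_abs, ← Complex.norm_real, hexp]
  have hle : ∀ f, ‖(∏ i, w i (f i)) * shiftSum χ s (c f)‖ ≤ ‖shiftSum χ s (c f)‖ := by
    intro f
    rw [norm_mul, norm_prod]
    exact mul_le_of_le_one_left (norm_nonneg _)
      (Finset.prod_le_one (fun _ _ => norm_nonneg _) fun i _ => hw1 i _)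
  refine (norm_sum_le_of_le _ fun f _ => hle f).trans ?_
  rw [← Finset.sum_filter_add_sum_filter_not _ fun f : T → ℕ => ∀ i, ∃ j ≠ i, f j = f i]
  refine add_le_add ?_ ?_
  · refine (Finset.sum_le_card_nsmul _ _ _ fun f _ => norm_shiftSum_le_card χ s (c f)).trans ?_
    rw [nsmul_eq_mul]
    gcongr
    exact_mod_cast card_repeated_le hT hH
  · have hbal : ∀ i₀ : T, (Finset.univ.filter fun i => s i = s i₀).card =
        (Finset.univ.filter fun i => s i ≠ s i₀).card := by
      have h1 : (Finset.univ.filter fun i : T => s i = true).card = r := by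
        rw [Finset.card_filter, Fintype.sum_sum_type]
        simp [hs]
      have h2 : (Finset.univ.filter fun i : T => s i = false).card = r := by
        rw [Finset.card_filter, Fintype.sum_sum_type]
        simp [hs]
      intro i₀
      cases s i₀ <;> simp [h1, h2]
    set K : ℝ := (4 * r) ^ a.primeFactors.card * (a : ℝ) ^ (2 / 3 : ℝ) with hK
    have hK0 : 0 ≤ K := by positivity
    calc _ ≤ ∑ i₀ : T, ∑ f ∈ (Fintype.piFinset fun _ : T => Finset.range H).filter
            (fun f => ∀ j ≠ i₀, f j ≠ f i₀), ‖shiftSum χ s (c f)‖ := by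
          simp only [Finset.sum_filter]
          rw [Finset.sum_comm]
          refine Finset.sum_le_sum fun f _ => ?_
          split_ifs with h
          · exact Finset.sum_nonneg fun i _ => by
              split_ifs
              exacts [norm_nonneg _, le_rfl]
          · push Not at h
            obtain ⟨i₀, hi₀⟩ := h
            refine le_trans ?_ (Finset.single_le_sum (f := fun i₀ : T =>
              if ∀ j ≠ i₀, f j ≠ f i₀ then ‖shiftSum χ s (c f)‖ else 0) (fun i _ => ?_)
              (Finset.mem_univ i₀))
            · rw [if_pos hi₀]
            · split_ifs
              exacts [norm_nonneg _, le_rfl]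
      _ ≤ ∑ i₀ : T, K * (H * (2 * H * a.divisors.card) ^ (2 * r - 1)) := by
          refine Finset.sum_le_sum fun i₀ _ => ?_
          have h1 := sum_prod_gcd_le a ha H i₀
          rw [hT] at h1
          have h2 : ((∑ f ∈ (Fintype.piFinset fun _ : T => Finset.range H).filter
              (fun f => ∀ j ≠ i₀, f j ≠ f i₀),
              ∏ j ∈ Finset.univ.erase i₀, a.gcd ((f j : ℤ) - f i₀).natAbs : ℕ) : ℝ) ≤
              H * (2 * H * a.divisors.card) ^ (2 * r - 1) := by exact_mod_cast h1
          refine le_trans ?_ (mul_le_mul_of_nonneg_left h2 hK0)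
          push_cast
          rw [Finset.mul_sum]
          refine Finset.sum_le_sum fun f _ => ?_
          refine (norm_shiftSum_le (c f) (hbal i₀) a χ hfree hχ).trans (le_of_eq ?_)
          rw [hT, hK]
          congr 1
          · push_cast
            ring
          · refine Finset.prod_congr rfl fun i _ => ?_
            simp only [hc]
            rw [Nat.cast_mul, Nat.cast_mul, ← mul_sub, Int.natAbs_mul, Int.natAbs_natCast,
              Nat.Coprime.gcd_mul_left_cancel_right _ hu.symm]
      _ = _ := by
          rw [Finset.sum_const, Finset.card_univ, hT, nsmul_eq_mul]
          push_cast
          ring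

end Moments

section Counting

theorem card_Icc_filter_cast_eq_le (a : ℕ) [NeZero a] (k : ZMod a) (X : ℕ) :
    ((Finset.Icc 1 X).filter fun l : ℕ => (l : ZMod a) = k).card ≤ X / a + 1 := by
  rw [← Finset.card_range (X / a + 1)]
  refine Finset.card_le_card_of_injOn (fun l => l / a) ?_ ?_
  · intro l hl
    have hl' := Finset.mem_Icc.1 (Finset.mem_filter.1 (Finset.mem_coe.1 hl)).1
    rw [Finset.mem_coe, Finset.mem_range]
    exact Nat.lt_succ_of_le (Nat.div_le_div_right hl'.2)
  · intro l hl l' hl' h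
    have h1 := (Finset.mem_filter.1 (Finset.mem_coe.1 hl)).2
    have h2 := (Finset.mem_filter.1 (Finset.mem_coe.1 hl')).2
    have h3 : l % a = l' % a := (ZMod.natCast_eq_natCast_iff' l l' a).1 (h1.trans h2.symm)
    rw [← Nat.div_add_mod l a, ← Nat.div_add_mod l' a, h3]
    simp only at h
    rw [h]

theorem card_filter_cast_eq_le {Ω : Type*} (s : Finset Ω) (F : Ω → ℕ) {X T : ℕ}
    (hF : ∀ ω ∈ s, F ω ∈ Finset.Icc 1 X)
    (hT : ∀ l ∈ Finset.Icc 1 X, (s.filter fun ω => F ω = l).card ≤ T) (a : ℕ) [NeZero a] (k : ZMod a) :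
    (s.filter fun ω => (F ω : ZMod a) = k).card ≤ (X / a + 1) * T := by
  classical
  have h := Finset.card_eq_sum_card_fiberwise (f := F)
    (s := s.filter fun ω => (F ω : ZMod a) = k)
    (t := (Finset.Icc 1 X).filter fun l : ℕ => (l : ZMod a) = k) (by
      intro ω hω
      obtain ⟨hω, h1⟩ := Finset.mem_filter.1 (Finset.mem_coe.1 hω)
      exact Finset.mem_coe.2 (Finset.mem_filter.2 ⟨hF ω hω, h1⟩))
  rw [h]
  refine (Finset.sum_le_card_nsmul _ _ T fun l hl => ?_).trans ?_
  · refine (Finset.card_le_card ?_).trans (hT l (Finset.mem_filter.1 hl).1)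
    exact Finset.filter_subset_filter _ (Finset.filter_subset _ _)
  · rw [smul_eq_mul]
    exact Nat.mul_le_mul_right T (card_Icc_filter_cast_eq_le a k X)

theorem card_mul_eq_le (s : Finset (ℕ × ℕ)) {l : ℕ} (hl : l ≠ 0) :
    (s.filter fun p => p.1 * p.2 = l).card ≤ l.divisors.card := by
  refine Finset.card_le_card_of_injOn (fun p => p.1) ?_ ?_
  · intro p hp
    have hp' := (Finset.mem_filter.1 (Finset.mem_coe.1 hp)).2
    exact Finset.mem_coe.2 (Nat.mem_divisors.2 ⟨⟨p.2, hp'.symm⟩, hl⟩)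
  · intro p hp p' hp' h
    have h1 := (Finset.mem_filter.1 (Finset.mem_coe.1 hp)).2
    have h2 := (Finset.mem_filter.1 (Finset.mem_coe.1 hp')).2
    simp only at h
    have h3 : p.1 ≠ 0 := by
      rintro h0
      rw [h0, zero_mul] at h1
      exact hl h1.symm
    refine Prod.ext h (Nat.eq_of_mul_eq_mul_left (Nat.pos_of_ne_zero h3) ?_)
    rw [h1, h, h2]

open ArithmeticFunction in
theorem card_coprime_eq_sum (m : ℕ) (hm : m ≠ 0) (N : ℕ) :
    (((Finset.Icc 1 N).filter fun n => n.Coprime m).card : ℤ) =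
      ∑ d ∈ m.divisors, moebius d * (N / d : ℕ) := by
  have h1 : ∀ n ∈ Finset.Icc 1 N, (if n.Coprime m then (1 : ℤ) else 0) =
      ∑ d ∈ m.divisors, if d ∣ n then moebius d else 0 := by
    intro n hn
    have hn0 : n ≠ 0 := by have := Finset.mem_Icc.1 hn; omega
    have h2 := congrArg (fun f : ArithmeticFunction ℤ => f (n.gcd m)) moebius_mul_coe_zeta
    simp only [coe_mul_zeta_apply, one_apply] at h2
    rw [← Finset.sum_filter]
    have h3 : m.divisors.filter (fun d => d ∣ n) = (n.gcd m).divisors := by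
      ext d
      simp only [Finset.mem_filter, Nat.mem_divisors, Nat.dvd_gcd_iff]
      have : n.gcd m ≠ 0 := Nat.gcd_ne_zero_left hn0
      tauto
    rw [h3, h2]
  rw [Finset.card_filter]
  push_cast
  rw [Finset.sum_congr rfl h1, Finset.sum_comm]
  refine Finset.sum_congr rfl fun d _ => ?_
  rw [← Finset.sum_filter, Finset.sum_const, nsmul_eq_mul, mul_comm]
  congr 2
  exact Nat.Ioc_filter_dvd_card_eq_div N d

theorem le_card_divisors_mul_totient (m : ℕ) : m ≤ m.divisors.card * m.totient := by
  rcases Nat.eq_zero_or_pos m with rfl | hm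
  · simp
  · calc m = ∑ d ∈ m.divisors, d.totient := (Nat.sum_totient m).symm
      _ ≤ ∑ d ∈ m.divisors, m.totient := Finset.sum_le_sum fun d hd =>
          Nat.le_of_dvd (Nat.totient_pos.2 hm) (Nat.totient_dvd_of_dvd (Nat.dvd_of_mem_divisors hd))
      _ = _ := by rw [Finset.sum_const, smul_eq_mul]

open ArithmeticFunction in
theorem card_coprime_ge (m : ℕ) (hm : 0 < m) (N : ℕ) :
    (N : ℝ) / m.divisors.card - m.divisors.card ≤
      ((Finset.Icc 1 N).filter fun n => n.Coprime m).card := by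
  have hm' : (0 : ℝ) < m := by exact_mod_cast hm
  have hτ : (0 : ℝ) < m.divisors.card := by
    exact_mod_cast Finset.card_pos.2 ⟨1, Nat.one_mem_divisors.2 hm.ne'⟩
  have hφ : (m.totient : ℝ) = ∑ d ∈ m.divisors, (moebius d : ℝ) * (m / d) := by
    have h := card_coprime_eq_sum m hm.ne' m
    have h1 : ((Finset.Icc 1 m).filter fun n => n.Coprime m).card = m.totient := by
      have := Nat.filter_coprime_Ico_eq_totient m 1
      rw [← this]
      congr 1
      ext n
      simp only [Finset.mem_filter, Finset.mem_Icc, Finset.mem_Ico, Nat.coprime_comm (m := n)]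
      constructor
      · rintro ⟨⟨a, b⟩, c⟩; exact ⟨⟨a, by omega⟩, c⟩
      · rintro ⟨⟨a, b⟩, c⟩; exact ⟨⟨a, by omega⟩, c⟩
    rw [h1] at h
    have h2 := congrArg (Int.cast (R := ℝ)) h
    simp only [Int.cast_sum, Int.cast_mul, Int.cast_natCast] at h2
    rw [h2]
    refine Finset.sum_congr rfl fun d hd => ?_
    rw [Nat.cast_div (Nat.dvd_of_mem_divisors hd)
      (Nat.cast_ne_zero.2 (Nat.pos_of_mem_divisors hd).ne')]
  have hN : (((Finset.Icc 1 N).filter fun n => n.Coprime m).card : ℝ) =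
      ∑ d ∈ m.divisors, (moebius d : ℝ) * ((N / d : ℕ) : ℝ) := by
    have h2 := congrArg (Int.cast (R := ℝ)) (card_coprime_eq_sum m hm.ne' N)
    simpa only [Int.cast_sum, Int.cast_mul, Int.cast_natCast] using h2
  have hφN : (N : ℝ) / m * m.totient = ∑ d ∈ m.divisors, (moebius d : ℝ) * (N / d) := by
    rw [hφ, Finset.mul_sum]
    refine Finset.sum_congr rfl fun d _ => ?_
    field_simp
  have hdiff : (N : ℝ) / m * m.totient - ((Finset.Icc 1 N).filter fun n => n.Coprime m).card ≤
      m.divisors.card := by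
    rw [hN, hφN, ← Finset.sum_sub_distrib]
    refine (Finset.sum_le_card_nsmul _ _ 1 fun d hd => ?_).trans (by simp)
    have hd0 : (0 : ℝ) < d := by exact_mod_cast Nat.pos_of_mem_divisors hd
    have h1 : ((N / d : ℕ) : ℝ) ≤ (N : ℝ) / d := Nat.cast_div_le
    have h2 : (N : ℝ) / d < (N / d : ℕ) + 1 := by
      rw [div_lt_iff₀ hd0]
      have := Nat.lt_div_mul_add (a := N) (Nat.pos_of_mem_divisors hd)
      have h3 : (N : ℝ) < (N / d : ℕ) * d + d := by exact_mod_cast this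
      linarith
    have h3 : |(moebius d : ℝ)| ≤ 1 := by exact_mod_cast abs_moebius_le_one
    obtain ⟨h4, h5⟩ := abs_le.1 h3
    nlinarith
  have h3 : (N : ℝ) / m.divisors.card ≤ N / m * m.totient := by
    rw [div_mul_eq_mul_div, div_le_div_iff₀ hτ hm']
    have : (m : ℝ) ≤ m.divisors.card * m.totient := by exact_mod_cast le_card_divisors_mul_totient m
    nlinarith [Nat.cast_nonneg (α := ℝ) N]
  linarith

/-- Short intervals contain almost the expected number of integers coprime to `m`. -/
theorem exists_card_coprime_ge {η : ℝ} (hη : 0 < η) :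
    ∃ M : ℝ, ∀ m : ℕ, M ≤ m → ∀ N : ℕ, 0 < N →
      (N : ℝ) * (m : ℝ) ^ (-η) ≤ ((Finset.Icc 1 N).filter fun n => n.Coprime m).card := by
  obtain ⟨C, hC, hdiv⟩ := exists_card_divisors_le (show 0 < η / 4 by linarith)
  obtain ⟨M, hM1, hM⟩ := exists_forall_mul_rpow_le (2 * C) (show η / 4 < η / 2 by linarith)
  refine ⟨M, fun m hm N hN => ?_⟩
  have hm1 : (1 : ℝ) ≤ m := hM1.trans hm
  have hm0 : (0 : ℝ) < m := by linarith
  have hmn : m ≠ 0 := by rintro rfl; simp at hm0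
  have hNr : (1 : ℝ) ≤ N := by exact_mod_cast hN
  by_cases hNs : (N : ℝ) ≤ (m : ℝ) ^ η
  · have h1 : (N : ℝ) * (m : ℝ) ^ (-η) ≤ 1 := by
      rw [Real.rpow_neg hm0.le, ← div_eq_mul_inv, div_le_one (by positivity)]
      exact hNs
    refine h1.trans (Nat.one_le_cast.2 (Finset.card_pos.2 ⟨1, Finset.mem_filter.2
      ⟨Finset.mem_Icc.2 ⟨le_rfl, hN⟩, Nat.coprime_one_left m⟩⟩))
  · push Not at hNs
    refine le_trans ?_ (card_coprime_ge m (Nat.pos_of_ne_zero hmn) N)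
    set t : ℝ := (m.divisors.card : ℝ) with ht
    have ht1 : 1 ≤ t := Nat.one_le_cast.2 (Finset.card_pos.2 ⟨1, Nat.one_mem_divisors.2 hmn⟩)
    have ht2 : 2 * t ≤ (m : ℝ) ^ (η / 2) := by
      have := hdiv m hmn
      have := hM m hm
      linarith
    have hsq : (m : ℝ) ^ η = (m : ℝ) ^ (η / 2) * (m : ℝ) ^ (η / 2) := by
      rw [← Real.rpow_add hm0]; congr 1; ring
    set y : ℝ := (m : ℝ) ^ (η / 2) with hy
    have hy0 : 0 < y := by positivity
    rw [Real.rpow_neg hm0.le, hsq]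
    rw [hsq] at hNs
    have h1 : (N : ℝ) * (y * y)⁻¹ ≤ N / t / 2 := by
      rw [← div_eq_mul_inv, div_div]
      refine div_le_div_of_nonneg_left (by positivity) (by positivity) ?_
      nlinarith
    have h2 : t ≤ N / t / 2 := by
      rw [div_div, le_div_iff₀ (by positivity)]
      nlinarith
    linarith

end Counting

section Burgess

theorem norm_sum_mul_apply_add_le {b : ℕ} [NeZero b] {u : ℕ} {D : ℕ} (hb : b ∣ u ^ (D + 2)) {H : ℕ}
    {𝒢 : Finset (ℕ → ℂ)} {E : ℝ} (hE : 0 ≤ E)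
    (hnet : ∀ ζ f, IsPhase (D + 1) ζ f → (∀ t, ‖f t‖ = 1) → ∃ g ∈ 𝒢, ∀ h ≤ H, ‖f h - g h‖ ≤ E)
    (ψ : DirichletCharacter ℂ b) (z : ZMod b) {w : ℕ → ℂ} (hw : ∀ h, ‖w h‖ ≤ 1) {K : ℝ} (hK0 : 0 ≤ K)
    (hK : ∀ g ∈ 𝒢, ‖∑ h ∈ Finset.range H, g h * w h‖ ≤ K) :
    ‖∑ h ∈ Finset.range H, w h * ψ (z + (u * h : ℕ))‖ ≤ K + H * E := by
  have hu : (u : ZMod b) ^ (D + 2) = 0 := by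
    have := (ZMod.natCast_eq_zero_iff (u ^ (D + 2)) b).2 hb
    push_cast at this
    exact this
  have hnil : ∀ y : ZMod b, IsNilpotent ((u : ZMod b) * y) := fun y => ⟨D + 2, by rw [mul_pow, hu, zero_mul]⟩
  by_cases hz : IsUnit z
  · obtain ⟨v, rfl⟩ := hz
    set f : ℕ → ℂ := fun h => ψ (1 + (↑v⁻¹ * (u : ZMod b)) * h) with hf
    obtain ⟨ζ, hphase⟩ : ∃ ζ, IsPhase (D + 1) ζ f :=
      ⟨_, isPhase_of_nilpotent ψ (z := ↑v⁻¹ * (u : ZMod b)) (by rw [mul_pow, hu, mul_zero])⟩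
    have hf1 : ∀ t, ‖f t‖ = 1 := fun t => by
      refine norm_eq_one_of_isUnit ψ (IsNilpotent.isUnit_one_add ?_)
      rw [mul_comm (↑v⁻¹ : ZMod b), mul_assoc]
      exact hnil _
    obtain ⟨g, hg, hfg⟩ := hnet ζ f hphase hf1
    have h1 : ∑ h ∈ Finset.range H, w h * ψ (v + (u * h : ℕ)) =
        ψ v * (∑ h ∈ Finset.range H, g h * w h + ∑ h ∈ Finset.range H, (f h - g h) * w h) := by
      rw [← Finset.sum_add_distrib, Finset.mul_sum]
      refine Finset.sum_congr rfl fun h _ => ?_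
      have : (v : ZMod b) + (u * h : ℕ) = v * (1 + (↑v⁻¹ * (u : ZMod b)) * h) := by
        rw [mul_add, ← mul_assoc, ← mul_assoc, Units.mul_inv]
        push_cast
        ring
      rw [this, map_mul]
      simp only [hf]
      ring
    rw [h1, norm_mul, ψ.unit_norm_eq_one, one_mul]
    refine (norm_add_le _ _).trans (add_le_add (hK g hg) ?_)
    refine (norm_sum_le_of_le _ fun h hh => ?_).trans (b := ∑ h ∈ Finset.range H, E) ?_
    · rw [norm_mul]
      exact (mul_le_of_le_one_right (norm_nonneg _) (hw h)).trans
        (hfg h (Finset.mem_range.1 hh).le)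
    · rw [Finset.sum_const, Finset.card_range, nsmul_eq_mul]
  · rw [Finset.sum_eq_zero, norm_zero]
    · positivity
    · intro h _
      rw [MulChar.map_nonunit, mul_zero]
      intro hunit
      apply hz
      have := IsNilpotent.isUnit_add_left_of_commute (hnil (-h)) hunit (Commute.all _ _)
      convert this using 1
      push_cast
      ring

theorem norm_sum_mul_card_le {q : ℕ} [NeZero q] (χ : DirichletCharacter ℂ q) {𝒜 : Finset ℕ} {A : ℕ}
    (hA : ∀ α ∈ 𝒜, α ≤ A ∧ α.Coprime q) (u H N : ℕ) :
    ‖∑ n ∈ Finset.range N, χ n‖ * (𝒜.card * H) ≤ 𝒜.card * H * (2 * (u * A * H) + 1) +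
      ∑ α ∈ 𝒜, ∑ n ∈ Finset.Icc 1 N,
        ‖∑ h ∈ Finset.range H, χ ((n : ZMod q) * (α : ZMod q)⁻¹ + (u * h : ℕ))‖ := by
  set S := ∑ n ∈ Finset.range N, χ n with hS
  have h1 : ∀ α ∈ 𝒜, ‖S‖ * H ≤ H * (2 * (u * A * H) + 1) + ∑ n ∈ Finset.Icc 1 N,
      ‖∑ h ∈ Finset.range H, χ ((n : ZMod q) * (α : ZMod q)⁻¹ + (u * h : ℕ))‖ := by
    intro α hα
    obtain ⟨hαA, hαq⟩ := hA α hα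
    have hunit : (α : ZMod q) * (α : ZMod q)⁻¹ = 1 := ZMod.coe_mul_inv_eq_one α hαq
    have h2 : ∀ h ∈ Finset.range H,
        ‖∑ n ∈ Finset.range N, χ ((n + u * α * h : ℕ) : ZMod q) - S‖ ≤ 2 * (u * A * H) := by
      intro h hh
      refine (norm_sum_range_shift_sub_le (f := fun n : ℕ => χ (n : ZMod q))
        (fun n => DirichletCharacter.norm_le_one _ _) N (u * α * h)).trans ?_
      have h3 : (h : ℝ) ≤ H := by exact_mod_cast (Finset.mem_range.1 hh).le
      have h4 : (α : ℝ) ≤ A := by exact_mod_cast hαA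
      push_cast
      gcongr
    have h3 : (H : ℂ) * S = ∑ n ∈ Finset.range N, ∑ h ∈ Finset.range H,
          χ ((n + u * α * h : ℕ) : ZMod q) -
        ∑ h ∈ Finset.range H, (∑ n ∈ Finset.range N, χ ((n + u * α * h : ℕ) : ZMod q) - S) := by
      rw [Finset.sum_sub_distrib, Finset.sum_comm, sub_sub_cancel, Finset.sum_const,
        Finset.card_range, nsmul_eq_mul]
    have h4 : ∀ n : ℕ, ‖∑ h ∈ Finset.range H, χ ((n + u * α * h : ℕ) : ZMod q)‖ =
        ‖∑ h ∈ Finset.range H, χ ((n : ZMod q) * (α : ZMod q)⁻¹ + (u * h : ℕ))‖ := by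
      intro n
      have h5 : ∑ h ∈ Finset.range H, χ ((n + u * α * h : ℕ) : ZMod q) = χ α *
          ∑ h ∈ Finset.range H, χ ((n : ZMod q) * (α : ZMod q)⁻¹ + (u * h : ℕ)) := by
        rw [Finset.mul_sum]
        refine Finset.sum_congr rfl fun h _ => ?_
        rw [← map_mul]
        congr 1
        push_cast
        linear_combination (-(n : ZMod q)) * hunit
      rw [h5, norm_mul, norm_eq_one_of_isUnit χ ((ZMod.isUnit_iff_coprime α q).2 hαq), one_mul]
    have h5 : ‖S‖ * H = ‖(H : ℂ) * S‖ := by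
      rw [norm_mul, Complex.norm_natCast, mul_comm]
    rw [h5, h3]
    refine (norm_sub_le _ _).trans ?_
    have h6 : ‖∑ h ∈ Finset.range H,
        (∑ n ∈ Finset.range N, χ ((n + u * α * h : ℕ) : ZMod q) - S)‖ ≤ H * (2 * (u * A * H)) := by
      refine (norm_sum_le_of_le _ h2).trans (le_of_eq ?_)
      rw [Finset.sum_const, Finset.card_range, nsmul_eq_mul]
    have h7 : ‖∑ n ∈ Finset.range N, ∑ h ∈ Finset.range H, χ ((n + u * α * h : ℕ) : ZMod q)‖ ≤
        H + ∑ n ∈ Finset.Icc 1 N,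
          ‖∑ h ∈ Finset.range H, χ ((n : ZMod q) * (α : ZMod q)⁻¹ + (u * h : ℕ))‖ := by
      refine (norm_sum_le _ _).trans ?_
      calc _ ≤ ∑ n ∈ insert 0 (Finset.Icc 1 N),
            ‖∑ h ∈ Finset.range H, χ ((n + u * α * h : ℕ) : ZMod q)‖ := by
            refine Finset.sum_le_sum_of_subset_of_nonneg (fun n hn => ?_) fun _ _ _ => norm_nonneg _
            simp only [Finset.mem_range, Finset.mem_insert, Finset.mem_Icc] at hn ⊢
            omega
        _ ≤ _ := by
            rw [Finset.sum_insert (by simp)]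
            refine add_le_add ?_ (Finset.sum_le_sum fun n _ => (h4 n).le)
            refine (norm_sum_le_of_le _ fun h _ => DirichletCharacter.norm_le_one χ _).trans ?_
            rw [Finset.sum_const, Finset.card_range, nsmul_eq_mul, mul_one]
    linarith
  have h2 := Finset.sum_le_sum h1
  rw [Finset.sum_add_distrib, Finset.sum_const, Finset.sum_const, nsmul_eq_mul, nsmul_eq_mul] at h2
  linarith

theorem card_pairs_mul_eq_le (a : ℕ) [NeZero a] {A N T : ℕ}
    (hT : ∀ l ∈ Finset.Icc 1 (A * N), l.divisors.card ≤ T) :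
    (((Finset.Icc 1 A ×ˢ Finset.Icc 1 N) ×ˢ (Finset.Icc 1 A ×ˢ Finset.Icc 1 N)).filter
      fun p => ((p.1.1 * p.1.2 : ℕ) : ZMod a) = ((p.2.1 * p.2.2 : ℕ) : ZMod a)).card ≤
      A * N * ((A * N / a + 1) * T) := by
  rw [Finset.card_filter, Finset.sum_product]
  refine (Finset.sum_le_card_nsmul _ _ ((A * N / a + 1) * T) fun s _ => ?_).trans ?_
  · rw [← Finset.card_filter]
    have := card_filter_cast_eq_le (Finset.Icc 1 A ×ˢ Finset.Icc 1 N) (fun p => p.1 * p.2)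
      (X := A * N) (T := T) (fun p hp => ?_) (fun l hl => ?_) a ((s.1 * s.2 : ℕ) : ZMod a)
    · simpa only [eq_comm] using this
    · obtain ⟨h1, h2⟩ := Finset.mem_product.1 hp
      rw [Finset.mem_Icc] at h1 h2 ⊢
      exact ⟨Nat.mul_pos h1.1 h2.1, Nat.mul_le_mul h1.2 h2.2⟩
    · exact (card_mul_eq_le _ (by have := (Finset.mem_Icc.1 hl).1; omega)).trans (hT l hl)
  · simp

theorem sq_card_filter_mem_le (a : ℕ) [NeZero a] {A N T : ℕ}
    (hT : ∀ l ∈ Finset.Icc 1 (A * N), l.divisors.card ≤ T) {P : Finset (ℕ × ℕ)}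
    (hP : P ⊆ Finset.Icc 1 A ×ˢ Finset.Icc 1 N) {y : ℕ × ℕ → ZMod a}
    (hy : ∀ p ∈ P, y p * p.1 = p.2) (B : Finset (ZMod a)) :
    (P.filter fun p => y p ∈ B).card ^ 2 ≤ B.card * (A * N * ((A * N / a + 1) * T)) := by
  classical
  have h1 : (P.filter fun p => y p ∈ B).card = ∑ k ∈ B, (P.filter fun p => y p = k).card := by
    rw [Finset.card_eq_sum_card_fiberwise (s := P.filter fun p => y p ∈ B) (f := y) (t := B)
      fun p hp => (Finset.mem_filter.1 (Finset.mem_coe.1 hp)).2]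
    refine Finset.sum_congr rfl fun k hk => ?_
    congr 1
    rw [Finset.filter_filter]
    refine Finset.filter_congr fun p _ => ?_
    constructor
    · exact fun h => h.2
    · rintro rfl; exact ⟨hk, rfl⟩
  rw [h1]
  refine sq_sum_le_card_mul_sum_sq.trans (Nat.mul_le_mul_left _ ?_)
  refine le_trans ?_ (card_pairs_mul_eq_le a hT)
  calc ∑ k ∈ B, (P.filter fun p => y p = k).card ^ 2
      = ∑ k ∈ B, ((P.filter fun p => y p = k) ×ˢ (P.filter fun p => y p = k)).card :=
        Finset.sum_congr rfl fun k _ => by rw [Finset.card_product, sq]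
    _ = (B.biUnion fun k => (P.filter fun p => y p = k) ×ˢ (P.filter fun p => y p = k)).card := by
        rw [Finset.card_biUnion]
        intro k _ k' _ hkk'
        rw [Function.onFun, Finset.disjoint_left]
        intro p hp hp'
        simp only [Finset.mem_product, Finset.mem_filter] at hp hp'
        exact hkk' (hp.1.2.symm.trans hp'.1.2)
    _ ≤ _ := by
        refine Finset.card_le_card_of_injOn
          (fun p : (ℕ × ℕ) × (ℕ × ℕ) => ((p.2.1, p.1.2), (p.1.1, p.2.2))) ?_ ?_
        · intro p hp
          obtain ⟨k, -, hk⟩ := Finset.mem_biUnion.1 (Finset.mem_coe.1 hp)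
          obtain ⟨hp1, hp2⟩ := Finset.mem_product.1 hk
          obtain ⟨hp1, hk1⟩ := Finset.mem_filter.1 hp1
          obtain ⟨hp2, hk2⟩ := Finset.mem_filter.1 hp2
          have m1 := Finset.mem_product.1 (hP hp1)
          have m2 := Finset.mem_product.1 (hP hp2)
          refine Finset.mem_coe.2 (Finset.mem_filter.2 ⟨Finset.mem_product.2
            ⟨Finset.mem_product.2 ⟨m2.1, m1.2⟩, Finset.mem_product.2 ⟨m1.1, m2.2⟩⟩, ?_⟩)
          have e1 := hy _ hp1
          have e2 := hy _ hp2
          rw [hk1] at e1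
          rw [hk2] at e2
          push_cast
          rw [← e1, ← e2]
          ring
        · intro p _ p' _ h
          simp only [Prod.mk.injEq] at h
          obtain ⟨⟨h1, h2⟩, h3, h4⟩ := h
          exact Prod.ext (Prod.ext h3 h2) (Prod.ext h1 h4)

end Burgess

section FiniteBurgess

theorem norm_sum_le_burgess {a b : ℕ} (hab : a.Coprime b) [NeZero a] [NeZero b]
    {χ : DirichletCharacter ℂ (a * b)} (hχ : IsLocallyPrimitive χ)
    (hfree : ∀ p : ℕ, p.Prime → ¬ p ^ 4 ∣ a) {u : ℕ} (hu : a.Coprime u) (hb : b ∣ u ^ 7)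
    {H r A N T : ℕ} (hH : 0 < H) {𝒜 : Finset ℕ}
    (hA : ∀ α ∈ 𝒜, α ∈ Finset.Icc 1 A ∧ α.Coprime (a * b))
    (hT : ∀ l ∈ Finset.Icc 1 (A * N), l.divisors.card ≤ T) {η : ℝ} (hη : 0 < η) :
    ∃ β : ℕ, (β : ℝ) * (η * H) ^ (2 * r) ≤
        H ^ 49 * (r ^ (2 * r) * H ^ r * a + (4 * r) ^ a.primeFactors.card * (a : ℝ) ^ (2 / 3 : ℝ) *
          (2 * r * (H * (2 * H * a.divisors.card) ^ (2 * r - 1)))) ∧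
      ‖∑ n ∈ Finset.range N, χ n‖ * 𝒜.card ≤
        𝒜.card * (2 * (u * A * H) + 1 + N * (η + 14 * Real.pi / H)) +
          √(β * (A * N * ((A * N / a + 1) * T))) := by
  classical
  obtain ⟨χ₁, χ₂, h12, hlp⟩ := exists_mul_decomposition hab χ
  obtain ⟨hl1, -⟩ := hlp hχ
  have hHr : (0 : ℝ) < H := by exact_mod_cast hH
  obtain ⟨𝒢, h𝒢card, h𝒢1, hnet⟩ := exists_phase_net 6 (pow_pos hH 7) hH
  set E : ℝ := 14 * Real.pi / H with hE
  have hE0 : 0 ≤ E := by positivity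
  have hEeq : ((6 : ℕ) + 1 : ℝ) * (H : ℝ) ^ 6 * (2 * Real.pi / ((H ^ 7 : ℕ) : ℝ)) = E := by
    rw [hE]; push_cast; field_simp; norm_num
  set M : ℝ := r ^ (2 * r) * H ^ r * a + (4 * r) ^ a.primeFactors.card * (a : ℝ) ^ (2 / 3 : ℝ) *
    (2 * r * (H * (2 * H * a.divisors.card) ^ (2 * r - 1))) with hM
  set B : Finset (ZMod a) := Finset.univ.filter fun y =>
    ∃ g ∈ 𝒢, η * H < ‖∑ h ∈ Finset.range H, g h * χ₁ (y + (u * h : ℕ))‖ with hB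
  refine ⟨B.card, ?_, ?_⟩
  · calc (B.card : ℝ) * (η * H) ^ (2 * r) = ∑ y ∈ B, (η * H) ^ (2 * r) := by
          rw [Finset.sum_const, nsmul_eq_mul]
      _ ≤ ∑ y ∈ B, ∑ g ∈ 𝒢, ‖∑ h ∈ Finset.range H, g h * χ₁ (y + (u * h : ℕ))‖ ^ (2 * r) := by
          refine Finset.sum_le_sum fun y hy => ?_
          obtain ⟨g, hg, hgy⟩ := (Finset.mem_filter.1 hy).2
          refine le_trans ?_ (Finset.single_le_sum (f := fun g : ℕ → ℂ =>
            ‖∑ h ∈ Finset.range H, g h * χ₁ (y + (u * h : ℕ))‖ ^ (2 * r))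
            (fun _ _ => by positivity) hg)
          exact pow_le_pow_left₀ (by positivity) hgy.le _
      _ ≤ ∑ g ∈ 𝒢, ∑ y : ZMod a, ‖∑ h ∈ Finset.range H, g h * χ₁ (y + (u * h : ℕ))‖ ^ (2 * r) := by
          rw [Finset.sum_comm]
          exact Finset.sum_le_sum fun g _ => Finset.sum_le_sum_of_subset_of_nonneg
            (Finset.subset_univ _) fun _ _ _ => by positivity
      _ ≤ ∑ g ∈ 𝒢, M := Finset.sum_le_sum fun g hg =>
          sum_norm_pow_le a hfree hl1 hu (h𝒢1 g hg) hH
      _ ≤ _ := by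
          rw [Finset.sum_const, nsmul_eq_mul]
          have : (𝒢.card : ℝ) ≤ H ^ 49 := by
            have h1 : (𝒢.card : ℝ) ≤ ((H ^ 7) ^ 7 : ℕ) := by exact_mod_cast h𝒢card
            refine h1.trans (le_of_eq ?_)
            push_cast
            ring
          have hM0 : 0 ≤ M := by positivity
          gcongr
  · set P := 𝒜 ×ˢ Finset.Icc 1 N with hP
    set x : ℕ × ℕ → ZMod (a * b) := fun p => (p.2 : ZMod (a * b)) * (p.1 : ZMod (a * b))⁻¹ with hx
    set y : ℕ × ℕ → ZMod a := fun p => ZMod.castHom (dvd_mul_right a b) (ZMod a) (x p) with hy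
    have hy1 : ∀ p ∈ P, y p * p.1 = p.2 := by
      intro p hp
      have hα := (hA p.1 (Finset.mem_product.1 hp).1).2
      have h1 : x p * p.1 = p.2 := by
        simp only [hx]
        rw [mul_assoc, mul_comm _ ((p.1 : ZMod (a * b))), ZMod.coe_mul_inv_eq_one _ hα, mul_one]
      have h2 := congrArg (ZMod.castHom (dvd_mul_right a b) (ZMod a)) h1
      rwa [map_mul, map_natCast, map_natCast] at h2
    have hsq := sq_card_filter_mem_le a hT (P := P) (fun p hp => by
      obtain ⟨h1, h2⟩ := Finset.mem_product.1 hp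
      exact Finset.mem_product.2 ⟨(hA _ h1).1, h2⟩) hy1 B
    set ν : ℕ := (P.filter fun p => y p ∈ B).card with hν
    have hνle : (ν : ℝ) ≤ √(B.card * (A * N * ((A * N / a + 1) * T))) := by
      refine Real.le_sqrt_of_sq_le ?_
      calc (ν : ℝ) ^ 2 ≤ ((B.card * (A * N * ((A * N / a + 1) * T)) : ℕ) : ℝ) := by
            exact_mod_cast hsq
        _ ≤ _ := by
            push_cast
            have : ((A * N / a : ℕ) : ℝ) ≤ (A * N : ℝ) / a := by
              exact_mod_cast Nat.cast_div_le (α := ℝ) (m := A * N) (n := a)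
            gcongr
    have hF : ∀ p ∈ P, ‖∑ h ∈ Finset.range H, χ (x p + (u * h : ℕ))‖ ≤
        H * (η + E) + if y p ∈ B then (H : ℝ) else 0 := by
      intro p hp
      split_ifs with hpB
      · refine (norm_sum_le_of_le _ fun h _ => DirichletCharacter.norm_le_one χ _).trans ?_
        rw [Finset.sum_const, Finset.card_range, nsmul_eq_mul, mul_one]
        have : 0 ≤ H * (η + E) := by positivity
        linarith
      · have hK : ∀ g ∈ 𝒢, ‖∑ h ∈ Finset.range H, g h * χ₁ (y p + (u * h : ℕ))‖ ≤ η * H := by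
          intro g hg
          by_contra! hlt
          exact hpB (Finset.mem_filter.2 ⟨Finset.mem_univ _, g, hg, hlt⟩)
        have h1 := norm_sum_mul_apply_add_le (D := 5) (u := u) hb hE0
          (fun ζ f hf hf1 => by
            obtain ⟨g, hg, hfg⟩ := hnet ζ f hf hf1
            exact ⟨g, hg, fun h hh => (hfg h hh).trans_eq hEeq⟩) χ₂
          (ZMod.castHom (dvd_mul_left b a) (ZMod b) (x p))
          (w := fun h => χ₁ (y p + (u * h : ℕ)))
          (fun h => DirichletCharacter.norm_le_one _ _) (by positivity) hK
        have h2 : ∑ h ∈ Finset.range H, χ (x p + (u * h : ℕ)) = ∑ h ∈ Finset.range H,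
            χ₁ (y p + (u * h : ℕ)) *
              χ₂ (ZMod.castHom (dvd_mul_left b a) (ZMod b) (x p) + (u * h : ℕ)) := by
          refine Finset.sum_congr rfl fun h _ => ?_
          rw [h12, RingHom.map_add, RingHom.map_add, map_natCast, map_natCast]
        rw [h2]
        refine h1.trans (le_of_eq ?_)
        ring
    have hmain := norm_sum_mul_card_le χ (𝒜 := 𝒜) (A := A)
      (fun α hα => ⟨(Finset.mem_Icc.1 (hA α hα).1).2, (hA α hα).2⟩) u H N
    have hsum : ∑ α ∈ 𝒜, ∑ n ∈ Finset.Icc 1 N,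
        ‖∑ h ∈ Finset.range H, χ ((n : ZMod (a * b)) * (α : ZMod (a * b))⁻¹ + (u * h : ℕ))‖ ≤
        𝒜.card * N * (H * (η + E)) + ν * H := by
      rw [← Finset.sum_product' (f := fun α n : ℕ =>
        ‖∑ h ∈ Finset.range H, χ ((n : ZMod (a * b)) * (α : ZMod (a * b))⁻¹ + (u * h : ℕ))‖)]
      refine (Finset.sum_le_sum hF).trans (le_of_eq ?_)
      rw [Finset.sum_add_distrib, Finset.sum_const, ← Finset.sum_filter, Finset.sum_const,
        nsmul_eq_mul, nsmul_eq_mul, hP, Finset.card_product, Nat.card_Icc, Nat.add_sub_cancel]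
      push_cast
      rfl
    have hfin := hmain.trans (add_le_add_right hsum _)
    refine le_of_mul_le_mul_right ?_ hHr
    nlinarith [mul_le_mul_of_nonneg_right hνle hHr.le]

end FiniteBurgess

section LargePart

theorem two_pow_card_primeFactors_le {n : ℕ} (hn : n ≠ 0) :
    2 ^ n.primeFactors.card ≤ n.divisors.card := by
  rw [Nat.card_divisors hn]
  refine Finset.pow_card_le_prod _ _ _ fun p hp => ?_
  have := (Nat.prime_of_mem_primeFactors hp).factorization_pos_of_dvd hn
    (Nat.dvd_of_mem_primeFactors hp)
  omega

theorem exists_moment_bound {η : ℝ} (hη : 0 < η) :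
    ∃ r : ℕ, 0 < r ∧ ∃ Q : ℝ, ∀ X : ℝ, Q ≤ X → ∀ a : ℕ, 0 < a → (a : ℝ) ≤ X → ∀ H : ℕ,
      X ^ η ≤ 2 * H →
      (r : ℝ) ^ (2 * r) * H ^ r * a + (4 * r) ^ a.primeFactors.card * (a : ℝ) ^ (2 / 3 : ℝ) *
        (2 * r * (H * (2 * H * a.divisors.card) ^ (2 * r - 1))) ≤
      H ^ (2 * r) * (a : ℝ) ^ (2 / 3 : ℝ) * X ^ η := by
  set r : ℕ := ⌈2 / η⌉₊ with hr
  have hr0 : 0 < r := Nat.ceil_pos.2 (by positivity)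
  set s : ℕ := 4 * r with hs
  have hs2 : (4 * r : ℝ) ≤ 2 ^ s := by
    have : 4 * r ≤ 2 ^ s := Nat.lt_two_pow_self.le
    exact_mod_cast this
  set k : ℕ := s + 2 * r with hk
  have hk0 : (0 : ℝ) < k := by
    have : 0 < k := by omega
    exact_mod_cast this
  obtain ⟨C, hC, hdiv⟩ := exists_card_divisors_le (show 0 < η / (2 * k) by positivity)
  set C' : ℝ := (r : ℝ) ^ (2 * r) + 2 * r * 2 ^ (2 * r - 1) with hC'
  obtain ⟨M₁, hM₁, hM₁'⟩ := exists_forall_mul_rpow_le (C' * C ^ k) (show η / 2 < η by linarith)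
  obtain ⟨M₂, hM₂, hM₂'⟩ := exists_forall_mul_rpow_le 2 (show η / 2 < η by linarith)
  refine ⟨r, hr0, max M₁ M₂, fun X hX a ha haX H hH => ?_⟩
  have hX1 : 1 ≤ X := hM₁.trans ((le_max_left _ _).trans hX)
  have hX0 : 0 < X := by linarith
  have hconst := hM₁' X ((le_max_left _ _).trans hX)
  have htwo := hM₂' X ((le_max_right _ _).trans hX)
  have hHX : X ^ (η / 2) ≤ H := by linarith
  have hHr : X ≤ (H : ℝ) ^ r := by
    calc X = X ^ (1 : ℝ) := (Real.rpow_one X).symm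
      _ ≤ X ^ (η / 2 * r) := by
          refine Real.rpow_le_rpow_of_exponent_le hX1 ?_
          have h1 : 2 / η ≤ r := Nat.le_ceil _
          rw [div_le_iff₀ hη] at h1
          linarith
      _ = (X ^ (η / 2)) ^ r := by rw [Real.rpow_mul hX0.le, Real.rpow_natCast]
      _ ≤ _ := pow_le_pow_left₀ (by positivity) hHX r
  have ha1 : (1 : ℝ) ≤ a := by exact_mod_cast ha
  set α : ℝ := (a : ℝ) ^ (2 / 3 : ℝ) with hα
  have hα1 : 1 ≤ α := Real.one_le_rpow ha1 (by norm_num)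
  set τ : ℝ := (a.divisors.card : ℝ) with hτ
  have hτ1 : 1 ≤ τ := Nat.one_le_cast.2 (Finset.card_pos.2 ⟨1, Nat.one_mem_divisors.2 ha.ne'⟩)
  have hω : (4 * r : ℝ) ^ a.primeFactors.card ≤ τ ^ s := by
    calc (4 * r : ℝ) ^ a.primeFactors.card ≤ (2 ^ s) ^ a.primeFactors.card := by gcongr
      _ = (2 ^ a.primeFactors.card) ^ s := by rw [← pow_mul, ← pow_mul, mul_comm]
      _ ≤ τ ^ s := by
          have : (2 : ℝ) ^ a.primeFactors.card ≤ τ := by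
            rw [hτ]; exact_mod_cast two_pow_card_primeFactors_le ha.ne'
          gcongr
  have hτk : τ ^ k ≤ C ^ k * X ^ (η / 2) := by
    calc τ ^ k ≤ (C * X ^ (η / (2 * k))) ^ k := by
          have h1 := hdiv a ha.ne'
          have h2 : (a : ℝ) ^ (η / (2 * k)) ≤ X ^ (η / (2 * k)) := by gcongr
          have h3 : τ ≤ C * X ^ (η / (2 * k)) := h1.trans (by gcongr)
          gcongr
      _ = C ^ k * X ^ (η / 2) := by
          rw [mul_pow, ← Real.rpow_natCast (X ^ _), ← Real.rpow_mul hX0.le]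
          congr 2
          field_simp
  have hHH : (H : ℝ) ^ (2 * r) = H ^ r * H ^ r := by rw [two_mul, pow_add]
  have hHs : (H : ℝ) * (2 * H * τ) ^ (2 * r - 1) = H ^ (2 * r) * (2 ^ (2 * r - 1) * τ ^ (2 * r - 1)) := by
    obtain ⟨j, hj⟩ : ∃ j, 2 * r = j + 1 := ⟨2 * r - 1, by omega⟩
    rw [hj, Nat.add_sub_cancel, mul_pow, mul_pow, pow_succ]
    ring
  have h1 : (r : ℝ) ^ (2 * r) * H ^ r * a ≤ H ^ (2 * r) * α * (r ^ (2 * r) * τ ^ k) := by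
    have h2 : (a : ℝ) ≤ H ^ r := haX.trans hHr
    calc (r : ℝ) ^ (2 * r) * H ^ r * a ≤ (r : ℝ) ^ (2 * r) * H ^ r * H ^ r := by gcongr
      _ = H ^ (2 * r) * 1 * (r ^ (2 * r) * 1) := by rw [hHH]; ring
      _ ≤ _ := by gcongr; exact one_le_pow₀ hτ1
  have h2 : (4 * r : ℝ) ^ a.primeFactors.card * α * (2 * r * (H * (2 * H * τ) ^ (2 * r - 1))) ≤
      H ^ (2 * r) * α * (2 * r * 2 ^ (2 * r - 1) * τ ^ k) := by
    rw [hHs]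
    calc _ ≤ τ ^ s * α * (2 * r * (H ^ (2 * r) * (2 ^ (2 * r - 1) * τ ^ (2 * r - 1)))) := by gcongr
      _ = H ^ (2 * r) * α * (2 * r * 2 ^ (2 * r - 1) * (τ ^ s * τ ^ (2 * r - 1))) := by ring
      _ ≤ _ := by
          rw [← pow_add]
          gcongr
          omega
  calc _ ≤ H ^ (2 * r) * α * (r ^ (2 * r) * τ ^ k) +
        H ^ (2 * r) * α * (2 * r * 2 ^ (2 * r - 1) * τ ^ k) := add_le_add h1 h2
    _ = H ^ (2 * r) * α * (C' * τ ^ k) := by rw [hC']; ring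
    _ ≤ H ^ (2 * r) * α * (C' * (C ^ k * X ^ (η / 2))) := by gcongr
    _ ≤ _ := by
        rw [← mul_assoc C']
        gcongr

set_option maxHeartbeats 1000000 in
theorem norm_sum_le_of_large_part {ε : ℝ} (hε : 0 < ε) :
    ∃ δ : ℝ, 0 < δ ∧ ∃ Q : ℝ, ∀ (a b : ℕ) [NeZero a] [NeZero b], a.Coprime b →
      ∀ χ : DirichletCharacter ℂ (a * b), IsLocallyPrimitive χ →
      (∀ p : ℕ, p.Prime → ¬ p ^ 4 ∣ a) → ∀ u : ℕ, a.Coprime u → u ^ 4 ∣ b → b ∣ u ^ 7 →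
      Q ≤ (a * b : ℕ) → ((a * b : ℕ) : ℝ) ^ (ε / 100) ≤ a →
      ∀ N : ℕ, ((a * b : ℕ) : ℝ) ^ (1 / 3 + ε) ≤ N → (N : ℝ) ≤ ((a * b : ℕ) : ℝ) ^ 2 →
      ‖∑ n ∈ Finset.range N, χ n‖ ≤ N * ((a * b : ℕ) : ℝ) ^ (-δ) := by
  set η : ℝ := ε / 20000 with hη
  have hη0 : 0 < η := by positivity
  obtain ⟨r, hr, Q₁, hmom⟩ := exists_moment_bound hη0
  obtain ⟨Q₂, hcop⟩ := exists_card_coprime_ge hη0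
  obtain ⟨C, hC, hdiv⟩ := exists_card_divisors_le (show 0 < η / 8 by positivity)
  obtain ⟨Q₃, hQ₃, hQ₃'⟩ := exists_forall_mul_rpow_le C (show η / 2 < η by linarith)
  obtain ⟨Q₄, -, hQ₄⟩ := exists_forall_mul_rpow_le 1000 hη0
  have hrr : (1 : ℝ) ≤ r := by exact_mod_cast hr
  set δ : ℝ := η / (2 * r) with hδ
  have hδ0 : 0 < δ := by positivity
  have hδη : δ ≤ η := div_le_self hη0.le (by linarith)
  obtain ⟨Q₅, -, hQ₅⟩ := exists_forall_mul_rpow_le 101 (show -δ < -(δ / 2) by linarith)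
  refine ⟨δ / 2, by positivity, max Q₁ (max Q₂ (max Q₃ (max Q₄ Q₅))), ?_⟩
  intro a b _ _ hab χ hχ hfree u hau hub hbu hQ ha N hN hN2
  simp only [max_le_iff] at hQ
  obtain ⟨hX₁, hX₂, hX₃, hX₄, hX₅⟩ := hQ
  have hcop := hcop (a * b) hX₂
  set X : ℝ := ((a * b : ℕ) : ℝ) with hX
  have hX1 : 1 ≤ X := hQ₃.trans hX₃
  have hX0 : 0 < X := by linarith
  have hQ₃' := hQ₃' X hX₃
  have hQ₄ := hQ₄ X hX₄
  have hQ₅ := hQ₅ X hX₅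
  rw [Real.rpow_zero, mul_one] at hQ₄
  set Y : ℝ := X ^ η with hY
  have hYpow : ∀ k : ℕ, Y ^ k = X ^ (η * k) := fun k => by
    rw [hY, ← Real.rpow_natCast, ← Real.rpow_mul hX0.le]
  have hY0 : 0 < Y := by linarith
  have ha0 : 0 < a := Nat.pos_of_neZero a
  have hb0 : 0 < b := Nat.pos_of_neZero b
  have hu0 : 0 < u := by
    rcases Nat.eq_zero_or_pos u with rfl | h
    · simp at hub; omega
    · exact h
  have hu1 : (1 : ℝ) ≤ u := by exact_mod_cast hu0
  have haX : (a : ℝ) ≤ X := by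
    rw [hX]; exact_mod_cast Nat.le_mul_of_pos_right a hb0
  have hauX : (a : ℝ) * u ^ 4 ≤ X := by
    rw [hX]; exact_mod_cast Nat.mul_le_mul_left a (Nat.le_of_dvd hb0 hub)
  have har : (1 : ℝ) ≤ a := by exact_mod_cast ha0
  set x : ℝ := X ^ (1 / 3 : ℝ) with hx
  have hx0 : 0 < x := by positivity
  have hx3 : x ^ 3 = X := by
    rw [hx, ← Real.rpow_natCast, ← Real.rpow_mul hX0.le]; norm_num
  set α : ℝ := (a : ℝ) ^ (1 / 3 : ℝ) with hα
  have hα0 : 0 < α := by positivity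
  have hα3 : α ^ 3 = a := by
    rw [hα, ← Real.rpow_natCast, ← Real.rpow_mul (by positivity)]; norm_num
  have hα2 : (a : ℝ) ^ (2 / 3 : ℝ) = α ^ 2 := by
    rw [hα, ← Real.rpow_natCast, ← Real.rpow_mul (by positivity)]; norm_num
  obtain ⟨Z, hZ⟩ : ∃ Z, Z = Y ^ 56 := ⟨_, rfl⟩
  have hZ0 : 0 < Z := hZ ▸ pow_pos hY0 56
  have hαY : Y * Z ≤ α := by
    have h1 : (Y * Z) ^ 3 ≤ α ^ 3 := by
      rw [hα3]
      refine le_trans ?_ ha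
      rw [hZ, ← pow_succ', ← pow_mul, hYpow]
      refine Real.rpow_le_rpow_of_exponent_le hX1 ?_
      rw [hη]; push_cast; linarith
    exact le_of_pow_le_pow_left₀ (by norm_num) hα0.le h1
  have hux : (u : ℝ) ≤ x := by
    refine le_of_pow_le_pow_left₀ (n := 3) (by norm_num) hx0.le ?_
    rw [hx3]
    refine le_trans ?_ hauX
    calc (u : ℝ) ^ 3 ≤ u ^ 4 := pow_le_pow_right₀ hu1 (by norm_num)
      _ ≤ a * u ^ 4 := le_mul_of_one_le_left (by positivity) har
  have hαux : α ^ 2 * u ≤ x ^ 2 := by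
    refine le_of_pow_le_pow_left₀ (n := 3) (by norm_num) (by positivity) ?_
    calc (α ^ 2 * u) ^ 3 = (α ^ 3) ^ 2 * u ^ 3 := by ring
      _ ≤ (α ^ 3) ^ 2 * u ^ 8 := by gcongr; norm_num
      _ = (a * u ^ 4) ^ 2 := by rw [hα3]; ring
      _ ≤ X ^ 2 := by gcongr
      _ = (x ^ 2) ^ 3 := by rw [← hx3]; ring
  have hNx : x * (Y * Z) ≤ N := by
    refine le_trans ?_ hN
    rw [hZ, ← pow_succ', hYpow, hx, ← Real.rpow_add hX0]
    refine Real.rpow_le_rpow_of_exponent_le hX1 ?_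
    rw [hη]; push_cast; linarith
  have hZY : Y ^ 3 ≤ Z := by
    rw [hZ]; exact pow_le_pow_right₀ (by linarith) (by norm_num)
  have hNr : 0 < (N : ℝ) := lt_of_lt_of_le (by positivity) hNx
  have hx1 : 1 ≤ x := hu1.trans hux
  set A : ℕ := ⌊(N : ℝ) / (Y ^ 3 * u)⌋₊ with hA
  have hA1 : (A : ℝ) * (Y ^ 3 * u) ≤ N := by
    rw [← le_div_iff₀ (by positivity)]
    exact Nat.floor_le (by positivity)
  have hdiv1 : 1 ≤ (N : ℝ) / (Y ^ 3 * u) := by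
    rw [le_div_iff₀ (by positivity), one_mul]
    calc Y ^ 3 * u ≤ Z * x := by gcongr
      _ = x * (1 * Z) := by ring
      _ ≤ x * (Y * Z) := by gcongr; linarith
      _ ≤ N := hNx
  have hA0 : 0 < A := Nat.floor_pos.2 hdiv1
  have hAr : (1 : ℝ) ≤ A := by exact_mod_cast hA0
  have hA2 : (N : ℝ) ≤ 2 * A * (Y ^ 3 * u) := by
    rw [← div_le_iff₀ (by positivity)]
    have := Nat.lt_floor_add_one ((N : ℝ) / (Y ^ 3 * u))
    rw [← hA] at this
    linarith
  have hAN : (A : ℝ) ≤ N := by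
    refine le_trans ?_ hA1
    refine le_mul_of_one_le_right (by positivity) ?_
    exact one_le_mul_of_one_le_of_one_le (one_le_pow₀ (by linarith)) hu1
  set H : ℕ := ⌊Y⌋₊ with hH
  have hHY : (H : ℝ) ≤ Y := Nat.floor_le hY0.le
  have hYH : Y ≤ 2 * H := by
    have := Nat.lt_floor_add_one Y
    rw [← hH] at this
    linarith
  have hH0 : 0 < H := Nat.floor_pos.2 (by linarith)
  have hHr : (0 : ℝ) < H := by exact_mod_cast hH0
  set T : ℕ := ⌊Y⌋₊ with hT
  set 𝒜 : Finset ℕ := (Finset.Icc 1 A).filter fun n => n.Coprime (a * b) with h𝒜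
  have hcard : (A : ℝ) ≤ 𝒜.card * Y := by
    have := hcop A hA0
    rwa [Real.rpow_neg hX0.le, ← div_eq_mul_inv, div_le_iff₀ hY0] at this
  have hTdiv : ∀ l ∈ Finset.Icc 1 (A * N), l.divisors.card ≤ T := by
    intro l hl
    rw [Finset.mem_Icc] at hl
    refine Nat.le_floor ((hdiv l (by omega)).trans (le_trans ?_ hQ₃'))
    have h1 : (l : ℝ) ≤ X ^ (4 : ℝ) := by
      calc (l : ℝ) ≤ A * N := by exact_mod_cast hl.2
        _ ≤ X ^ 2 * X ^ 2 := mul_le_mul (hAN.trans hN2) hN2 hNr.le (by positivity)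
        _ = X ^ (4 : ℝ) := by rw [← pow_add]; exact (Real.rpow_natCast X 4).symm
    have h2 : (l : ℝ) ^ (η / 8) ≤ X ^ (η / 2) := by
      calc (l : ℝ) ^ (η / 8) ≤ (X ^ (4 : ℝ)) ^ (η / 8) := by gcongr
        _ = X ^ (η / 2) := by rw [← Real.rpow_mul hX0.le]; congr 1; ring
    gcongr
  set θ : ℝ := X ^ (-δ) with hθ
  have hθ0 : 0 < θ := by positivity
  have hθr : θ ^ (2 * r) * Y = 1 := by
    rw [hθ, ← Real.rpow_natCast, ← Real.rpow_mul hX0.le, hY, ← Real.rpow_add hX0, hδ]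
    convert Real.rpow_zero X using 2
    push_cast
    field_simp
    ring
  have hθY : 1 ≤ θ * Y := by
    rw [hθ, hY, ← Real.rpow_add hX0]
    exact Real.one_le_rpow hX1 (by linarith)
  obtain ⟨β, hβ, hS⟩ := norm_sum_le_burgess hab hχ hfree hau hbu (H := H) (r := r) (A := A) (N := N)
    (T := T) hH0 (𝒜 := 𝒜) (fun α hα => Finset.mem_filter.1 hα) hTdiv hθ0
  have hm := hmom X hX₁ a ha0 haX H hYH
  rw [hα2] at hm
  have hTY : (T : ℝ) ≤ Y := hHY
  obtain ⟨W, hW⟩ : ∃ W : ℝ, W = (H : ℝ) ^ 49 := ⟨_, rfl⟩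
  obtain ⟨G, hG⟩ : ∃ G : ℝ, G = (H : ℝ) ^ (2 * r) := ⟨_, rfl⟩
  obtain ⟨K, hK⟩ : ∃ K : ℝ, K = θ ^ (2 * r) := ⟨_, rfl⟩
  have hG0 : 0 < G := hG ▸ pow_pos hHr _
  have hK0 : 0 < K := hK ▸ pow_pos hθ0 _
  have hW0 : 0 < W := by rw [hW]; positivity
  have hWY : W * Y ^ 7 ≤ Z := by
    have h1 : W ≤ Y ^ 49 := by rw [hW]; exact pow_le_pow_left₀ hHr.le hHY 49
    calc W * Y ^ 7 ≤ Y ^ 49 * Y ^ 7 := mul_le_mul_of_nonneg_right h1 (pow_pos hY0 7).le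
      _ = Z := by rw [hZ, ← pow_add]
  have hβ' : (β : ℝ) * T * Y ^ 4 ≤ Z * α ^ 2 := by
    have h1 : (β : ℝ) * (K * G) ≤ W * (G * α ^ 2 * Y) := by
      rw [hK, hG, hW, ← mul_pow]
      rw [← hα2, hY]
      rw [← hα2] at hm
      exact hβ.trans (mul_le_mul_of_nonneg_left hm (pow_pos hHr _).le)
    rw [← hK] at hθr
    have h2 : (β : ℝ) ≤ W * α ^ 2 * Y ^ 2 := by
      refine le_of_mul_le_mul_right ?_ hG0
      calc (β : ℝ) * G = β * (K * G) * Y := by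
            linear_combination (-(β : ℝ) * G) * hθr
        _ ≤ W * (G * α ^ 2 * Y) * Y := mul_le_mul_of_nonneg_right h1 hY0.le
        _ = _ := by ring
    calc (β : ℝ) * T * Y ^ 4 ≤ (W * α ^ 2 * Y ^ 2) * Y * Y ^ 4 := by
          refine mul_le_mul_of_nonneg_right ?_ (pow_pos hY0 4).le
          exact mul_le_mul h2 hTY (Nat.cast_nonneg _) (by positivity)
      _ = W * Y ^ 7 * α ^ 2 := by ring
      _ ≤ Z * α ^ 2 := mul_le_mul_of_nonneg_right hWY (pow_pos hα0 2).le
  have hAN0 : (0 : ℝ) < A * N := by positivity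
  have hV1 : 2 * (β * T * Y ^ 4) ≤ (a : ℝ) := by
    rw [← hα3]
    calc 2 * (β * T * Y ^ 4) ≤ Y * (Z * α ^ 2) := by gcongr; linarith
      _ = Y * Z * α ^ 2 := by ring
      _ ≤ α * α ^ 2 := by gcongr
      _ = α ^ 3 := by ring
  have hV2 : 2 * (β * T * Y ^ 4) ≤ (A * N : ℝ) := by
    refine le_of_mul_le_mul_right ?_ (show 0 < 2 * (Y ^ 3 * u) by positivity)
    calc 2 * (β * T * Y ^ 4) * (2 * (Y ^ 3 * u)) ≤ 2 * (Z * α ^ 2) * (2 * (Z * u)) := by gcongr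
      _ = 2 * 2 * (Z * Z) * (α ^ 2 * u) := by ring
      _ ≤ Y * Y * (Z * Z) * x ^ 2 := by gcongr <;> linarith
      _ = (x * (Y * Z)) * (x * (Y * Z)) := by ring
      _ ≤ N * (2 * A * (Y ^ 3 * u)) := by
          refine mul_le_mul hNx (hNx.trans hA2) (by positivity) hNr.le
      _ = _ := by ring
  have hsqrt : √(β * (A * N * ((A * N / a + 1) * T))) ≤ A * N / Y ^ 2 := by
    refine Real.sqrt_le_iff.2 ⟨by positivity, ?_⟩
    rw [div_pow, ← pow_mul, le_div_iff₀ (by positivity)]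
    have ha' : (0 : ℝ) < a := by linarith
    have h1 : β * (T * Y ^ 4) * (A * N / a) ≤ A * N / 2 := by
      rw [mul_div_assoc', div_le_div_iff₀ ha' (by norm_num)]
      linear_combination (A * N : ℝ) * hV1
    calc (β * (A * N * ((A * N / a + 1) * T)) * Y ^ (2 * 2) : ℝ) =
          A * N * (β * (T * Y ^ 4) * (A * N / a) + β * T * Y ^ 4) := by ring
      _ ≤ A * N * (A * N / 2 + A * N / 2) := by gcongr; linarith
      _ = _ := by ring
  have hc0 : (0 : ℝ) < 𝒜.card := by
    refine (pos_iff_pos_of_mul_pos (lt_of_lt_of_le (zero_lt_one.trans_le hAr) hcard)).2 hY0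
  have hfin : ‖∑ n ∈ Finset.range N, χ n‖ ≤
      2 * (u * A * H) + 1 + N * (θ + 14 * Real.pi / H) + N / Y := by
    refine le_of_mul_le_mul_right ?_ hc0
    refine hS.trans ?_
    have h1 : (A : ℝ) * N / Y ^ 2 ≤ N / Y * 𝒜.card := by
      rw [div_mul_eq_mul_div, div_le_div_iff₀ (by positivity) hY0]
      linear_combination (N : ℝ) * Y * hcard
    linarith
  have hNY : (N : ℝ) / Y ≤ N * θ := by
    rw [div_le_iff₀ hY0]
    linear_combination (N : ℝ) * hθY
  have h1 : (u * A * H : ℝ) ≤ N / Y := by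
    rw [le_div_iff₀ hY0]
    calc (u * A * H : ℝ) * Y ≤ u * A * Y * Y := by gcongr
      _ = A * (Y ^ 2 * u) := by ring
      _ ≤ A * (Y ^ 3 * u) := by
          gcongr
          · linarith
          · norm_num
      _ ≤ N := hA1
  have h2 : (1 : ℝ) ≤ N / Y := by
    rw [le_div_iff₀ hY0, one_mul]
    refine le_trans ?_ hA1
    calc Y ≤ Y ^ 3 := le_self_pow₀ (by linarith) (by norm_num)
      _ = 1 * (Y ^ 3 * 1) := by ring
      _ ≤ A * (Y ^ 3 * u) := by gcongr
  have h3 : N * (14 * Real.pi / H) ≤ 96 * (N / Y) := by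
    rw [mul_div_assoc', mul_div_assoc', div_le_div_iff₀ hHr hY0]
    have hpi : 14 * Real.pi ≤ 48 := by linarith [Real.pi_lt_d2]
    calc (N : ℝ) * (14 * Real.pi) * Y ≤ N * 48 * (2 * H) := by gcongr
      _ = _ := by ring
  calc _ ≤ N * (101 * θ) := by linarith
    _ ≤ _ := by gcongr

end LargePart

section PrimitiveSum

theorem sum_Icc_one_eq_sum_range {R : Type*} [AddCommMonoid R] (f : ℕ → R) (hf : f 0 = 0) (N : ℕ) :
    ∑ n ∈ Finset.Icc 1 N, f n = ∑ n ∈ Finset.range (N + 1), f n := by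
  rw [Finset.range_eq_Ico, Finset.sum_eq_sum_Ico_succ_bot (Nat.succ_pos N), hf, zero_add]
  rfl

theorem norm_sum_primitive_le {ε : ℝ} (hε : 0 < ε) :
    ∃ δ : ℝ, 0 < δ ∧ ∃ Q : ℝ, ∀ (q : ℕ) [NeZero q], Q ≤ q → ∀ χ : DirichletCharacter ℂ q,
      χ.IsPrimitive → ∀ N : ℕ, (q : ℝ) ^ (1 / 3 + ε) ≤ N → (N : ℝ) < (q : ℝ) ^ 2 →
      ‖∑ n ∈ Finset.Icc 1 N, χ n‖ ≤ N * (q : ℝ) ^ (-δ) := by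
  set ε' : ℝ := min ε (1 / 2) with hε'
  have hε0 : 0 < ε' := by positivity
  obtain ⟨Q₁, h₁⟩ := norm_sum_le_of_small_part hε0 (min_le_right _ _)
  obtain ⟨δ₂, hδ₂, Q₂, h₂⟩ := norm_sum_le_of_large_part hε0
  set δ : ℝ := min (ε' / 20000000) δ₂ with hδ
  have hδ0 : 0 < δ := by positivity
  obtain ⟨Q₃, -, h₃⟩ := exists_forall_mul_rpow_le 6 (show -δ < -(δ / 2) by linarith)
  refine ⟨δ / 2, by positivity, max 2 (max Q₁ (max Q₂ Q₃)), ?_⟩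
  intro q hq0 hQ χ hχ N hN hN2
  simp only [max_le_iff] at hQ
  obtain ⟨hq2, hQ₁, hQ₂, hQ₃⟩ := hQ
  have h₃ := h₃ q hQ₃
  have hq1 : (1 : ℝ) ≤ q := by linarith
  have hqq : 1 < q := by exact_mod_cast (show (1 : ℝ) < q by linarith)
  have hlp := IsLocallyPrimitive.of_isPrimitive hχ
  have hN' : (q : ℝ) ^ (1 / 3 + ε') ≤ N :=
    le_trans (Real.rpow_le_rpow_of_exponent_le hq1 (by linarith [min_le_left ε (1 / 2)])) hN
  have hNpos : (1 : ℝ) ≤ N := (Real.one_le_rpow hq1 (by linarith)).trans hN'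
  have hN1 : (q : ℝ) ^ (1 / 3 + ε') ≤ (N + 1 : ℕ) := by push_cast; linarith
  have hN21 : ((N + 1 : ℕ) : ℝ) ≤ (q : ℝ) ^ 2 := by
    exact_mod_cast (show N + 1 ≤ q ^ 2 from by exact_mod_cast hN2)
  have key : ‖∑ n ∈ Finset.range (N + 1), χ n‖ ≤ 3 * (((N + 1 : ℕ) : ℝ) * (q : ℝ) ^ (-δ)) := by
    obtain ⟨a, b, u, hab, hcop, hau, hub, hbu, hfree⟩ :=
      exists_fourth_power_free_decomposition q (NeZero.pos q)
    rcases le_total (a : ℝ) ((q : ℝ) ^ (ε' / 100)) with ha | ha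
    · refine (h₁ q hQ₁ χ hlp a u (hab ▸ Nat.mul_dvd_mul_left a hub)
        (hab ▸ Nat.mul_dvd_mul_left a hbu) ha (N + 1) hN1).trans ?_
      gcongr
      exact min_le_left _ _
    · subst hab
      have : NeZero a := ⟨fun h => hq0.out (by simp [h])⟩
      have : NeZero b := ⟨fun h => hq0.out (by simp [h])⟩
      refine (h₂ a b hcop χ hlp hfree u hau hub hbu hQ₂ ha (N + 1) hN1 hN21).trans ?_
      have h4 : ((a * b : ℕ) : ℝ) ^ (-δ₂) ≤ ((a * b : ℕ) : ℝ) ^ (-δ) :=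
        Real.rpow_le_rpow_of_exponent_le hq1 (neg_le_neg (min_le_right _ _))
      have h5 : (0 : ℝ) ≤ ((N + 1 : ℕ) : ℝ) * ((a * b : ℕ) : ℝ) ^ (-δ) := by positivity
      calc _ ≤ ((N + 1 : ℕ) : ℝ) * ((a * b : ℕ) : ℝ) ^ (-δ) := by gcongr
        _ ≤ _ := by linarith
  rw [sum_Icc_one_eq_sum_range _ (by simpa using χ.map_zero' hqq.ne')]
  refine key.trans ?_
  have h6 : 0 ≤ (q : ℝ) ^ (-δ) := by positivity
  calc 3 * (((N + 1 : ℕ) : ℝ) * (q : ℝ) ^ (-δ)) ≤ 3 * ((2 * N : ℝ) * (q : ℝ) ^ (-δ)) := by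
        gcongr; push_cast; linarith
    _ = N * (6 * (q : ℝ) ^ (-δ)) := by ring
    _ ≤ _ := by gcongr

end PrimitiveSum

section Imprimitive

open ArithmeticFunction in
theorem sum_coprime_eq_sum_moebius {R : Type*} [CommRing R] (f : ℕ → R) {m : ℕ} (hm : m ≠ 0)
    (N : ℕ) :
    ∑ n ∈ (Finset.Icc 1 N).filter (·.Coprime m), f n =
      ∑ d ∈ m.divisors, (moebius d : R) * ∑ k ∈ Finset.Icc 1 (N / d), f (d * k) := by
  have h1 : ∀ n ∈ Finset.Icc 1 N, (if n.Coprime m then f n else 0) =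
      ∑ d ∈ m.divisors, if d ∣ n then (moebius d : R) * f n else 0 := by
    intro n hn
    have hn0 : n ≠ 0 := by have := Finset.mem_Icc.1 hn; omega
    have h2 := congrArg (fun f : ArithmeticFunction ℤ => f (n.gcd m)) moebius_mul_coe_zeta
    simp only [coe_mul_zeta_apply, one_apply] at h2
    have h3 : m.divisors.filter (fun d => d ∣ n) = (n.gcd m).divisors := by
      ext d
      simp only [Finset.mem_filter, Nat.mem_divisors, Nat.dvd_gcd_iff]
      have : n.gcd m ≠ 0 := Nat.gcd_ne_zero_left hn0
      tauto
    rw [← Finset.sum_filter, h3, ← Finset.sum_mul, ← Int.cast_sum, h2]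
    by_cases h : n.gcd m = 1
    · simp [Nat.Coprime, h]
    · simp [Nat.Coprime, h]
  rw [Finset.sum_filter, Finset.sum_congr rfl h1, Finset.sum_comm]
  refine Finset.sum_congr rfl fun d hd => ?_
  have hd0 : 0 < d := Nat.pos_of_mem_divisors hd
  rw [← Finset.sum_filter, ← Finset.mul_sum]
  congr 1
  refine Finset.sum_nbij' (fun n => n / d) (fun k => d * k) ?_ ?_ ?_ ?_ ?_
  · intro n hn
    simp only [Finset.mem_filter, Finset.mem_Icc] at hn ⊢
    exact ⟨Nat.div_pos (Nat.le_of_dvd (by omega) hn.2) hd0, Nat.div_le_div_right hn.1.2⟩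
  · intro k hk
    simp only [Finset.mem_filter, Finset.mem_Icc] at hk ⊢
    exact ⟨⟨Nat.mul_pos hd0 hk.1, by
      rw [mul_comm]; exact (Nat.le_div_iff_mul_le hd0).1 hk.2⟩, dvd_mul_right _ _⟩
  · intro n hn
    exact Nat.mul_div_cancel' (Finset.mem_filter.1 hn).2
  · intro k _
    exact Nat.mul_div_cancel_left _ hd0
  · intro n hn
    rw [Nat.mul_div_cancel' (Finset.mem_filter.1 hn).2]

theorem sum_range_level_eq_zero {q : ℕ} [NeZero q] {χ : DirichletCharacter ℂ q} (hχ : χ ≠ 1) :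
    ∑ n ∈ Finset.range q, χ n = 0 := by
  rw [← MulChar.sum_eq_zero_of_ne_one hχ]
  refine Finset.sum_nbij' (fun n => (n : ZMod q)) ZMod.val (by simp) ?_ ?_ (by simp) (by simp)
  · intro x _
    exact Finset.mem_range.2 x.val_lt
  · intro n hn
    exact ZMod.val_cast_of_lt (Finset.mem_range.1 hn)

theorem norm_sum_Icc_le_level {q : ℕ} [NeZero q] {χ : DirichletCharacter ℂ q} (hχ : χ ≠ 1)
    (N : ℕ) : ‖∑ n ∈ Finset.Icc 1 N, χ n‖ ≤ q := by
  have hq1 : q ≠ 1 := by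
    rintro rfl
    exact hχ (DirichletCharacter.level_one χ)
  rw [sum_Icc_one_eq_sum_range _ (by simpa using χ.map_zero' hq1)]
  have h0 : ∀ t : ℕ, ∑ n ∈ Finset.range (q * t), χ n = 0 := by
    intro t
    induction t with
    | zero => simp
    | succ t ih =>
      rw [Nat.mul_succ, Finset.sum_range_add, ih, zero_add]
      simpa using sum_range_level_eq_zero hχ
  rw [← Nat.div_add_mod (N + 1) q, Finset.sum_range_add, h0, zero_add]
  refine (norm_sum_le_of_le _ fun i _ => χ.norm_le_one _).trans ?_
  simpa using (Nat.mod_lt _ (NeZero.pos q)).le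

theorem norm_sum_Icc_le_primitiveCharacter {m : ℕ} [NeZero m] (χ : DirichletCharacter ℂ m) (N : ℕ) :
    ‖∑ n ∈ Finset.Icc 1 N, χ n‖ ≤
      ∑ d ∈ m.divisors, ‖∑ k ∈ Finset.Icc 1 (N / d), χ.primitiveCharacter k‖ := by
  have h1 : ∑ n ∈ Finset.Icc 1 N, χ n =
      ∑ n ∈ (Finset.Icc 1 N).filter (·.Coprime m), χ.primitiveCharacter n := by
    rw [Finset.sum_filter]
    refine Finset.sum_congr rfl fun n _ => ?_
    split_ifs with h
    · have := χ.primitiveCharacter_apply_of_isCoprime (a := n) (Nat.isCoprime_iff_coprime.2 h)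
      simpa using this.symm
    · exact χ.map_nonunit (by rwa [ZMod.isUnit_iff_coprime])
  rw [h1, sum_coprime_eq_sum_moebius _ (NeZero.ne m)]
  refine (norm_sum_le _ _).trans (Finset.sum_le_sum fun d _ => ?_)
  simp only [Nat.cast_mul, map_mul, ← Finset.mul_sum, norm_mul]
  have h2 : ‖((ArithmeticFunction.moebius d : ℤ) : ℂ)‖ ≤ 1 := by
    rw [Complex.norm_intCast]
    exact_mod_cast ArithmeticFunction.abs_moebius_le_one
  have h3 := χ.primitiveCharacter.norm_le_one (d : ZMod χ.conductor)
  calc _ ≤ (1 : ℝ) * (1 * _) := by gcongr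
    _ = _ := by ring

end Imprimitive

section NonprincipalSum

theorem norm_sum_dirichletCharacter_le {ε : ℝ} (hε : 0 < ε) :
    ∃ δ : ℝ, 0 < δ ∧ ∃ M : ℝ, ∀ (m : ℕ) [NeZero m], M ≤ m → ∀ χ : DirichletCharacter ℂ m,
      χ ≠ 1 → ∀ N : ℕ, (m : ℝ) ^ (1 / 3 + ε) ≤ N → (N : ℝ) ≤ (m : ℝ) ^ (2 / 3 : ℝ) →
      ‖∑ n ∈ Finset.Icc 1 N, χ n‖ ≤ N * (m : ℝ) ^ (-δ) := by
  obtain ⟨δ₁, hδ₁, Q, hprim⟩ := norm_sum_primitive_le (show 0 < ε / 4 by positivity)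
  set δ : ℝ := min (ε / 2) (δ₁ / 3) with hδ
  have hδ0 : 0 < δ := by positivity
  obtain ⟨C, hC, hdiv⟩ := exists_card_divisors_le (show 0 < δ / 4 by positivity)
  obtain ⟨M₁, hM₁, h₁⟩ := exists_forall_mul_rpow_le Q (show 0 < (1 / 3 : ℝ) by norm_num)
  obtain ⟨M₂, -, h₂⟩ := exists_forall_mul_rpow_le 2 (show 1 / 3 + ε / 4 < 1 / 3 + ε / 2 by linarith)
  obtain ⟨M₃, -, h₃⟩ := exists_forall_mul_rpow_le C (show -δ + δ / 4 < -(δ / 2) by linarith)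
  refine ⟨δ / 2, by positivity, max M₁ (max M₂ M₃), ?_⟩
  intro m _ hM χ hχ N hN hN2
  simp only [max_le_iff] at hM
  have h₁ := h₁ m hM.1
  have h₂ := h₂ m hM.2.1
  have h₃ := h₃ m hM.2.2
  rw [Real.rpow_zero, mul_one] at h₁
  have hm1 : (1 : ℝ) ≤ m := hM₁.trans hM.1
  have hm0 : (0 : ℝ) < m := by linarith
  have hq0 : χ.conductor ≠ 0 := fun h => NeZero.ne m
    (DirichletCharacter.conductor_eq_zero_iff_level_eq_zero.1 h)
  have : NeZero χ.conductor := ⟨hq0⟩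
  have hqm : (χ.conductor : ℝ) ≤ m := by
    exact_mod_cast Nat.le_of_dvd (NeZero.pos m) χ.conductor_dvd_level
  have hne : χ.primitiveCharacter ≠ 1 := by
    intro h
    apply hχ
    rw [← χ.changeLevel_primitiveCharacter, h, DirichletCharacter.changeLevel_one]
  have key : ∀ d ∈ m.divisors, ‖∑ k ∈ Finset.Icc 1 (N / d), χ.primitiveCharacter k‖ ≤
      N * (m : ℝ) ^ (-δ) := by
    intro d hd
    have hd0 : (1 : ℝ) ≤ d := by exact_mod_cast Nat.pos_of_mem_divisors hd
    rcases le_or_gt (χ.conductor : ℝ) ((m : ℝ) ^ (1 / 3 : ℝ)) with hq | hq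
    · refine (norm_sum_Icc_le_level hne _).trans (hq.trans ?_)
      calc (m : ℝ) ^ (1 / 3 : ℝ) ≤ (m : ℝ) ^ (1 / 3 + ε) * (m : ℝ) ^ (-δ) := by
            rw [← Real.rpow_add hm0]
            exact Real.rpow_le_rpow_of_exponent_le hm1 (by linarith [min_le_left (ε / 2) (δ₁ / 3)])
        _ ≤ _ := by gcongr
    rcases le_or_gt ((m : ℝ) ^ (ε / 2)) d with hdm | hdm
    · calc _ ≤ ((N / d : ℕ) : ℝ) := by
            refine (norm_sum_le_of_le _ fun i _ => DirichletCharacter.norm_le_one _ _).trans ?_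
            simp
        _ ≤ N / d := Nat.cast_div_le
        _ ≤ N / (m : ℝ) ^ (ε / 2) := by gcongr
        _ = N * (m : ℝ) ^ (-(ε / 2)) := by rw [Real.rpow_neg hm0.le, div_eq_mul_inv]
        _ ≤ _ := by
          gcongr
          exact min_le_left _ _
    · have h4 : (m : ℝ) ^ (1 / 3 + ε / 4) ≤ (N / d : ℕ) := by
        have h5 : (m : ℝ) ^ (1 / 3 + ε / 2) ≤ N / d := by
          rw [le_div_iff₀ (by linarith)]
          calc (m : ℝ) ^ (1 / 3 + ε / 2) * d ≤ (m : ℝ) ^ (1 / 3 + ε / 2) * (m : ℝ) ^ (ε / 2) := by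
                gcongr
            _ = (m : ℝ) ^ (1 / 3 + ε) := by rw [← Real.rpow_add hm0]; congr 1; ring
            _ ≤ N := hN
        have h6 := Nat.lt_floor_add_one ((N : ℝ) / d)
        rw [Nat.floor_div_eq_div] at h6
        have h7 : 1 ≤ (m : ℝ) ^ (1 / 3 + ε / 4) := Real.one_le_rpow hm1 (by positivity)
        linarith
      have h8 : ((N / d : ℕ) : ℝ) ≤ N := by exact_mod_cast Nat.div_le_self N d
      refine (hprim χ.conductor (h₁.trans hq.le) _ χ.primitiveCharacter_isPrimitive (N / d)
        (le_trans (by gcongr) h4) ?_).trans ?_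
      · calc ((N / d : ℕ) : ℝ) ≤ (m : ℝ) ^ (2 / 3 : ℝ) := h8.trans hN2
          _ = ((m : ℝ) ^ (1 / 3 : ℝ)) ^ 2 := by
            rw [← Real.rpow_natCast, ← Real.rpow_mul hm0.le]; norm_num
          _ < _ := by gcongr
      · have h9 : (χ.conductor : ℝ) ^ (-δ₁) ≤ (m : ℝ) ^ (-δ) := by
          calc (χ.conductor : ℝ) ^ (-δ₁) ≤ ((m : ℝ) ^ (1 / 3 : ℝ)) ^ (-δ₁) :=
                Real.rpow_le_rpow_of_nonpos (by positivity) hq.le (by linarith)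
            _ = (m : ℝ) ^ (-(δ₁ / 3)) := by rw [← Real.rpow_mul hm0.le]; congr 1; ring
            _ ≤ _ := Real.rpow_le_rpow_of_exponent_le hm1 (neg_le_neg (min_le_right _ _))
        exact mul_le_mul h8 h9 (by positivity) (by positivity)
  calc _ ≤ _ := norm_sum_Icc_le_primitiveCharacter χ N
    _ ≤ m.divisors.card • (N * (m : ℝ) ^ (-δ)) := Finset.sum_le_card_nsmul _ _ _ key
    _ ≤ (C * (m : ℝ) ^ (δ / 4)) * (N * (m : ℝ) ^ (-δ)) := by
      rw [nsmul_eq_mul]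
      gcongr
      exact hdiv m (NeZero.ne m)
    _ = N * (C * (m : ℝ) ^ (-δ + δ / 4)) := by rw [Real.rpow_add hm0]; ring
    _ ≤ _ := by gcongr

end NonprincipalSum

section MeanValue

theorem sum_star_sum_mul_sum {m : ℕ} [NeZero m] {ι κ : Type*} (s : Finset ι) (t : Finset κ)
    (u : ι → ZMod m) (v : κ → ZMod m) (hu : ∀ i ∈ s, IsUnit (u i)) :
    ∑ χ : DirichletCharacter ℂ m, star (∑ i ∈ s, χ (u i)) * ∑ j ∈ t, χ (v j) =
      m.totient * (∑ i ∈ s, (t.filter fun j => v j = u i).card : ℕ) := by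
  simp_rw [star_sum, Finset.sum_mul_sum]
  rw [Finset.sum_comm]
  push_cast
  rw [Finset.mul_sum]
  refine Finset.sum_congr rfl fun i hi => ?_
  rw [Finset.sum_comm, Finset.card_filter]
  push_cast
  rw [Finset.mul_sum]
  refine Finset.sum_congr rfl fun j _ => ?_
  have h := DirichletCharacter.sum_char_inv_mul_char_eq ℂ (hu i hi) (v j)
  have h1 : ∀ χ : DirichletCharacter ℂ m, star (χ (u i)) = χ (u i)⁻¹ := by
    intro χ
    have h2 : χ (u i)⁻¹ * χ (u i) = 1 := by
      rw [← map_mul, ZMod.inv_mul_of_unit _ (hu i hi), map_one]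
    rw [MulChar.star_apply', MulChar.inv_apply_eq_inv', eq_inv_of_mul_eq_one_left h2]
  simp_rw [h1]
  rw [h]
  by_cases h : v j = u i
  · simp [h]
  · simp [h, Ne.symm h]

/-- The integers in `[1, N]` coprime to `m`. -/
def coprimeIcc (m N : ℕ) : Finset ℕ := (Finset.Icc 1 N).filter (·.Coprime m)

theorem sum_coprimeIcc {m : ℕ} (χ : DirichletCharacter ℂ m) (N : ℕ) :
    ∑ n ∈ coprimeIcc m N, χ n = ∑ n ∈ Finset.Icc 1 N, χ n := by
  rw [coprimeIcc, Finset.sum_filter]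
  refine Finset.sum_congr rfl fun n _ => ?_
  split_ifs with h
  · rfl
  · exact (χ.map_nonunit (by rwa [ZMod.isUnit_iff_coprime])).symm

theorem card_filter_prod_eq_le {ι : Type*} [Fintype ι] [DecidableEq ι] (A : ι → Finset ℕ) {l : ℕ}
    (hl : l ≠ 0) :
    ((Fintype.piFinset A).filter fun x => ∏ i, x i = l).card ≤
      l.divisors.card ^ Fintype.card ι := by
  have h1 : ((Fintype.piFinset A).filter fun x => ∏ i, x i = l) ⊆
      Fintype.piFinset fun _ : ι => l.divisors := by
    intro x hx
    rw [Fintype.mem_piFinset]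
    intro i
    rw [Nat.mem_divisors]
    exact ⟨(Finset.mem_filter.1 hx).2 ▸ Finset.dvd_prod_of_mem x (Finset.mem_univ i), hl⟩
  refine (Finset.card_le_card h1).trans ?_
  simp

theorem sum_prod_norm_sq_le {m : ℕ} [NeZero m] {ι : Type*} [Fintype ι] [DecidableEq ι] (N : ι → ℕ)
    {T : ℕ} (hT : ∀ l ∈ Finset.Icc 1 (∏ i, N i), l.divisors.card ^ Fintype.card ι ≤ T) :
    ∑ χ : DirichletCharacter ℂ m, ∏ i, ‖∑ n ∈ coprimeIcc m (N i), χ n‖ ^ 2 ≤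
      m.totient * ((∏ i, (coprimeIcc m (N i)).card) * (((∏ i, N i) / m + 1) * T) : ℕ) := by
  set s := Fintype.piFinset fun i => coprimeIcc m (N i) with hs
  set F : (ι → ℕ) → ℕ := fun x => ∏ i, x i with hF
  have hmem : ∀ x ∈ s, ∀ i, (1 ≤ x i ∧ x i ≤ N i) ∧ (x i).Coprime m := by
    intro x hx i
    have := Fintype.mem_piFinset.1 hx i
    simpa [coprimeIcc] using this
  have h1 : ∀ χ : DirichletCharacter ℂ m, ((∏ i, ‖∑ n ∈ coprimeIcc m (N i), χ n‖ ^ 2 : ℝ) : ℂ) =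
      star (∑ x ∈ s, χ (F x : ZMod m)) * ∑ x ∈ s, χ (F x : ZMod m) := by
    intro χ
    have h2 : ∑ x ∈ s, χ (F x : ZMod m) = ∏ i, ∑ n ∈ coprimeIcc m (N i), χ n := by
      rw [Finset.prod_univ_sum]
      refine Finset.sum_congr rfl fun x _ => ?_
      rw [hF]
      push_cast
      rw [map_prod]
    rw [h2, Finset.prod_pow, ← norm_prod, mul_comm, ← starRingEnd_apply, Complex.mul_conj']
    push_cast
    rfl
  have h2 := sum_star_sum_mul_sum (m := m) s s (fun x => (F x : ZMod m)) (fun x => (F x : ZMod m))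
    (fun x hx => by
      rw [ZMod.isUnit_iff_coprime]
      exact Nat.Coprime.prod_left fun i _ => (hmem x hx i).2)
  rw [← Finset.sum_congr rfl fun χ _ => h1 χ] at h2
  have h3 : ∑ χ : DirichletCharacter ℂ m, ∏ i, ‖∑ n ∈ coprimeIcc m (N i), χ n‖ ^ 2 =
      m.totient * (∑ x ∈ s, (s.filter fun y => (F y : ZMod m) = F x).card : ℕ) := by
    exact_mod_cast h2
  rw [h3]
  gcongr
  calc _ ≤ ∑ x ∈ s, ((∏ i, N i) / m + 1) * T := Finset.sum_le_sum fun x _ => by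
        refine card_filter_cast_eq_le s F (fun y hy => ?_) (fun l hl => ?_) m _
        · rw [Finset.mem_Icc]
          exact ⟨Nat.succ_le_of_lt (Finset.prod_pos fun i _ => (hmem y hy i).1.1),
            Finset.prod_le_prod' fun i _ => (hmem y hy i).1.2⟩
        · refine (card_filter_prod_eq_le _ ?_).trans (hT l hl)
          have := Finset.mem_Icc.1 hl
          omega
    _ = _ := by rw [Finset.sum_const, smul_eq_mul, hs, Fintype.card_piFinset]

theorem exists_mean_value_le {η : ℝ} (hη : 0 < η) (k K : ℕ) :
    ∃ M : ℝ, ∀ (m : ℕ) [NeZero m], M ≤ m → ∀ N : Fin k → ℕ, (∀ i, 0 < N i) →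
      m ≤ ∏ i, N i → ∏ i, N i ≤ m ^ K →
      ∑ χ : DirichletCharacter ℂ m,
        ∏ i, (‖∑ n ∈ coprimeIcc m (N i), χ n‖ / (coprimeIcc m (N i)).card) ^ 2 ≤
        (m : ℝ) ^ η := by
  set θ : ℝ := η / (4 * (k + 1) * (K + 1)) with hθ
  have hθ0 : 0 < θ := by positivity
  obtain ⟨C, hC, hdiv⟩ := exists_card_divisors_le hθ0
  obtain ⟨M₁, h₁⟩ := exists_card_coprime_ge hθ0
  obtain ⟨M₂, hM₂, h₂⟩ := exists_forall_mul_rpow_le (2 * C ^ k) (show η / 2 < η by linarith)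
  refine ⟨max M₁ M₂, ?_⟩
  intro m _ hM N hN hmN hNm
  simp only [max_le_iff] at hM
  have h₁ := h₁ m hM.1
  have h₂ := h₂ m hM.2
  have hm1 : (1 : ℝ) ≤ m := hM₂.trans hM.2
  have hm0 : (0 : ℝ) < m := by linarith
  obtain ⟨R, hR⟩ : ∃ R, R = ∏ i, N i := ⟨_, rfl⟩
  rw [← hR] at hmN hNm
  have hR0 : 0 < R := hR ▸ Finset.prod_pos fun i _ => hN i
  obtain ⟨T, hT⟩ : ∃ T : ℕ, T = ⌊(C * (m : ℝ) ^ (K * θ)) ^ k⌋₊ := ⟨_, rfl⟩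
  have hT' : ∀ l ∈ Finset.Icc 1 R, l.divisors.card ^ Fintype.card (Fin k) ≤ T := by
    intro l hl
    rw [Finset.mem_Icc] at hl
    rw [hT]
    refine Nat.le_floor ?_
    rw [Fintype.card_fin, Nat.cast_pow]
    refine pow_le_pow_left₀ (by positivity) ((hdiv l (by omega)).trans ?_) _
    have h3 : (l : ℝ) ≤ (m : ℝ) ^ K := by exact_mod_cast hl.2.trans hNm
    calc C * (l : ℝ) ^ θ ≤ C * ((m : ℝ) ^ K) ^ θ := by gcongr
      _ = _ := by rw [← Real.rpow_natCast, ← Real.rpow_mul hm0.le]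
  have hmv := sum_prod_norm_sq_le (m := m) N (hR ▸ hT')
  have hcard : ∀ i, (N i : ℝ) * (m : ℝ) ^ (-θ) ≤ (coprimeIcc m (N i)).card := fun i => h₁ _ (hN i)
  have hcard0 : ∀ i, (0 : ℝ) < (coprimeIcc m (N i)).card := fun i =>
    lt_of_lt_of_le (mul_pos (by exact_mod_cast hN i) (by positivity)) (hcard i)
  obtain ⟨B, hB⟩ : ∃ B : ℝ, B = ∏ i, ((coprimeIcc m (N i)).card : ℝ) := ⟨_, rfl⟩
  have hB0 : 0 < B := hB ▸ Finset.prod_pos fun i _ => hcard0 i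
  have hBR : (R : ℝ) ≤ B * (m : ℝ) ^ (k * θ) := by
    have h4 : ∏ i, ((N i : ℝ) * (m : ℝ) ^ (-θ)) ≤ B :=
      hB ▸ Finset.prod_le_prod (fun i _ => by positivity) fun i _ => hcard i
    rw [Finset.prod_mul_distrib, Finset.prod_const, Finset.card_univ, Fintype.card_fin,
      ← Nat.cast_prod, ← hR, ← Real.rpow_natCast, ← Real.rpow_mul hm0.le] at h4
    calc (R : ℝ) = R * (m : ℝ) ^ (-θ * k) * (m : ℝ) ^ (k * θ) := by
          rw [mul_assoc, ← Real.rpow_add hm0]; ring_nf; simp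
      _ ≤ _ := by gcongr
  have h5 : ∑ χ : DirichletCharacter ℂ m,
      ∏ i, (‖∑ n ∈ coprimeIcc m (N i), χ n‖ / (coprimeIcc m (N i)).card) ^ 2 =
      (∑ χ : DirichletCharacter ℂ m, ∏ i, ‖∑ n ∈ coprimeIcc m (N i), χ n‖ ^ 2) / B ^ 2 := by
    rw [Finset.sum_div]
    refine Finset.sum_congr rfl fun χ _ => ?_
    simp_rw [div_pow]
    rw [Finset.prod_div_distrib, hB, Finset.prod_pow _ _ (fun i => ((coprimeIcc m (N i)).card : ℝ))]
  rw [h5, div_le_iff₀ (by positivity)]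
  refine hmv.trans ?_
  push_cast
  rw [← hB, ← hR]
  have h6 : ((R / m : ℕ) : ℝ) + 1 ≤ 2 * R / m := by
    have h7 : (1 : ℝ) ≤ R / m := by
      rw [one_le_div hm0]; exact_mod_cast hmN
    have h8 : ((R / m : ℕ) : ℝ) ≤ R / m := Nat.cast_div_le
    rw [mul_div_assoc]; linarith
  have h7 : (m.totient : ℝ) ≤ m := by exact_mod_cast m.totient_le
  have h8 : (T : ℝ) ≤ C ^ k * (m : ℝ) ^ (K * θ * k) := by
    rw [hT]
    refine (Nat.floor_le (by positivity)).trans ?_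
    rw [mul_pow, ← Real.rpow_mul_natCast hm0.le]
  have h9 : k * θ + K * θ * k ≤ η / 2 := by
    rw [hθ]
    have : (k * (η / (4 * (k + 1) * (K + 1))) + K * (η / (4 * (k + 1) * (K + 1))) * k : ℝ) =
        η / 4 * (k / (k + 1)) := by field_simp; ring
    rw [this]
    have : (k / (k + 1) : ℝ) ≤ 1 := by rw [div_le_one (by positivity)]; linarith
    nlinarith
  calc (m.totient : ℝ) * (B * ((((R / m : ℕ) : ℝ) + 1) * T)) ≤
        m * (B * ((2 * (B * (m : ℝ) ^ (k * θ)) / m) * (C ^ k * (m : ℝ) ^ (K * θ * k)))) := by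
        gcongr
        exact h6.trans (by gcongr)
    _ = (2 * C ^ k) * ((m : ℝ) ^ (k * θ + K * θ * k)) * B ^ 2 := by
      rw [Real.rpow_add hm0]; field_simp
    _ ≤ (2 * C ^ k) * ((m : ℝ) ^ (η / 2)) * B ^ 2 := by gcongr
    _ ≤ _ := by gcongr

end MeanValue

section Units

theorem card_mul_sq_le_sum {m : ℕ} [NeZero m] {κ : Type*} (E : Finset (ZMod m)) (t : Finset κ)
    (v : κ → ZMod m) (hE : ∀ x ∈ E, IsUnit x) (ht : ∀ j ∈ t, IsUnit (v j))
    (hv : ∀ j ∈ t, v j ∉ E) :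
    (E.card : ℝ) * t.card ^ 2 ≤
      m.totient * ∑ χ ∈ (Finset.univ : Finset (DirichletCharacter ℂ m)).erase 1,
        ‖∑ j ∈ t, χ (v j)‖ ^ 2 := by
  rcases E.eq_empty_or_nonempty with rfl | hne
  · simp only [Finset.card_empty, Nat.cast_zero, zero_mul]
    positivity
  have hEpos : (0 : ℝ) < E.card := by exact_mod_cast hne.card_pos
  have h1 := sum_star_sum_mul_sum E t (fun x => x) v hE
  have h2 : ∀ x ∈ E, (t.filter fun j => v j = x).card = 0 := by
    intro x hx
    rw [Finset.card_eq_zero, Finset.filter_eq_empty_iff]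
    rintro j hj rfl
    exact hv j hj hx
  rw [Finset.sum_eq_zero h2, Nat.cast_zero, mul_zero,
    ← Finset.add_sum_erase _ _ (Finset.mem_univ 1)] at h1
  have h3 : ∑ x ∈ E, (1 : DirichletCharacter ℂ m) x = E.card := by
    rw [Finset.sum_congr rfl fun x hx => MulChar.one_apply (hE x hx)]
    simp
  have h4 : ∑ j ∈ t, (1 : DirichletCharacter ℂ m) (v j) = t.card := by
    rw [Finset.sum_congr rfl fun j hj => MulChar.one_apply (ht j hj)]
    simp
  rw [h3, h4] at h1
  have h5 : (E.card : ℝ) * t.card ≤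
      ∑ χ ∈ (Finset.univ : Finset (DirichletCharacter ℂ m)).erase 1,
        ‖∑ x ∈ E, χ x‖ * ‖∑ j ∈ t, χ (v j)‖ := by
    have h6 : ((E.card * t.card : ℝ) : ℂ) =
        -∑ χ ∈ (Finset.univ : Finset (DirichletCharacter ℂ m)).erase 1,
          star (∑ x ∈ E, χ x) * ∑ j ∈ t, χ (v j) := by
      rw [← add_eq_zero_iff_eq_neg, ← h1]
      simp
    calc (E.card : ℝ) * t.card = ‖((E.card * t.card : ℝ) : ℂ)‖ := by
          rw [Complex.norm_real, Real.norm_of_nonneg (by positivity)]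
      _ ≤ _ := by
        rw [h6, norm_neg]
        refine (norm_sum_le _ _).trans (le_of_eq ?_)
        exact Finset.sum_congr rfl fun χ _ => by rw [norm_mul, norm_star]
  have h7 : ∑ χ : DirichletCharacter ℂ m, ‖∑ x ∈ E, χ x‖ ^ 2 = m.totient * E.card := by
    have h8 := sum_star_sum_mul_sum E E (fun x => x) (fun x => x) hE
    have h9 : ∀ χ : DirichletCharacter ℂ m, star (∑ x ∈ E, χ x) * ∑ x ∈ E, χ x =
        ((‖∑ x ∈ E, χ x‖ ^ 2 : ℝ) : ℂ) := by
      intro χ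
      rw [mul_comm, ← starRingEnd_apply, Complex.mul_conj']
      push_cast
      rfl
    rw [Finset.sum_congr rfl fun χ _ => h9 χ] at h8
    have h10 : ∑ x ∈ E, (E.filter fun y => y = x).card = E.card := by
      rw [Finset.card_eq_sum_ones]
      refine Finset.sum_congr rfl fun x hx => ?_
      simp [Finset.filter_eq', hx]
    rw [h10] at h8
    exact_mod_cast h8
  have h11 : ((E.card : ℝ) * t.card) ^ 2 ≤ (m.totient * E.card) *
      ∑ χ ∈ (Finset.univ : Finset (DirichletCharacter ℂ m)).erase 1, ‖∑ j ∈ t, χ (v j)‖ ^ 2 := by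
    refine (pow_le_pow_left₀ (by positivity) h5 2).trans ((Finset.sum_mul_sq_le_sq_mul_sq _ _ _).trans ?_)
    refine mul_le_mul_of_nonneg_right ?_ (by positivity)
    rw [← h7]
    exact Finset.sum_le_sum_of_subset_of_nonneg (Finset.erase_subset _ _) fun _ _ _ => by positivity
  refine le_of_mul_le_mul_left ?_ hEpos
  linear_combination h11

theorem sum_sq_mul_sq_le {ι : Type*} (s : Finset ι) {a b : ι → ℝ} {α β A : ℝ} {k : ℕ}
    (ha : ∀ i ∈ s, 0 ≤ a i ∧ a i ≤ α) (hb : ∀ i ∈ s, 0 ≤ b i ∧ b i ≤ 1) (hβ : 0 < β)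
    (hA : ∑ i ∈ s, a i ^ 2 ≤ A) (hB : ∑ i ∈ s, (b i ^ 2) ^ k ≤ A) :
    ∑ i ∈ s, a i ^ 2 * b i ^ 2 ≤ β ^ 2 * A + α ^ 2 * (A / (β ^ 2) ^ k) := by
  have h1 : ∀ i ∈ s, a i ^ 2 * b i ^ 2 ≤ β ^ 2 * a i ^ 2 + α ^ 2 * ((b i ^ 2) ^ k / (β ^ 2) ^ k) := by
    intro i hi
    obtain ⟨ha0, ha1⟩ := ha i hi
    obtain ⟨hb0, hb1⟩ := hb i hi
    rcases le_total (b i) β with h | h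
    · have h2 : a i ^ 2 * b i ^ 2 ≤ β ^ 2 * a i ^ 2 := by
        rw [mul_comm]; gcongr
      have h3 : 0 ≤ α ^ 2 * ((b i ^ 2) ^ k / (β ^ 2) ^ k) := by positivity
      linarith
    · have h2 : a i ^ 2 * b i ^ 2 ≤ α ^ 2 * 1 := by
        gcongr; exact pow_le_one₀ hb0 hb1
      have h3 : 1 ≤ (b i ^ 2) ^ k / (β ^ 2) ^ k := by
        rw [one_le_div (by positivity)]; gcongr
      have h4 : α ^ 2 * 1 ≤ α ^ 2 * ((b i ^ 2) ^ k / (β ^ 2) ^ k) := by gcongr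
      have h5 : 0 ≤ β ^ 2 * a i ^ 2 := by positivity
      linarith
  calc _ ≤ _ := Finset.sum_le_sum h1
    _ = β ^ 2 * ∑ i ∈ s, a i ^ 2 + α ^ 2 * ((∑ i ∈ s, (b i ^ 2) ^ k) / (β ^ 2) ^ k) := by
      rw [Finset.sum_add_distrib, ← Finset.mul_sum, ← Finset.mul_sum, ← Finset.sum_div]
    _ ≤ _ := by gcongr

theorem norm_sum_coprimeIcc_div_le_one {m : ℕ} (χ : DirichletCharacter ℂ m) (N : ℕ) :
    ‖∑ n ∈ coprimeIcc m N, χ n‖ / (coprimeIcc m N).card ≤ 1 := by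
  refine div_le_one_of_le₀ ?_ (by positivity)
  refine (norm_sum_le_of_le _ fun i _ => χ.norm_le_one _).trans ?_
  simp

/-- If a unit-valued product set over `N : Fin k → ℕ` and `P` misses `E`, then `E` is controlled by
normalised character sums. -/
theorem card_le_of_forall_prod_mul_notMem {m : ℕ} [NeZero m] {k : ℕ} (E : Finset (ZMod m))
    (N : Fin k → ℕ) (P : ℕ) (hE : ∀ x ∈ E, IsUnit x)
    (hN : ∀ i, (coprimeIcc m (N i)).Nonempty) (hP : (coprimeIcc m P).Nonempty)
    (hmiss : ∀ x : Fin k → ℕ, (∀ i, x i ∈ Finset.Icc 1 (N i)) → ∀ p ∈ Finset.Icc 1 P,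
      (((∏ i, x i) * p : ℕ) : ZMod m) ∉ E) :
    (E.card : ℝ) ≤ m.totient * ∑ χ ∈ (Finset.univ : Finset (DirichletCharacter ℂ m)).erase 1,
      (∏ i, (‖∑ n ∈ coprimeIcc m (N i), χ n‖ / (coprimeIcc m (N i)).card)) ^ 2 *
        (‖∑ n ∈ coprimeIcc m P, χ n‖ / (coprimeIcc m P).card) ^ 2 := by
  set s := Fintype.piFinset fun i => coprimeIcc m (N i) with hs
  have hmem : ∀ {n K : ℕ}, n ∈ coprimeIcc m K → n ∈ Finset.Icc 1 K ∧ n.Coprime m := fun h =>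
    Finset.mem_filter.1 h
  have h := card_mul_sq_le_sum E (s ×ˢ coprimeIcc m P)
    (fun y => (((∏ i, y.1 i) * y.2 : ℕ) : ZMod m)) hE
    (fun y hy => by
      rw [Finset.mem_product, Fintype.mem_piFinset] at hy
      rw [ZMod.isUnit_iff_coprime]
      exact Nat.Coprime.mul_left (Nat.Coprime.prod_left fun i _ => (hmem (hy.1 i)).2)
        (hmem hy.2).2)
    (fun y hy => by
      rw [Finset.mem_product, Fintype.mem_piFinset] at hy
      exact hmiss y.1 (fun i => (hmem (hy.1 i)).1) y.2 (hmem hy.2).1)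
  have hfac : ∀ χ : DirichletCharacter ℂ m,
      ∑ y ∈ s ×ˢ coprimeIcc m P, χ (((∏ i, y.1 i) * y.2 : ℕ) : ZMod m) =
        (∏ i, ∑ n ∈ coprimeIcc m (N i), χ n) * ∑ n ∈ coprimeIcc m P, χ n := by
    intro χ
    rw [Finset.prod_univ_sum, Finset.sum_mul_sum, Finset.sum_product]
    refine Finset.sum_congr rfl fun x _ => Finset.sum_congr rfl fun p _ => ?_
    push_cast
    rw [map_mul, map_prod]
  have hcard : ((s ×ˢ coprimeIcc m P).card : ℝ) =
      (∏ i, ((coprimeIcc m (N i)).card : ℝ)) * (coprimeIcc m P).card := by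
    rw [Finset.card_product, hs, Fintype.card_piFinset]
    push_cast
    rfl
  have hpos1 : 0 < ∏ i, ((coprimeIcc m (N i)).card : ℝ) :=
    Finset.prod_pos fun i _ => by exact_mod_cast (hN i).card_pos
  have hpos2 : (0 : ℝ) < (coprimeIcc m P).card := by exact_mod_cast hP.card_pos
  rw [hcard, ← le_div_iff₀ (by positivity), mul_div_assoc, Finset.sum_div] at h
  refine h.trans (le_of_eq ?_)
  congr 1
  refine Finset.sum_congr rfl fun χ _ => ?_
  rw [hfac, norm_mul, norm_prod, Finset.prod_div_distrib, mul_pow, mul_pow, div_pow, div_pow,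
    mul_div_mul_comm]

end Units

section UnitTheorem

set_option maxHeartbeats 1000000 in
theorem exists_card_unit_notMem_le {ε : ℝ} (hε : 0 < ε) (hε1 : ε ≤ 1) :
    ∃ δ : ℝ, 0 < δ ∧ ∃ M : ℝ, ∀ (m : ℕ) [NeZero m], M ≤ m → ∀ N₁ N₂ N₃ : ℕ,
      0 < N₁ → 0 < N₂ → N₁ ≤ m ^ 2 → N₂ ≤ m ^ 2 → N₃ ≤ m ^ 2 → (m : ℝ) ^ (1 / 3 + ε / 3) ≤ N₃ →
      (m : ℝ) ^ (1 + ε) ≤ N₁ * N₂ * N₃ → ∀ E : Finset (ZMod m), (∀ x ∈ E, IsUnit x) →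
      (∀ x₁ ∈ Finset.Icc 1 N₁, ∀ x₂ ∈ Finset.Icc 1 N₂, ∀ x₃ ∈ Finset.Icc 1 N₃,
        ((x₁ * x₂ * x₃ : ℕ) : ZMod m) ∉ E) → (E.card : ℝ) ≤ (m : ℝ) ^ (1 - δ) := by
  obtain ⟨δ₀, hδ₀, M₁, h₁⟩ := norm_sum_dirichletCharacter_le (show 0 < ε / 7 by positivity)
  set δ : ℝ := δ₀ / 2 with hδ
  have hδ0 : 0 < δ := by positivity
  obtain ⟨M₂, h₂⟩ := exists_card_coprime_ge hδ0
  set k : ℕ := ⌈20 / ε⌉₊ with hk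
  have hkε : 20 / ε ≤ k := Nat.le_ceil _
  have hk0 : (0 : ℝ) < k := lt_of_lt_of_le (by positivity) hkε
  have hk1 : (1 : ℝ) ≤ k := by exact_mod_cast (show 0 < k by exact_mod_cast hk0)
  set η : ℝ := δ / (2 * k) with hη
  have hη0 : 0 < η := by positivity
  have hηk : 2 * η * k = δ := by rw [hη]; field_simp
  have hηδ : 2 * η ≤ δ := by nlinarith
  obtain ⟨M₃, h₃⟩ := exists_mean_value_le hη0 4 8
  obtain ⟨M₄, h₄⟩ := exists_mean_value_le hη0 k k
  obtain ⟨M₅, hM₅, h₅⟩ := exists_forall_mul_rpow_le 2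
    (show 1 / 3 + ε / 7 < 1 / 3 + ε / 6 by linarith)
  obtain ⟨M₆, -, h₆⟩ := exists_forall_mul_rpow_le 2 (show ε / 20 < ε / 10 by linarith)
  obtain ⟨M₇, -, h₇⟩ := exists_forall_mul_rpow_le 2 (show 1 + ε / 10 < 1 + ε by linarith)
  obtain ⟨M₈, -, h₈⟩ := exists_forall_mul_rpow_le 2 (show 1 - η < 1 - η / 2 by linarith)
  refine ⟨η / 2, by positivity, max M₁ (max M₂ (max M₃ (max M₄ (max M₅ (max M₆ (max M₇ M₈)))))), ?_⟩
  intro m _ hM N₁ N₂ N₃ hN₁ hN₂ hN₁m hN₂m hN₃m hN₃ hN E hE hmiss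
  simp only [max_le_iff] at hM
  obtain ⟨hM₁, hM₂, hM₃, hM₄, hM₅', hM₆, hM₇, hM₈⟩ := hM
  have h₅ := h₅ m hM₅'
  have h₆ := h₆ m hM₆
  have h₇ := h₇ m hM₇
  have h₈ := h₈ m hM₈
  have hm1 : (1 : ℝ) ≤ m := hM₅.trans hM₅'
  have hm0 : (0 : ℝ) < m := by linarith
  have hfl : ∀ {z w : ℝ}, 2 * w ≤ z → 1 ≤ w → w ≤ ⌊z⌋₊ := fun {z w} h1 h2 => by
    have := Nat.lt_floor_add_one z
    linarith
  obtain ⟨Y, hY⟩ : ∃ Y : ℕ, Y = ⌊(m : ℝ) ^ (1 / 3 + ε / 6)⌋₊ := ⟨_, rfl⟩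
  obtain ⟨P, hP⟩ : ∃ P : ℕ, P = ⌊(m : ℝ) ^ (ε / 10)⌋₊ := ⟨_, rfl⟩
  have hYl : (m : ℝ) ^ (1 / 3 + ε / 7) ≤ Y := hY ▸ hfl h₅ (Real.one_le_rpow hm1 (by positivity))
  have hPl : (m : ℝ) ^ (ε / 20) ≤ P := hP ▸ hfl h₆ (Real.one_le_rpow hm1 (by positivity))
  have hYu : (Y : ℝ) ≤ (m : ℝ) ^ (1 / 3 + ε / 6) := hY ▸ Nat.floor_le (by positivity)
  have hPu : (P : ℝ) ≤ (m : ℝ) ^ (ε / 10) := hP ▸ Nat.floor_le (by positivity)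
  have hY1 : (1 : ℝ) ≤ Y := (Real.one_le_rpow hm1 (by positivity)).trans hYl
  have hP1 : (1 : ℝ) ≤ P := (Real.one_le_rpow hm1 (by positivity)).trans hPl
  have hY0 : 0 < Y := by exact_mod_cast hY1
  have hP0 : 0 < P := by exact_mod_cast hP1
  have hYm : Y ≤ m := by
    have : (Y : ℝ) ≤ (m : ℝ) ^ (1 : ℝ) :=
      hYu.trans (Real.rpow_le_rpow_of_exponent_le hm1 (by linarith))
    rw [Real.rpow_one] at this
    exact_mod_cast this
  have hPm : P ≤ m := by
    have : (P : ℝ) ≤ (m : ℝ) ^ (1 : ℝ) :=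
      hPu.trans (Real.rpow_le_rpow_of_exponent_le hm1 (by linarith))
    rw [Real.rpow_one] at this
    exact_mod_cast this
  obtain ⟨L, hL⟩ : ∃ L : ℕ, L = N₃ / (Y * P) := ⟨_, rfl⟩
  have hYP : Y * P ≤ N₃ := by
    have : (Y : ℝ) * P ≤ N₃ := by
      calc (Y : ℝ) * P ≤ (m : ℝ) ^ (1 / 3 + ε / 6) * (m : ℝ) ^ (ε / 10) := by gcongr
        _ ≤ (m : ℝ) ^ (1 / 3 + ε / 3) := by
          rw [← Real.rpow_add hm0]
          exact Real.rpow_le_rpow_of_exponent_le hm1 (by linarith)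
        _ ≤ N₃ := hN₃
    exact_mod_cast this
  have hL0 : 0 < L := hL ▸ Nat.div_pos hYP (Nat.mul_pos hY0 hP0)
  have hLm : L ≤ m ^ 2 := hL ▸ (Nat.div_le_self _ _).trans hN₃m
  have hLYP : L * (Y * P) ≤ N₃ := hL ▸ Nat.div_mul_le_self _ _
  have hN₃L : N₃ ≤ 2 * L * (Y * P) := by
    have h1 := Nat.lt_div_mul_add (a := N₃) (Nat.mul_pos hY0 hP0)
    rw [← hL] at h1
    have h2 : Y * P ≤ L * (Y * P) := Nat.le_mul_of_pos_left _ hL0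
    rw [mul_assoc]
    omega
  set N : Fin 4 → ℕ := ![N₁, N₂, L, Y] with hNdef
  have hprodN : ∏ i, N i = N₁ * N₂ * L * Y := by simp [hNdef, Fin.prod_univ_four]
  have hNpos : ∀ i, 0 < N i := by
    intro i
    fin_cases i <;> simp [hNdef, hN₁, hN₂, hL0, hY0]
  have hYm2 : Y ≤ m ^ 2 := hYm.trans (Nat.le_self_pow two_ne_zero m)
  have hNle : ∀ i, N i ≤ m ^ 2 := by
    intro i
    fin_cases i <;> simp [hNdef, hN₁m, hN₂m, hLm, hYm2]
  have hmN : m ≤ ∏ i, N i := by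
    rw [hprodN]
    have h1 : 2 * (m : ℝ) ^ (1 + ε / 10) ≤ 2 * (N₁ * N₂ * L * Y) * (m : ℝ) ^ (ε / 10) := by
      calc _ ≤ _ := h₇
        _ ≤ (N₁ * N₂ * N₃ : ℝ) := hN
        _ ≤ N₁ * N₂ * (2 * L * (Y * P)) := by
          gcongr; exact_mod_cast hN₃L
        _ = 2 * (N₁ * N₂ * L * Y) * P := by ring
        _ ≤ _ := by gcongr
    rw [Real.rpow_add hm0, Real.rpow_one, ← mul_assoc] at h1
    have h2 := le_of_mul_le_mul_right h1 (by positivity)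
    have h3 : (m : ℝ) ≤ N₁ * N₂ * L * Y := by linarith
    exact_mod_cast h3
  have hNm : ∏ i, N i ≤ m ^ 8 := by
    refine (Finset.prod_le_pow_card _ _ (m ^ 2) fun i _ => hNle i).trans (le_of_eq ?_)
    simp [← pow_mul]
  have hmean1 := h₃ m hM₃ N hNpos hmN hNm
  have hmean2 := h₄ m hM₄ (fun _ => P) (fun _ => hP0)
    (by
      have h1 : (m : ℝ) ≤ P ^ k := by
        calc (m : ℝ) = (m : ℝ) ^ (1 : ℝ) := (Real.rpow_one _).symm
          _ ≤ (m : ℝ) ^ (ε / 20 * k) := by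
            refine Real.rpow_le_rpow_of_exponent_le hm1 ?_
            calc (1 : ℝ) = ε / 20 * (20 / ε) := by field_simp
              _ ≤ _ := by gcongr
          _ = ((m : ℝ) ^ (ε / 20)) ^ k := Real.rpow_mul_natCast hm0.le _ _
          _ ≤ _ := by gcongr
      simpa using (show m ≤ P ^ k by exact_mod_cast h1))
    (by simpa using Nat.pow_le_pow_left hPm k)
  have hcardpos : ∀ K : ℕ, 0 < K → (0 : ℝ) < (coprimeIcc m K).card := fun K hK =>
    lt_of_lt_of_le (mul_pos (by exact_mod_cast hK) (by positivity)) (h₂ m hM₂ K hK)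
  have hne : ∀ K : ℕ, 0 < K → (coprimeIcc m K).Nonempty := fun K hK =>
    Finset.card_pos.1 (by exact_mod_cast hcardpos K hK)
  have hcardE := card_le_of_forall_prod_mul_notMem E N P hE (fun i => hne _ (hNpos i)) (hne P hP0)
    (fun x hx p hp => by
      have h1 := hx 0
      have h2 := hx 1
      have h3 := hx 2
      have h4 := hx 3
      simp only [hNdef, Finset.mem_Icc, Matrix.cons_val] at h1 h2 h3 h4 hp
      have h5 := hmiss (x 0) (Finset.mem_Icc.2 h1) (x 1) (Finset.mem_Icc.2 h2) (x 2 * (x 3 * p))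
        (Finset.mem_Icc.2 ⟨Nat.mul_pos h3.1 (Nat.mul_pos h4.1 hp.1),
          le_trans (Nat.mul_le_mul h3.2 (Nat.mul_le_mul h4.2 hp.2)) hLYP⟩)
      rw [Fin.prod_univ_four]
      rwa [show x 0 * x 1 * x 2 * x 3 * p = x 0 * x 1 * (x 2 * (x 3 * p)) by ring])
  set S : ℕ → DirichletCharacter ℂ m → ℝ := fun K χ =>
    ‖∑ n ∈ coprimeIcc m K, χ n‖ / (coprimeIcc m K).card with hS
  have hS0 : ∀ K χ, 0 ≤ S K χ := fun K χ => by positivity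
  have hS1 : ∀ K χ, S K χ ≤ 1 := fun K χ => norm_sum_coprimeIcc_div_le_one χ K
  have hSY : ∀ χ : DirichletCharacter ℂ m, χ ≠ 1 → S Y χ ≤ (m : ℝ) ^ (-δ) := by
    intro χ hχ
    have hYu' : (Y : ℝ) ≤ (m : ℝ) ^ (2 / 3 : ℝ) :=
      hYu.trans (Real.rpow_le_rpow_of_exponent_le hm1 (by linarith))
    have h1 := h₁ m hM₁ χ hχ Y hYl hYu'
    rw [← sum_coprimeIcc] at h1
    rw [hS]
    simp only
    rw [div_le_iff₀ (hcardpos Y hY0)]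
    refine h1.trans ?_
    calc (Y : ℝ) * (m : ℝ) ^ (-δ₀) = (m : ℝ) ^ (-δ) * (Y * (m : ℝ) ^ (-δ)) := by
          rw [mul_left_comm, ← Real.rpow_add hm0]
          congr 2
          rw [hδ]; ring
      _ ≤ _ := by
        gcongr
        exact h₂ m hM₂ Y hY0
  have hsub : ∀ f : DirichletCharacter ℂ m → ℝ, (∀ χ, 0 ≤ f χ) →
      ∑ χ ∈ Finset.univ.erase 1, f χ ≤ ∑ χ, f χ := fun f hf =>
    Finset.sum_le_sum_of_subset_of_nonneg (Finset.erase_subset _ _) fun _ _ _ => hf _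
  have hfinal := sum_sq_mul_sq_le ((Finset.univ : Finset (DirichletCharacter ℂ m)).erase 1)
    (a := fun χ => ∏ i, S (N i) χ) (b := S P) (α := (m : ℝ) ^ (-δ)) (β := (m : ℝ) ^ (-η))
    (A := (m : ℝ) ^ η) (k := k)
    (fun χ hχ => ⟨Finset.prod_nonneg fun i _ => hS0 _ _, by
      rw [Fin.prod_univ_four]
      have h1 : S (N 0) χ * S (N 1) χ * S (N 2) χ ≤ 1 :=
        mul_le_one₀ (mul_le_one₀ (hS1 _ _) (hS0 _ _) (hS1 _ _)) (hS0 _ _) (hS1 _ _)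
      refine (mul_le_of_le_one_left (hS0 _ _) h1).trans ?_
      exact hSY χ (Finset.ne_of_mem_erase hχ)⟩)
    (fun χ _ => ⟨hS0 _ _, hS1 _ _⟩) (by positivity)
    ((hsub _ fun χ => sq_nonneg _).trans (by
      refine le_trans (le_of_eq ?_) hmean1
      exact Finset.sum_congr rfl fun χ _ => (Finset.prod_pow _ _ _).symm))
    ((hsub _ fun χ => pow_nonneg (sq_nonneg _) _).trans (by
      simpa using hmean2))
  have hbound : ((m : ℝ) ^ (-η)) ^ 2 * (m : ℝ) ^ η +
      ((m : ℝ) ^ (-δ)) ^ 2 * ((m : ℝ) ^ η / (((m : ℝ) ^ (-η)) ^ 2) ^ k) ≤ 2 * (m : ℝ) ^ (-η) := by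
    have h1 : ((m : ℝ) ^ (-η)) ^ 2 * (m : ℝ) ^ η = (m : ℝ) ^ (-η) := by
      rw [← Real.rpow_mul_natCast hm0.le, ← Real.rpow_add hm0]
      congr 1; push_cast; ring
    have h2 : ((m : ℝ) ^ (-δ)) ^ 2 * ((m : ℝ) ^ η / (((m : ℝ) ^ (-η)) ^ 2) ^ k) =
        (m : ℝ) ^ (-δ + η) := by
      rw [← pow_mul, ← Real.rpow_mul_natCast hm0.le, ← Real.rpow_mul_natCast hm0.le,
        ← Real.rpow_sub hm0, ← Real.rpow_add hm0]
      congr 1; push_cast; linear_combination hηk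
    have h3 : (m : ℝ) ^ (-δ + η) ≤ (m : ℝ) ^ (-η) :=
      Real.rpow_le_rpow_of_exponent_le hm1 (by linarith)
    rw [h1, h2]
    linarith
  calc (E.card : ℝ) ≤ _ := hcardE
    _ ≤ m * (2 * (m : ℝ) ^ (-η)) := by
      refine mul_le_mul (by exact_mod_cast m.totient_le) (hfinal.trans hbound) ?_ hm0.le
      exact Finset.sum_nonneg fun χ _ => mul_nonneg (sq_nonneg _) (sq_nonneg _)
    _ = 2 * (m : ℝ) ^ (1 - η) := by
      rw [sub_eq_add_neg, Real.rpow_add hm0, Real.rpow_one]; ring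
    _ ≤ _ := h₈

end UnitTheorem

section AllResidues

/-- The residues `x` with `gcd(x, m) = g`, divided by `g`, as residues modulo `m / g`. -/
def divGcd (m g : ℕ) (U : Finset (ZMod m)) : Finset (ZMod (m / g)) :=
  (U.filter fun x => x.val.gcd m = g).image fun x => ((x.val / g : ℕ) : ZMod (m / g))

theorem card_divGcd {m g : ℕ} [NeZero m] (hg : g ∣ m) (U : Finset (ZMod m)) :
    (divGcd m g U).card = (U.filter fun x => x.val.gcd m = g).card := by
  refine Finset.card_image_of_injOn fun x hx y hy hxy => ?_
  have hg0 : 0 < g := Nat.pos_of_dvd_of_pos hg (NeZero.pos m)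
  have hx' : g ∣ x.val := (Finset.mem_filter.1 hx).2 ▸ Nat.gcd_dvd_left _ _
  have hy' : g ∣ y.val := (Finset.mem_filter.1 hy).2 ▸ Nat.gcd_dvd_left _ _
  have h1 := (ZMod.natCast_eq_natCast_iff' _ _ _).1 hxy
  rw [Nat.mod_eq_of_lt (Nat.div_lt_div_of_lt_of_dvd hg x.val_lt),
    Nat.mod_eq_of_lt (Nat.div_lt_div_of_lt_of_dvd hg y.val_lt)] at h1
  apply ZMod.val_injective m
  rw [← Nat.div_mul_cancel hx', h1, Nat.div_mul_cancel hy']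

theorem isUnit_of_mem_divGcd {m g : ℕ} [NeZero m] (hg : g ∣ m) {U : Finset (ZMod m)}
    {y : ZMod (m / g)} (hy : y ∈ divGcd m g U) : IsUnit y := by
  obtain ⟨x, hx, rfl⟩ := Finset.mem_image.1 hy
  have hg0 : 0 < g := Nat.pos_of_dvd_of_pos hg (NeZero.pos m)
  have h := (Finset.mem_filter.1 hx).2
  rw [ZMod.isUnit_iff_coprime]
  subst h
  exact Nat.coprime_div_gcd_div_gcd hg0

theorem mul_mem_of_mem_divGcd {m g : ℕ} [NeZero m] (hg : g ∣ m) {U : Finset (ZMod m)} {n : ℕ}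
    (hn : ((n : ℕ) : ZMod (m / g)) ∈ divGcd m g U) : ((g * n : ℕ) : ZMod m) ∈ U := by
  obtain ⟨x, hx, hxn⟩ := Finset.mem_image.1 hn
  have hx' : g ∣ x.val := (Finset.mem_filter.1 hx).2 ▸ Nat.gcd_dvd_left _ _
  have h1 := ((ZMod.natCast_eq_natCast_iff _ _ _).1 hxn).mul_left' g
  rw [Nat.mul_div_cancel' hg, Nat.mul_div_cancel' hx'] at h1
  rw [← (ZMod.natCast_eq_natCast_iff _ _ _).2 h1, ZMod.natCast_zmod_val]
  exact (Finset.mem_filter.1 hx).1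

theorem card_eq_sum_card_divGcd {m : ℕ} [NeZero m] (U : Finset (ZMod m)) :
    U.card = ∑ g ∈ m.divisors, (divGcd m g U).card := by
  rw [Finset.card_eq_sum_card_fiberwise (f := fun x : ZMod m => x.val.gcd m) (t := m.divisors)]
  · exact Finset.sum_congr rfl fun g hg => (card_divGcd (Nat.dvd_of_mem_divisors hg) U).symm
  · intro x _
    exact Nat.mem_divisors.2 ⟨Nat.gcd_dvd_right _ _, NeZero.ne m⟩

theorem exists_card_compl_le_of_le {ε : ℝ} (hε : 0 < ε) (hε1 : ε ≤ 1) :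
    ∃ δ : ℝ, 0 < δ ∧ ∃ M : ℝ, ∀ (m : ℕ) [NeZero m], M ≤ m → ∀ N₁ N₂ N₃ : ℕ,
      0 < N₁ → 0 < N₂ → 0 < N₃ → N₁ ≤ N₃ → N₂ ≤ N₃ →
      (m : ℝ) ^ (1 + ε) ≤ N₁ * N₂ * N₃ → ∀ R : Finset (ZMod m),
      (∀ x₁ ∈ Finset.Icc 1 N₁, ∀ x₂ ∈ Finset.Icc 1 N₂, ∀ x₃ ∈ Finset.Icc 1 N₃,
        ((x₁ * x₂ * x₃ : ℕ) : ZMod m) ∈ R) → (Rᶜ.card : ℝ) ≤ (m : ℝ) ^ (1 - δ) := by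
  obtain ⟨δ₁, hδ₁, M₁, h₁⟩ := exists_card_unit_notMem_le (show 0 < ε / 2 by positivity)
    (by linarith)
  set δ : ℝ := min (ε / 20) δ₁ with hδ
  have hδ0 : 0 < δ := by positivity
  have hδ1 : δ ≤ 1 := (min_le_left _ _).trans (by linarith)
  obtain ⟨C, hC, hdiv⟩ := exists_card_divisors_le (show 0 < δ / 4 by positivity)
  obtain ⟨M₂, hM₂, h₂⟩ := exists_forall_mul_rpow_le M₁ (show 0 < (1 / 2 : ℝ) by norm_num)
  obtain ⟨M₃, -, h₃⟩ := exists_forall_mul_rpow_le 2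
    (show 1 / 3 + ε / 6 < 1 / 3 + ε / 3 - ε / 20 by linarith)
  obtain ⟨M₄, -, h₄⟩ := exists_forall_mul_rpow_le 2 (show 1 + ε / 2 < 1 + ε - ε / 20 by linarith)
  obtain ⟨M₅, -, h₅⟩ := exists_forall_mul_rpow_le C
    (show δ / 4 + (1 - δ) < 1 - δ / 2 by linarith)
  refine ⟨δ / 2, by positivity, max M₂ (max M₃ (max M₄ M₅)), ?_⟩
  intro m _ hM N₁ N₂ N₃ hN₁ hN₂ hN₃ hN₁₃ hN₂₃ hN R hR
  simp only [max_le_iff] at hM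
  obtain ⟨hM₂', hM₃, hM₄, hM₅⟩ := hM
  have h₂ := h₂ m hM₂'
  have h₃ := h₃ m hM₃
  have h₄ := h₄ m hM₄
  have h₅ := h₅ m hM₅
  rw [Real.rpow_zero, mul_one] at h₂
  have hm1 : (1 : ℝ) ≤ m := hM₂.trans hM₂'
  have hm0 : (0 : ℝ) < m := by linarith
  rcases le_or_gt m N₃ with hmN | hmN
  · have : R = Finset.univ := by
      rw [Finset.eq_univ_iff_forall]
      intro x
      have h := hR 1 (Finset.mem_Icc.2 ⟨le_rfl, hN₁⟩) 1 (Finset.mem_Icc.2 ⟨le_rfl, hN₂⟩)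
      simp only [one_mul] at h
      rcases eq_or_ne x 0 with rfl | hx
      · simpa using h m (Finset.mem_Icc.2 ⟨NeZero.pos m, hmN⟩)
      · have hx0 : x.val ≠ 0 := fun h0 => hx ((ZMod.val_eq_zero x).1 h0)
        simpa using h x.val (Finset.mem_Icc.2 ⟨by omega, x.val_lt.le.trans hmN⟩)
    rw [this]
    simp only [Finset.compl_univ, Finset.card_empty, Nat.cast_zero]
    positivity
  have hN₃l : (m : ℝ) ^ (1 / 3 + ε / 3) ≤ N₃ := by
    refine le_of_pow_le_pow_left₀ (n := 3) (by norm_num) (by positivity) ?_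
    calc ((m : ℝ) ^ (1 / 3 + ε / 3)) ^ 3 = (m : ℝ) ^ (1 + ε) := by
          rw [← Real.rpow_mul_natCast hm0.le]; congr 1; push_cast; ring
      _ ≤ N₁ * N₂ * N₃ := hN
      _ ≤ N₃ * N₃ * N₃ := by gcongr
      _ = _ := by ring
  have key : ∀ g ∈ m.divisors, ((divGcd m g Rᶜ).card : ℝ) ≤ (m : ℝ) ^ (1 - δ) := by
    intro g hg
    have hgm := Nat.dvd_of_mem_divisors hg
    have hg0 : 0 < g := Nat.pos_of_mem_divisors hg
    have hgr : (0 : ℝ) < g := by exact_mod_cast hg0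
    have hm'0 : 0 < m / g := Nat.div_pos (Nat.le_of_dvd (NeZero.pos m) hgm) hg0
    have : NeZero (m / g) := ⟨hm'0.ne'⟩
    have hm' : ((m / g : ℕ) : ℝ) = m / g := Nat.cast_div hgm hgr.ne'
    have hm'm : ((m / g : ℕ) : ℝ) ≤ m := by exact_mod_cast Nat.div_le_self m g
    rcases le_or_gt ((m : ℝ) ^ (ε / 20)) g with hgl | hgs
    · have h6 : (divGcd m g Rᶜ).card ≤ m / g := by
        simpa [ZMod.card] using Finset.card_le_univ (divGcd m g Rᶜ)
      calc ((divGcd m g Rᶜ).card : ℝ) ≤ ((m / g : ℕ) : ℝ) := by exact_mod_cast h6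
        _ = m / g := hm'
        _ ≤ m / (m : ℝ) ^ (ε / 20) := by gcongr
        _ = (m : ℝ) ^ (1 - ε / 20) := by rw [Real.rpow_sub hm0, Real.rpow_one]
        _ ≤ _ := Real.rpow_le_rpow_of_exponent_le hm1 (by linarith [min_le_left (ε / 20) δ₁])
    have hsqrt : (m : ℝ) ^ (1 / 2 : ℝ) ≤ ((m / g : ℕ) : ℝ) := by
      rw [hm', le_div_iff₀ hgr]
      calc (m : ℝ) ^ (1 / 2 : ℝ) * g ≤ (m : ℝ) ^ (1 / 2 : ℝ) * (m : ℝ) ^ (1 / 2 : ℝ) := by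
            gcongr
            exact hgs.le.trans (Real.rpow_le_rpow_of_exponent_le hm1 (by linarith))
        _ = m := by rw [← Real.rpow_add hm0]; norm_num
    have hmsq : m ≤ (m / g) ^ 2 := by
      have : (m : ℝ) ≤ ((m / g : ℕ) : ℝ) ^ 2 := by
        calc (m : ℝ) = ((m : ℝ) ^ (1 / 2 : ℝ)) ^ 2 := by
              rw [← Real.rpow_mul_natCast hm0.le]; norm_num
          _ ≤ _ := by gcongr
      exact_mod_cast this
    have hfl : (N₃ : ℝ) / g ≤ 2 * ((N₃ / g : ℕ) : ℝ) := by
      have h6 := Nat.lt_floor_add_one ((N₃ : ℝ) / g)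
      rw [Nat.floor_div_eq_div] at h6
      have h7 : 1 ≤ N₃ / g := by
        refine Nat.div_pos ?_ hg0
        have : (g : ℝ) ≤ N₃ := hgs.le.trans
          ((Real.rpow_le_rpow_of_exponent_le hm1 (by linarith)).trans hN₃l)
        exact_mod_cast this
      have h8 : (1 : ℝ) ≤ ((N₃ / g : ℕ) : ℝ) := by exact_mod_cast h7
      linarith
    have h6 := h₁ (m / g) (h₂.trans hsqrt) N₁ N₂ (N₃ / g) hN₁ hN₂
      ((hN₁₃.trans hmN.le).trans hmsq) ((hN₂₃.trans hmN.le).trans hmsq)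
      ((Nat.div_le_self _ _).trans (hmN.le.trans hmsq))
      (by
        have h7 : (m : ℝ) ^ (1 / 3 + ε / 3 - ε / 20) ≤ N₃ / g := by
          rw [Real.rpow_sub hm0]
          gcongr
        have h8 : ((m / g : ℕ) : ℝ) ^ (1 / 3 + ε / 2 / 3) ≤ (m : ℝ) ^ (1 / 3 + ε / 6) := by
          rw [show ε / 2 / 3 = ε / 6 by ring]
          gcongr
        linarith)
      (by
        have h7 : (m : ℝ) ^ (1 + ε - ε / 20) ≤ N₁ * N₂ * N₃ / g := by
          rw [Real.rpow_sub hm0]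
          gcongr
        have h8 : ((m / g : ℕ) : ℝ) ^ (1 + ε / 2) ≤ (m : ℝ) ^ (1 + ε / 2) := by gcongr
        have h9 : (N₁ * N₂ * N₃ / g : ℝ) ≤ 2 * (N₁ * N₂ * ((N₃ / g : ℕ) : ℝ)) := by
          calc (N₁ * N₂ * N₃ / g : ℝ) = N₁ * N₂ * (N₃ / g) := by ring
            _ ≤ N₁ * N₂ * (2 * ((N₃ / g : ℕ) : ℝ)) := by gcongr
            _ = _ := by ring
        linarith)
      (divGcd m g Rᶜ) (fun x hx => isUnit_of_mem_divGcd hgm hx)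
      (by
        intro x₁ hx₁ x₂ hx₂ x₃ hx₃ hmem
        have h7 := mul_mem_of_mem_divGcd hgm hmem
        rw [Finset.mem_compl] at h7
        rw [Finset.mem_Icc] at hx₃
        apply h7
        rw [show g * (x₁ * x₂ * x₃) = x₁ * x₂ * (x₃ * g) by ring]
        exact hR x₁ hx₁ x₂ hx₂ (x₃ * g) (Finset.mem_Icc.2 ⟨Nat.mul_pos hx₃.1 hg0,
          (Nat.le_div_iff_mul_le hg0).1 hx₃.2⟩))
    have hm'1 : (1 : ℝ) ≤ ((m / g : ℕ) : ℝ) := by exact_mod_cast hm'0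
    calc _ ≤ _ := h6
      _ ≤ ((m / g : ℕ) : ℝ) ^ (1 - δ) :=
        Real.rpow_le_rpow_of_exponent_le hm'1 (by linarith [min_le_right (ε / 20) δ₁])
      _ ≤ _ := Real.rpow_le_rpow (by positivity) hm'm (by linarith)
  rw [card_eq_sum_card_divGcd Rᶜ]
  push_cast
  calc _ ≤ m.divisors.card • ((m : ℝ) ^ (1 - δ)) := Finset.sum_le_card_nsmul _ _ _ key
    _ ≤ (C * (m : ℝ) ^ (δ / 4)) * (m : ℝ) ^ (1 - δ) := by
      rw [nsmul_eq_mul]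
      gcongr
      exact hdiv m (NeZero.ne m)
    _ = C * (m : ℝ) ^ (δ / 4 + (1 - δ)) := by rw [Real.rpow_add hm0]; ring
    _ ≤ _ := h₅

theorem exists_card_compl_le {ε : ℝ} (hε : 0 < ε) :
    ∃ δ : ℝ, 0 < δ ∧ ∃ M : ℝ, ∀ (m : ℕ) [NeZero m], M ≤ m → ∀ N₁ N₂ N₃ : ℕ,
      0 < N₁ → 0 < N₂ → 0 < N₃ → (m : ℝ) ^ (1 + ε) ≤ N₁ * N₂ * N₃ → ∀ R : Finset (ZMod m),
      (∀ x₁ ∈ Finset.Icc 1 N₁, ∀ x₂ ∈ Finset.Icc 1 N₂, ∀ x₃ ∈ Finset.Icc 1 N₃,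
        ((x₁ * x₂ * x₃ : ℕ) : ZMod m) ∈ R) → (Rᶜ.card : ℝ) ≤ (m : ℝ) ^ (1 - δ) := by
  obtain ⟨δ, hδ, M, h⟩ := exists_card_compl_le_of_le (show 0 < min ε 1 by positivity)
    (min_le_right _ _)
  refine ⟨δ, hδ, M, ?_⟩
  intro m _ hM N₁ N₂ N₃ hN₁ hN₂ hN₃ hN R hR
  have hm1 : (1 : ℝ) ≤ m := by exact_mod_cast NeZero.pos m
  have hN' : (m : ℝ) ^ (1 + min ε 1) ≤ N₁ * N₂ * N₃ :=
    (Real.rpow_le_rpow_of_exponent_le hm1 (by linarith [min_le_left ε 1])).trans hN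
  by_cases h3 : N₁ ≤ N₃ ∧ N₂ ≤ N₃
  · exact h m hM N₁ N₂ N₃ hN₁ hN₂ hN₃ h3.1 h3.2 hN' R hR
  by_cases h2 : N₁ ≤ N₂ ∧ N₃ ≤ N₂
  · refine h m hM N₁ N₃ N₂ hN₁ hN₃ hN₂ h2.1 h2.2 (by linarith) R fun x₁ hx₁ x₃ hx₃ x₂ hx₂ => ?_
    rw [mul_right_comm]
    exact hR x₁ hx₁ x₂ hx₂ x₃ hx₃
  · refine h m hM N₂ N₃ N₁ hN₂ hN₃ hN₁ (by omega) (by omega) (by linarith) R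
      fun x₂ hx₂ x₃ hx₃ x₁ hx₁ => ?_
    rw [mul_comm, ← mul_assoc]
    exact hR x₁ hx₁ x₂ hx₂ x₃ hx₃

end AllResidues

end ThreeProducts

/-- For every fixed ε > 0 there is δ > 0 and a constant C such that for all sufficiently
large m and all positive N₁, N₂, N₃ with N₁N₂N₃ > m^(1+ε), the number of residue classes
x₁x₂x₃ mod m with xⱼ ∈ [1,Nⱼ] equals m + O(m^(1-δ)). -/
theorem stmt0 :
    ∀ ε : ℝ, 0 < ε → ∃ δ : ℝ, 0 < δ ∧ ∃ C : ℝ, 0 < C ∧ ∃ M : ℕ, ∀ m : ℕ, M ≤ m →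
      ∀ N₁ N₂ N₃ : ℕ, 0 < N₁ → 0 < N₂ → 0 < N₃ →
      (m : ℝ) ^ ((1 : ℝ) + ε) < ((N₁ * N₂ * N₃ : ℕ) : ℝ) →
      |(((Finset.Icc 1 N₁ ×ˢ Finset.Icc 1 N₂ ×ˢ Finset.Icc 1 N₃).image
          (fun t => ((t.1 * t.2.1 * t.2.2 : ℕ) : ZMod m))).card : ℝ) - (m : ℝ)|
        ≤ C * (m : ℝ) ^ ((1 : ℝ) - δ) := by
  intro ε hε
  obtain ⟨δ, hδ, M, h⟩ := ThreeProducts.exists_card_compl_le hε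
  refine ⟨δ, hδ, 1, one_pos, max 1 ⌈M⌉₊, fun m hm N₁ N₂ N₃ hN₁ hN₂ hN₃ hN => ?_⟩
  have : NeZero m := ⟨by have := le_of_max_le_left hm; omega⟩
  set R := (Finset.Icc 1 N₁ ×ˢ Finset.Icc 1 N₂ ×ˢ Finset.Icc 1 N₃).image
    (fun t => ((t.1 * t.2.1 * t.2.2 : ℕ) : ZMod m)) with hR
  have h1 := h m (Nat.ceil_le.1 (le_of_max_le_right hm)) N₁ N₂ N₃ hN₁ hN₂ hN₃
    (by push_cast at hN; exact hN.le) R fun x₁ hx₁ x₂ hx₂ x₃ hx₃ =>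
      Finset.mem_image.2 ⟨(x₁, x₂, x₃), by simp only [Finset.mem_product]; exact ⟨hx₁, hx₂, hx₃⟩, rfl⟩
  have h2 : (R.card : ℝ) + Rᶜ.card = m := by
    have := Finset.card_add_card_compl R
    rw [ZMod.card] at this
    exact_mod_cast this
  rw [one_mul, ← h2, sub_add_cancel_left, abs_neg, abs_of_nonneg (by positivity), h2]
  exact h1
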